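/- (Isometry property of the Poisson transform.) Let n ≥ 2, 0 ≤ p ≤ n/2 and 2 − n + 2p < a < 1. Then for every f ∈ Ḣ^{(1−a)/2,p}(ℝ^{n−1}) one has ‖P_{a,p} f‖_{(2−a)/2,p}² = [2√π (n − 2p − a + 2) Γ((2−a)/2) / ((n − 2p − a) Γ((1−a)/2))] · ‖f‖_{(1−a)/2,p}², where ‖·‖_{(2−a)/2,p} and ‖·‖_{(1−a)/2,p} are the conformally invariant norms on Ḣ^{(2−a)/2,p}(ℝ^n) and Ḣ^{(1−a)/2,p}(ℝ^{n−1}) respectively. In particular P_{a,p} is, up to an explicit constant, an isometry. -/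

import Mathlib

open MeasureTheory Complex Finset

noncomputable section

/-- Euclidean space ℝ^n -/
abbrev Rn (n : ℕ) := EuclideanSpace ℝ (Fin n)

/-- The full exterior algebra Λ^•ℂ^n, realized as the Euclidean space with orthonormal
basis indexed by subsets of {1,…,n} (the basis e_S = e_{i_1}∧…∧e_{i_p}). -/
abbrev Lam (n : ℕ) := EuclideanSpace ℂ (Finset (Fin n))

variable {n : ℕ}

/-- the sign (-1)^{#{i ∈ S : i < j}} -/
def wsign (j : Fin n) (S : Finset (Fin n)) : ℂ := (-1) ^ (S.filter (· < j)).card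

/-- exterior multiplication ε_x by x ∈ ℂ^n -/
def eps (x : Fin n → ℂ) (v : Lam n) : Lam n :=
  WithLp.toLp 2 (fun S => ∑ j ∈ S, wsign j S * x j * v (S.erase j))

/-- interior multiplication i_x by x ∈ ℂ^n (adjoint of ε_x for real x) -/
def iot (x : Fin n → ℂ) (v : Lam n) : Lam n :=
  WithLp.toLp 2 (fun S => ∑ j ∈ Sᶜ, wsign j S * x j * v (insert j S))

/-- v lies in the degree-p part Λ^p ℂ^n ⊆ Λ^• ℂ^n -/
def IsForm (p : ℕ) (v : Lam n) : Prop := ∀ S, S.card ≠ p → v S = 0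

/-- complexification of a real vector -/
def rc (x : Fin n → ℝ) : Fin n → ℂ := fun j => (x j : ℂ)

/-- the j-th standard basis vector of ℂ^n -/
def ee (j : Fin n) : Fin n → ℂ := fun i => if i = j then 1 else 0

/-- extend x' ∈ ℝ^{n-1} by last coordinate t to the vector (x',t) ∈ ℝ^n -/
def app (x' : Rn (n-1)) (t : ℝ) : Rn n :=
  WithLp.toLp 2 (fun j => if h : (j : ℕ) < n - 1 then x' ⟨j, h⟩ else t)

/-- restriction ℝ^n → ℝ^{n-1}, x ↦ x' -/
def restr (ξ : Rn n) : Rn (n-1) := WithLp.toLp 2 (fun i => ξ (Fin.castLE (Nat.sub_le n 1) i))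

/-- the embedding Fin (n-1) ↪ Fin n -/
def embF : Fin (n-1) ↪ Fin n := ⟨Fin.castLE (Nat.sub_le n 1), (Fin.castLE_injective _)⟩

/-- pullback Λ^• ℂ^n → Λ^• ℂ^{n-1}; on p-forms this is the projection i_{e_n} ε_{e_n}
followed by restriction of indices. -/
def projL (v : Lam n) : Lam (n-1) := WithLp.toLp 2 (fun T => v (T.map embF))

/-- the inclusion Λ^• ℂ^{n-1} ⊆ Λ^• ℂ^n -/
def incL (v : Lam (n-1)) : Lam n :=
  WithLp.toLp 2 (fun S => ∑ T : Finset (Fin (n-1)), if T.map embF = S then v T else 0)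

/-- the operator i_z ε_z - ε_z i_z -/
def cmm (z : Fin n → ℂ) (v : Lam n) : Lam n := iot z (eps z v) - eps z (iot z v)

/-- partial derivative ∂/∂x_j -/
def pd (j : Fin n) (u : Rn n → Lam n) : Rn n → Lam n :=
  fun x => fderiv ℝ u x (EuclideanSpace.single j 1)

/-- the differential operator Δ_{a,p} = x_n²Δ + a x_n ∂_n + 2x_n(i_{e_n}d' - ε_{e_n}δ')
- (n-2p) ε_{e_n} i_{e_n}; here ℓ is the index of the last coordinate. -/
def Dap (a : ℝ) (p : ℕ) (ℓ : Fin n) (u : Rn n → Lam n) (x : Rn n) : Lam n :=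
  ((x ℓ)^2 : ℝ) • (∑ j, pd j (pd j u) x)
  + (a * x ℓ) • pd ℓ u x
  + (2 * x ℓ) • (iot (ee ℓ) (∑ j ∈ univ.erase ℓ, eps (ee j) (pd j u x))
      - eps (ee ℓ) (-(∑ j ∈ univ.erase ℓ, iot (ee j) (pd j u x))))
  - ((n : ℝ) - 2*p) • eps (ee ℓ) (iot (ee ℓ) (u x))

/-- the formal transpose of Δ_{a,p} with respect to the bilinear pairing
∫ ⟨u(x), φ(x)⟩ dx (⟨·,·⟩ the bilinear form with ⟨e_S, e_T⟩ = δ_{ST}):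
Δ_{a,p}ᵗφ = Δ(x_n²φ) - a ∂_n(x_n φ) - 2x_n Σ_j (i_{e_j}ε_{e_n} + ε_{e_j}i_{e_n}) ∂_j φ
- (n-2p) ε_{e_n} i_{e_n} φ. -/
def DapT (a : ℝ) (p : ℕ) (ℓ : Fin n) (φ : Rn n → Lam n) (x : Rn n) : Lam n :=
  (∑ j, pd j (pd j (fun y => ((y ℓ)^2 : ℝ) • φ y)) x)
  - a • pd ℓ (fun y => (y ℓ) • φ y) x
  - (2 * x ℓ) • (∑ j ∈ univ.erase ℓ,
      (iot (ee j) (eps (ee ℓ) (pd j φ x)) + eps (ee j) (iot (ee ℓ) (pd j φ x))))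
  - ((n : ℝ) - 2*p) • eps (ee ℓ) (iot (ee ℓ) (φ x))

/-- the Fourier transform with the convention û(ξ) = (2π)^{-n/2} ∫ e^{-i x·ξ} u(x) dx -/
def ft (u : Rn n → Lam n) : Rn n → Lam n := fun ξ =>
  ((2 * Real.pi) ^ (-(n:ℝ)/2) : ℝ) •
    ∫ x, Complex.exp (-(((∑ j, x j * ξ j : ℝ) : ℂ) * Complex.I)) • u x

/-- the inverse Fourier transform -/
def ftInv (u : Rn n → Lam n) : Rn n → Lam n := fun ξ =>
  ((2 * Real.pi) ^ (-(n:ℝ)/2) : ℝ) •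
    ∫ x, Complex.exp ((((∑ j, x j * ξ j : ℝ) : ℂ) * Complex.I)) • u x

/-- The homogeneous Sobolev space Ḣ^{s,p}(ℝ^n) of Λ^pℂ^n-valued tempered distributions,
modeled on the Fourier transform side: an element of the set is the function g = û. -/
def Hdot (n : ℕ) (s : ℝ) (p : ℕ) : Set (Rn n → Lam n) :=
  {g | AEStronglyMeasurable g volume ∧ (∀ ξ, IsForm p (g ξ)) ∧
    Integrable (fun ξ => ‖ξ‖ ^ (2*s) * ‖g ξ‖^2)}

/-- squared weighted L² norm ∫ ‖ξ‖^t ‖g(ξ)‖² dξ on the Fourier side;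
wInt (2s) g is the squared homogeneous Sobolev norm of degree s of u with û = g. -/
def wInt (t : ℝ) (g : Rn n → Lam n) : ℝ := ∫ ξ, ‖ξ‖ ^ t * ‖g ξ‖^2

/-- the operator (c - λ) i_x ε_x + (c + λ) ε_x i_x on Λ^•ℂ^n -/
def opC (c lam : ℝ) (x : Fin n → ℝ) (v : Lam n) : Lam n :=
  ((c - lam : ℝ) : ℂ) • iot (rc x) (eps (rc x) v)
    + ((c + lam : ℝ) : ℂ) • eps (rc x) (iot (rc x) v)

/-- the conformally invariant squared norm ‖u‖_λ² on the Fourier side (for û = g);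
c is dim/2 - p, i.e. n/2 - p on ℝ^n and (n-1)/2 - p on ℝ^{n-1}. -/
def cSq (c lam : ℝ) (g : Rn n → Lam n) : ℝ :=
  ∫ ξ, ‖ξ‖ ^ (-(2*lam)) * (inner ℂ (g ξ) (opC c lam (‖ξ‖⁻¹ • ξ) (g ξ)) : ℂ).re

/-- the conformally invariant inner product on the Fourier side -/
def cIp (c lam : ℝ) (g h : Rn n → Lam n) : ℂ :=
  ∫ ξ, (‖ξ‖ ^ (-(2*lam)) : ℝ) • (inner ℂ (g ξ) (opC c lam (‖ξ‖⁻¹ • ξ) (h ξ)) : ℂ)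

/-- the bilinear pairing on Λ^•ℂ^n with ⟨e_S, e_T⟩ = δ_{ST} -/
def blin (v w : Lam n) : ℂ := ∑ S, v S * w S

/-- the pairing ⟨u, ψ⟩ of the tempered distribution u whose Fourier transform is g
with a Schwartz function ψ: ⟨u, ψ⟩ = ⟨û, 𝓕⁻¹ψ⟩ = ∫ ⟨g(ξ), (𝓕⁻¹ψ)(ξ)⟩ dξ. -/
def dpair (g : Rn n → Lam n) (ψ : Rn n → Lam n) : ℂ :=
  ∫ ξ, blin (g ξ) (ftInv ψ ξ)

/-- "Δ_{a,p} u = μ u in the sense of tempered distributions", expressed for the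
distribution u whose Fourier transform is g: testing against all Λ^•ℂ^n-valued
Schwartz functions φ via the formal transpose of Δ_{a,p}. -/
def WeakEig (a : ℝ) (p : ℕ) (ℓ : Fin n) (g : Rn n → Lam n) (μ : ℂ) : Prop :=
  ∀ φ : SchwartzMap (Rn n) (Lam n),
    dpair g (fun x => DapT a p ℓ (fun y => φ y) x - μ • φ x) = 0

/-- the Fourier side of the trace map u ↦ u|_{ℝ^{n-1}}:
(Ru)^(ξ') = (2π)^{-1/2} ∫_ℝ û(ξ', ξ_n) dξ_n, composed with the pullback
Λ^pℂ^n → Λ^pℂ^{n-1}. -/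
def ftrace (g : Rn n → Lam n) : Rn (n-1) → Lam (n-1) := fun ξ' =>
  ((2 * Real.pi) ^ (-(1:ℝ)/2) : ℝ) • ∫ t : ℝ, projL (g (app ξ' t))

/-- the constant c_{a,p} -/
def cP (n p : ℕ) (a : ℝ) : ℝ :=
  2 * Real.Gamma (((n:ℝ) - a + 2)/2) /
    (Real.pi ^ (((n:ℝ)-1)/2) * ((n:ℝ) - 2*p - a) * Real.Gamma ((1-a)/2))

/-- the Poisson transform P_{a,p}f(x) = c_{a,p} ∫_{ℝ^{n-1}} |x_n|^{1-a}
(|x'-y|²+x_n²)^{-(n-a+2)/2} (i_{x-y}ε_{x-y} - ε_{x-y}i_{x-y}) f(y) dy,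
where ℓ is the index of the last coordinate. -/
def Pois (a : ℝ) (p : ℕ) (ℓ : Fin n) (f : Rn (n-1) → Lam (n-1)) (x : Rn n) : Lam n :=
  cP n p a • ∫ y : Rn (n-1),
    (|x ℓ| ^ (1-a) * ‖x - app y 0‖ ^ (-((n:ℝ) - a + 2))) •
      cmm (rc (x - app y 0)) (incL (f y))

/-- "G is the Fourier transform of the (polynomially bounded, locally integrable)
function u in the sense of tempered distributions":
∫ ⟨G(ξ), ψ(ξ)⟩ dξ = ∫ ⟨u(x), ψ̂(x)⟩ dx for every Schwartz function ψ. -/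
def IsFTof (G : Rn n → Lam n) (u : Rn n → Lam n) : Prop :=
  ∀ ψ : SchwartzMap (Rn n) (Lam n),
    ∫ ξ, blin (G ξ) (ψ ξ) = ∫ x, blin (u x) (ft (fun y => ψ y) x)

set_option linter.all false

section
variable {n : ℕ}

lemma eps_apply (x : Fin n → ℂ) (v : Lam n) (S) :
    eps x v S = ∑ j ∈ S, wsign j S * x j * v (S.erase j) := rfl
lemma iot_apply (x : Fin n → ℂ) (v : Lam n) (S) :
    iot x v S = ∑ j ∈ Sᶜ, wsign j S * x j * v (insert j S) := rfl

lemma eps_add (x : Fin n → ℂ) (v w : Lam n) : eps x (v + w) = eps x v + eps x w := by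
  ext S; simp [eps_apply, mul_add, Finset.sum_add_distrib]
lemma iot_add (x : Fin n → ℂ) (v w : Lam n) : iot x (v + w) = iot x v + iot x w := by
  ext S; simp [iot_apply, mul_add, Finset.sum_add_distrib]
lemma eps_smul (x : Fin n → ℂ) (c : ℂ) (v : Lam n) : eps x (c • v) = c • eps x v := by
  ext S; simp [eps_apply, Finset.mul_sum]
  exact Finset.sum_congr rfl fun _ _ => by ring
lemma iot_smul (x : Fin n → ℂ) (c : ℂ) (v : Lam n) : iot x (c • v) = c • iot x v := by
  ext S; simp [iot_apply, Finset.mul_sum]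
  exact Finset.sum_congr rfl fun _ _ => by ring
lemma eps_add_left (x y : Fin n → ℂ) (v : Lam n) : eps (x + y) v = eps x v + eps y v := by
  ext S; simp [eps_apply, mul_add, add_mul, Finset.sum_add_distrib]
lemma iot_add_left (x y : Fin n → ℂ) (v : Lam n) : iot (x + y) v = iot x v + iot y v := by
  ext S; simp [iot_apply, mul_add, add_mul, Finset.sum_add_distrib]
lemma eps_smul_left (c : ℂ) (x : Fin n → ℂ) (v : Lam n) : eps (c • x) v = c • eps x v := by
  ext S; simp [eps_apply, Finset.mul_sum]
  exact Finset.sum_congr rfl fun _ _ => by ring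
lemma iot_smul_left (c : ℂ) (x : Fin n → ℂ) (v : Lam n) : iot (c • x) v = c • iot x v := by
  ext S; simp [iot_apply, Finset.mul_sum]
  exact Finset.sum_congr rfl fun _ _ => by ring

/-- exterior multiplication as a continuous linear map -/
def epsL (x : Fin n → ℂ) : Lam n →L[ℂ] Lam n :=
  LinearMap.toContinuousLinearMap
    { toFun := eps x, map_add' := eps_add x, map_smul' := fun c v => eps_smul x c v }
/-- interior multiplication as a continuous linear map -/
def iotL (x : Fin n → ℂ) : Lam n →L[ℂ] Lam n :=
  LinearMap.toContinuousLinearMap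
    { toFun := iot x, map_add' := iot_add x, map_smul' := fun c v => iot_smul x c v }
lemma epsL_apply (x : Fin n → ℂ) (v : Lam n) : epsL x v = eps x v := rfl
lemma iotL_apply (x : Fin n → ℂ) (v : Lam n) : iotL x v = iot x v := rfl

/-! signs -/
lemma wsign_sq (j : Fin n) (S) : wsign j S * wsign j S = 1 := by
  unfold wsign; rw [← mul_pow]; simp
lemma wsign_insert_self (j : Fin n) (S) : wsign j (insert j S) = wsign j S := by
  unfold wsign; rw [Finset.filter_insert]; simp
lemma wsign_erase_self (j : Fin n) (S : Finset (Fin n)) : wsign j (S.erase j) = wsign j S := by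
  unfold wsign; congr 2; ext i; simp; intro h _ ; exact h.ne
lemma wsign_insert (i j : Fin n) (S) (hj : j ∉ S) :
    wsign i (insert j S) = wsign i S * (if j < i then -1 else 1) := by
  unfold wsign; rw [Finset.filter_insert]
  split_ifs with h
  · rw [Finset.card_insert_of_notMem (by simp [hj]), pow_succ]
  · simp
lemma wsign_erase (i j : Fin n) (S : Finset (Fin n)) (hi : i ∈ S) :
    wsign j (S.erase i) = wsign j S * (if i < j then -1 else 1) := by
  have := wsign_insert j i (S.erase i) (by simp)
  rw [Finset.insert_erase hi] at this
  rw [this]; split_ifs <;> ring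

lemma wsign_anti1 (i j : Fin n) (S : Finset (Fin n)) (hi : i ∈ S) (hj : j ∉ S) :
    wsign j S * wsign i (insert j S) = - (wsign i S * wsign j (S.erase i)) := by
  rw [wsign_insert _ _ _ hj, wsign_erase _ _ _ hi]
  have hne : i ≠ j := by rintro rfl; exact hj hi
  rcases lt_or_gt_of_ne hne with h | h
  · simp [h, h.not_gt]; ring
  · simp [h, h.not_gt]; ring
lemma wsign_anti2 (i j : Fin n) (S : Finset (Fin n)) (hi : i ∉ S) (hj : j ∉ S) (hne : i ≠ j) :
    wsign j S * wsign i (insert j S) = - (wsign i S * wsign j (insert i S)) := by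
  rw [wsign_insert _ _ _ hj, wsign_insert _ _ _ hi]
  rcases lt_or_gt_of_ne hne with h | h
  · simp [h, h.not_gt]; ring
  · simp [h, h.not_gt]; ring

/-- the canonical anticommutation relation -/
lemma iot_eps (x y : Fin n → ℂ) (v : Lam n) :
    iot x (eps y v) + eps y (iot x v) = (∑ j, x j * y j) • v := by
  ext S
  simp only [PiLp.add_apply, PiLp.smul_apply, smul_eq_mul, iot_apply, eps_apply]
  have h1 : ∀ j ∈ Sᶜ, wsign j S * x j * ∑ i ∈ insert j S, wsign i (insert j S) * y i * v ((insert j S).erase i)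
      = x j * y j * v S + ∑ i ∈ S, wsign j S * wsign i (insert j S) * x j * y i * v ((insert j S).erase i) := by
    intro j hj
    have hj' : j ∉ S := by simpa using hj
    rw [Finset.sum_insert hj', mul_add, Finset.erase_insert hj', wsign_insert_self, Finset.mul_sum]
    congr 1
    · linear_combination (x j * y j * v S) * wsign_sq j S
    · exact Finset.sum_congr rfl fun _ _ => by ring
  have h2 : ∀ i ∈ S, wsign i S * y i * ∑ j ∈ (S.erase i)ᶜ, wsign j (S.erase i) * x j * v (insert j (S.erase i))
      = x i * y i * v S - ∑ j ∈ Sᶜ, wsign j S * wsign i (insert j S) * x j * y i * v ((insert j S).erase i) := by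
    intro i hi
    have : (S.erase i)ᶜ = insert i Sᶜ := by simp
    rw [this, Finset.sum_insert (by simpa using hi), mul_add, Finset.insert_erase hi, wsign_erase_self, Finset.mul_sum,
      sub_eq_add_neg, ← Finset.sum_neg_distrib]
    congr 1
    · linear_combination (x i * y i * v S) * wsign_sq i S
    · refine Finset.sum_congr rfl fun j hj => ?_
      have hj' : j ∉ S := by simpa using hj
      have hne : i ≠ j := by rintro rfl; exact hj' hi
      rw [wsign_anti1 i j S hi hj', Finset.erase_insert_of_ne hne.symm]; ring
  rw [Finset.sum_congr rfl h1, Finset.sum_congr rfl h2, Finset.sum_add_distrib, Finset.sum_sub_distrib,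
    Finset.sum_comm (s := S) (t := Sᶜ), ← Finset.sum_compl_add_sum S (fun j => x j * y j), add_mul, Finset.sum_mul,
    Finset.sum_mul]
  ring

lemma iot_iot (x y : Fin n → ℂ) (v : Lam n) : iot x (iot y v) = - iot y (iot x v) := by
  have key : ∀ (x y : Fin n → ℂ) (S : Finset (Fin n)), iot x (iot y v) S =
      ∑ j, ∑ i, if j ∉ S ∧ i ∉ S ∧ i ≠ j then wsign j S * wsign i (insert j S) * x j * y i * v (insert i (insert j S)) else 0 := by
    intro x y S
    simp only [iot_apply]
    rw [← Finset.sum_compl_add_sum S (fun j => ∑ i, _), Finset.sum_eq_zero (s := S), add_zero]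
    · refine Finset.sum_congr rfl fun j hj => ?_
      have hj' : j ∉ S := by simpa using hj
      rw [Finset.mul_sum, ← Finset.sum_compl_add_sum (insert j S) (fun i => ite _ _ _), Finset.sum_eq_zero (s := insert j S), add_zero]
      · refine Finset.sum_congr rfl fun i hi => ?_
        have : i ≠ j ∧ i ∉ S := by simpa [not_or] using hi
        rw [if_pos ⟨hj', this.2, this.1⟩]; ring
      · intro i hi
        rw [if_neg]; rintro ⟨_, h2, h3⟩
        simp [h2, h3] at hi
    · intro j hj; exact Finset.sum_eq_zero fun i _ => by simp [hj]
  ext S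
  rw [PiLp.neg_apply, key, key, Finset.sum_comm, ← Finset.sum_neg_distrib]
  refine Finset.sum_congr rfl fun i _ => ?_
  rw [← Finset.sum_neg_distrib]
  refine Finset.sum_congr rfl fun j _ => ?_
  by_cases h : j ∉ S ∧ i ∉ S ∧ i ≠ j
  · rw [if_pos h, if_pos ⟨h.2.1, h.1, h.2.2.symm⟩, wsign_anti2 i j S h.2.1 h.1 h.2.2, Finset.insert_comm]; ring
  · rw [if_neg h, if_neg (fun h' => h ⟨h'.2.1, h'.1, h'.2.2.symm⟩)]; simp

lemma blin_eps (x : Fin n → ℂ) (v w : Lam n) : blin v (eps x w) = blin (iot x v) w := by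
  unfold blin
  simp only [eps_apply, iot_apply, Finset.mul_sum, Finset.sum_mul]
  rw [Finset.sum_sigma', Finset.sum_sigma']
  refine Finset.sum_bij' (fun a _ => ⟨a.1.erase a.2, a.2⟩) (fun a _ => ⟨insert a.2 a.1, a.2⟩) ?_ ?_ ?_ ?_ ?_
  · rintro ⟨S, j⟩ h; simp
  · rintro ⟨S, j⟩ h; simp
  · rintro ⟨S, j⟩ h; simp at h; simp [Finset.insert_erase h]
  · rintro ⟨S, j⟩ h; simp at h; simp [Finset.erase_insert h]
  · rintro ⟨S, j⟩ h; simp at h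
    simp only [wsign_erase_self, Finset.insert_erase h]; ring

lemma blin_comm (v w : Lam n) : blin v w = blin w v := by
  unfold blin; exact Finset.sum_congr rfl fun _ _ => mul_comm _ _
lemma blin_iot (x : Fin n → ℂ) (v w : Lam n) : blin v (iot x w) = blin (eps x v) w := by
  rw [blin_comm, ← blin_eps, blin_comm]
lemma blin_single (v : Lam n) (S : Finset (Fin n)) : blin v (EuclideanSpace.single S 1) = v S := by
  unfold blin; simp
lemma eps_eps (x y : Fin n → ℂ) (v : Lam n) : eps x (eps y v) = - eps y (eps x v) := by
  ext S
  rw [← blin_single, ← blin_single, ← blin_iot, ← blin_iot, iot_iot]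
  have : - eps y (eps x v) = (-1 : ℂ) • eps y (eps x v) := by simp
  rw [this]
  unfold blin
  have := blin_iot y (eps x v) (EuclideanSpace.single S 1)
  have h2 := blin_iot x v (iot y (EuclideanSpace.single S 1))
  unfold blin at this h2
  simp only [PiLp.neg_apply, mul_neg, Finset.sum_neg_distrib, PiLp.smul_apply, smul_eq_mul, mul_assoc, ← Finset.mul_sum]
  rw [h2, this]; ring

lemma self_zero {v : Lam n} (h : v = -v) : v = 0 := by
  have : (2 : ℂ) • v = 0 := by rw [two_smul]; nth_rw 1 [h]; simp
  simpa using this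
lemma eps_eps_self (x : Fin n → ℂ) (v : Lam n) : eps x (eps x v) = 0 := self_zero (eps_eps x x v)
lemma iot_iot_self (x : Fin n → ℂ) (v : Lam n) : iot x (iot x v) = 0 := self_zero (iot_iot x x v)

lemma inner_eq_blin (v w : Lam n) : inner ℂ v w = blin (WithLp.toLp 2 fun S => (starRingEnd ℂ) (v S)) w := by
  unfold blin
  rw [PiLp.inner_apply]
  exact Finset.sum_congr rfl fun _ _ => by simp [mul_comm]

lemma inner_eps (x : Fin n → ℝ) (v w : Lam n) : inner ℂ v (eps (rc x) w) = inner ℂ (iot (rc x) v) w := by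
  rw [inner_eq_blin, blin_eps, inner_eq_blin]
  congr 1
  ext S
  have hw : ∀ j, (starRingEnd ℂ) (wsign j S) = wsign j S := fun j => by simp [wsign]
  simp [iot_apply, rc, hw]

lemma inner_self_ofReal (w : Lam n) : inner ℂ w w = ((‖w‖^2 : ℝ) : ℂ) := by
  rw [inner_self_eq_norm_sq_to_K]; push_cast; rfl

lemma re_inner_opC (c lam : ℝ) (x : Fin n → ℝ) (hx : ∑ j, x j * x j = 1) (v : Lam n) :
    (inner ℂ v (opC c lam x v) : ℂ).re = (c - lam) * ‖v‖^2 + 2 * lam * ‖iot (rc x) v‖^2 := by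
  have h := iot_eps (rc x) (rc x) v
  have h1 : (∑ j, rc x j * rc x j) = 1 := by
    unfold rc; exact_mod_cast hx
  rw [h1, one_smul] at h
  unfold opC
  rw [eq_sub_of_add_eq h, inner_add_right, inner_smul_right, inner_smul_right, inner_sub_right, inner_eps,
    inner_self_ofReal, inner_self_ofReal]
  simp only [← ofReal_sub, ← ofReal_mul, ← ofReal_add, ofReal_re]
  ring
end

section
variable {n : ℕ} {m : ℕ}

lemma cmm_eq (z : Fin n → ℂ) (v : Lam n) :
    cmm z v = (∑ j, z j * z j) • v - (2:ℂ) • eps z (iot z v) := by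
  unfold cmm
  rw [← iot_eps z z v, two_smul]; abel

lemma eps_zero_left (v : Lam n) : eps 0 v = 0 := by ext S; simp [eps_apply]
lemma iot_zero_left (v : Lam n) : iot 0 v = 0 := by ext S; simp [iot_apply]
lemma eps_sum_left {ι : Type*} (s : Finset ι) (x : ι → Fin n → ℂ) (v : Lam n) :
    eps (∑ i ∈ s, x i) v = ∑ i ∈ s, eps (x i) v := by
  classical
  induction s using Finset.induction_on with
  | empty => simp [eps_zero_left]
  | insert a s ha ih => rw [Finset.sum_insert ha, Finset.sum_insert ha, eps_add_left, ih]
lemma iot_sum_left {ι : Type*} (s : Finset ι) (x : ι → Fin n → ℂ) (v : Lam n) :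
    iot (∑ i ∈ s, x i) v = ∑ i ∈ s, iot (x i) v := by
  classical
  induction s using Finset.induction_on with
  | empty => simp [iot_zero_left]
  | insert a s ha ih => rw [Finset.sum_insert ha, Finset.sum_insert ha, iot_add_left, ih]

lemma vec_eq_sum (x : Fin n → ℂ) : x = ∑ j, x j • ee j := by
  ext i; simp [ee]
lemma eps_eq_sum (x : Fin n → ℂ) (v : Lam n) : eps x v = ∑ j, x j • eps (ee j) v := by
  conv_lhs => rw [vec_eq_sum x]
  rw [eps_sum_left]; exact Finset.sum_congr rfl fun _ _ => eps_smul_left _ _ _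
lemma iot_eq_sum (x : Fin n → ℂ) (v : Lam n) : iot x v = ∑ j, x j • iot (ee j) v := by
  conv_lhs => rw [vec_eq_sum x]
  rw [iot_sum_left]; exact Finset.sum_congr rfl fun _ _ => iot_smul_left _ _ _

lemma eps_ee_apply (i : Fin n) (v : Lam n) (S) :
    eps (ee i) v S = if i ∈ S then wsign i S * v (S.erase i) else 0 := by
  rw [eps_apply]
  split_ifs with h
  · rw [Finset.sum_eq_single i] <;> simp +contextual [ee, h]
  · refine Finset.sum_eq_zero fun j hj => ?_
    have : j ≠ i := by rintro rfl; exact h hj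
    simp [ee, this]
lemma iot_ee_apply (i : Fin n) (v : Lam n) (S) :
    iot (ee i) v S = if i ∉ S then wsign i S * v (insert i S) else 0 := by
  rw [iot_apply]
  by_cases h : i ∈ S
  · rw [if_neg (not_not.2 h)]
    refine Finset.sum_eq_zero fun j hj => ?_
    have : j ≠ i := by rintro rfl; simp at hj; exact hj h
    simp [ee, this]
  · rw [if_pos h]
    rw [Finset.sum_eq_single i] <;> simp +contextual [ee, h]

lemma sum_eps_iot {p : ℕ} (v : Lam n) (hv : IsForm p v) : ∑ j, eps (ee j) (iot (ee j) v) = (p : ℂ) • v := by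
  ext S
  have : ∀ j, eps (ee j) (iot (ee j) v) S = if j ∈ S then v S else 0 := by
    intro j
    rw [eps_ee_apply]
    split_ifs with h
    · rw [iot_ee_apply, if_pos (by simp), Finset.insert_erase h, wsign_erase_self, ← mul_assoc, wsign_sq, one_mul]
    · rfl
  rw [WithLp.ofLp_sum, Finset.sum_apply]
  simp only [this, PiLp.smul_apply, smul_eq_mul]
  rw [Finset.sum_ite_mem, Finset.univ_inter, Finset.sum_const, nsmul_eq_mul]
  by_cases hS : S.card = p
  · rw [hS]
  · rw [hv S hS]; simp

/-! the inclusion in codimension one -/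
/-- the inclusion of forms -/
def inc (v : Lam m) : Lam (m+1) := incL (n := m+1) v
/-- the pullback of forms -/
def prj (v : Lam (m+1)) : Lam m := projL (n := m+1) v
/-- the vector (x', t) -/
def ap (x : Rn m) (t : ℝ) : Rn (m+1) := app (n := m+1) x t
/-- extension by zero -/
def exz (x : Fin m → ℂ) : Fin (m+1) → ℂ := fun j => if h : (j:ℕ) < m then x ⟨j, h⟩ else 0
lemma exz_castSucc (x : Fin m → ℂ) (j : Fin m) : exz x j.castSucc = x j := by simp [exz]
lemma exz_last (x : Fin m → ℂ) : exz x (Fin.last m) = 0 := by simp [exz]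
lemma ap_castSucc (x : Rn m) (t : ℝ) (j : Fin m) : ap x t j.castSucc = x j := by
  simp [ap, app]
lemma ap_last (x : Rn m) (t : ℝ) : ap x t (Fin.last m) = t := by simp [ap, app]

lemma prj_apply (v : Lam (m+1)) (T : Finset (Fin m)) : prj v T = v (T.map Fin.castSuccEmb) := rfl
lemma inc_map (v : Lam m) (T : Finset (Fin m)) : inc v (T.map Fin.castSuccEmb) = v T := by
  have : inc v (T.map Fin.castSuccEmb) = ∑ T' : Finset (Fin m), if T'.map Fin.castSuccEmb = T.map Fin.castSuccEmb then v T' else 0 := rfl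
  rw [this, Finset.sum_eq_single T] <;> simp +contextual [Finset.map_inj]
lemma inc_last (v : Lam m) (S : Finset (Fin (m+1))) (h : Fin.last m ∈ S) : inc v S = 0 := by
  have : inc v S = ∑ T' : Finset (Fin m), if T'.map Fin.castSuccEmb = S then v T' else 0 := rfl
  rw [this]
  refine Finset.sum_eq_zero fun T _ => if_neg ?_
  rintro rfl
  simp only [Finset.mem_map, Fin.coe_castSuccEmb] at h
  obtain ⟨a, _, ha⟩ := h
  exact (Fin.castSucc_lt_last a).ne ha
lemma exists_map (S : Finset (Fin (m+1))) (h : Fin.last m ∉ S) : ∃ T : Finset (Fin m), S = T.map Fin.castSuccEmb := by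
  refine ⟨Finset.univ.filter (fun j => j.castSucc ∈ S), ?_⟩
  ext j
  simp only [Finset.mem_map, Finset.mem_filter, Finset.mem_univ, true_and, Fin.coe_castSuccEmb]
  constructor
  · intro hj
    have : j ≠ Fin.last m := by rintro rfl; exact h hj
    exact ⟨j.castPred this, by simpa using hj, by simp⟩
  · rintro ⟨a, ha, rfl⟩; exact ha
lemma last_notMem_map (T : Finset (Fin m)) : Fin.last m ∉ T.map Fin.castSuccEmb := by
  simp only [Finset.mem_map, Fin.coe_castSuccEmb, not_exists, not_and]
  intro a _ ha; exact (Fin.castSucc_lt_last a).ne ha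

lemma iot_inc (x : Fin m → ℂ) (v : Lam m) : iot (exz x) (inc v) = inc (iot x v) := by
  ext S
  by_cases h : Fin.last m ∈ S
  · rw [inc_last _ _ h, iot_apply]
    refine Finset.sum_eq_zero fun j _ => ?_
    rw [inc_last _ _ (Finset.mem_insert_of_mem h), mul_zero]
  · obtain ⟨T, rfl⟩ := exists_map S h
    rw [inc_map, iot_apply, iot_apply]
    have hc : (T.map Fin.castSuccEmb)ᶜ = insert (Fin.last m) (Tᶜ.map Fin.castSuccEmb) := by
      ext j
      refine Fin.lastCases ?_ (fun i => ?_) j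
      · simp [last_notMem_map]
      · simp [(Fin.castSucc_lt_last i).ne]
    rw [hc, Finset.sum_insert (last_notMem_map _), exz_last]
    simp only [mul_zero, zero_mul, zero_add, Finset.sum_map, Fin.coe_castSuccEmb]
    refine Finset.sum_congr rfl fun j _ => ?_
    rw [exz_castSucc]
    have h1 : insert j.castSucc (T.map Fin.castSuccEmb) = (insert j T).map Fin.castSuccEmb := by
      simp
    rw [h1, inc_map]
    congr 2
    unfold wsign
    rw [Finset.filter_map, Finset.card_map]
    rfl

lemma iot_last_inc (v : Lam m) : iot (ee (Fin.last m)) (inc v) = 0 := by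
  ext S
  rw [iot_ee_apply, inc_last _ _ (Finset.mem_insert_self _ _)]; simp
lemma inc_prj (w : Lam (m+1)) (hw : iot (ee (Fin.last m)) w = 0) : inc (prj w) = w := by
  ext S
  by_cases h : Fin.last m ∈ S
  · rw [inc_last _ _ h]
    have h2 := congrArg (fun z : Lam (m+1) => z (S.erase (Fin.last m))) hw
    simp only [iot_ee_apply] at h2
    rw [if_pos (by simp), Finset.insert_erase h] at h2
    have h3 := wsign_sq (Fin.last m) (S.erase (Fin.last m))
    have : w S = wsign (Fin.last m) (S.erase (Fin.last m)) * (wsign (Fin.last m) (S.erase (Fin.last m)) * w S) := by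
      rw [← mul_assoc, h3, one_mul]
    rw [this, h2]; simp
  · obtain ⟨T, rfl⟩ := exists_map S h
    rw [inc_map, prj_apply]

lemma norm_inc (v : Lam m) : ‖inc v‖ = ‖v‖ := by
  rw [EuclideanSpace.norm_eq, EuclideanSpace.norm_eq]
  congr 1
  symm
  rw [← Finset.sum_filter_add_sum_filter_not Finset.univ (fun S : Finset (Fin (m+1)) => Fin.last m ∈ S),
    Finset.sum_eq_zero (s := Finset.univ.filter (fun S : Finset (Fin (m+1)) => Fin.last m ∈ S)), zero_add]
  · refine Finset.sum_bij (fun T _ => T.map Fin.castSuccEmb) ?_ ?_ ?_ ?_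
    · intro T _; simp [last_notMem_map]
    · intro T _ T' _ h; simpa using h
    · intro S hS
      simp only [Finset.mem_filter, Finset.mem_univ, true_and] at hS
      obtain ⟨T, rfl⟩ := exists_map S hS
      exact ⟨T, by simp, rfl⟩
    · intro T _; rw [inc_map]
  · intro S hS
    simp only [Finset.mem_filter, Finset.mem_univ, true_and] at hS
    rw [inc_last _ _ hS]; simp

lemma prj_add (v w : Lam (m+1)) : prj (v + w) = prj v + prj w := rfl
lemma prj_smul (c : ℂ) (v : Lam (m+1)) : prj (c • v) = c • prj v := rfl
/-- the pullback as a continuous linear map -/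
def prjL : Lam (m+1) →L[ℂ] Lam m :=
  LinearMap.toContinuousLinearMap { toFun := prj, map_add' := prj_add, map_smul' := prj_smul }
lemma prjL_apply (v : Lam (m+1)) : prjL v = prj v := rfl
lemma inc_add (v w : Lam m) : inc (v + w) = inc v + inc w := by
  ext S
  by_cases h : Fin.last m ∈ S
  · simp [inc_last _ _ h]
  · obtain ⟨T, rfl⟩ := exists_map S h
    simp [inc_map]
lemma inc_smul (c : ℂ) (v : Lam m) : inc (c • v) = c • inc v := by
  ext S
  by_cases h : Fin.last m ∈ S
  · simp [inc_last _ _ h]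
  · obtain ⟨T, rfl⟩ := exists_map S h
    simp [inc_map]
/-- the inclusion as a continuous linear map -/
def incC : Lam m →L[ℂ] Lam (m+1) :=
  LinearMap.toContinuousLinearMap { toFun := inc, map_add' := inc_add, map_smul' := inc_smul }
lemma incC_apply (v : Lam m) : incC v = inc v := rfl
lemma isForm_inc {p : ℕ} {v : Lam m} (hv : IsForm p v) : IsForm p (inc v) := by
  intro S hS
  by_cases h : Fin.last m ∈ S
  · exact inc_last _ _ h
  · obtain ⟨T, rfl⟩ := exists_map S h
    rw [inc_map]; apply hv; simpa using hS
lemma prj_eps_last (v : Lam (m+1)) : prj (eps (ee (Fin.last m)) v) = 0 := by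
  ext T; rw [prj_apply, eps_ee_apply, if_neg (last_notMem_map _)]; rfl
end

section
lemma rpow_neg_subord {r s : ℝ} (hr : 0 < r) (hs : 0 < s) :
    ∫ σ in Set.Ioi (0:ℝ), σ ^ (s-1) * Real.exp (-(r*σ)) = r ^ (-s) * Real.Gamma s := by
  rw [Real.integral_rpow_mul_exp_neg_mul_Ioi hs hr, one_div, Real.inv_rpow hr.le, Real.rpow_neg hr.le]

lemma integrable_rpow_exp {r s : ℝ} (hr : 0 < r) (hs : 0 < s) :
    IntegrableOn (fun σ : ℝ => σ ^ (s-1) * Real.exp (-(r*σ))) (Set.Ioi 0) := by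
  by_contra h
  have h1 := rpow_neg_subord hr hs
  rw [integral_undef h] at h1
  have := Real.Gamma_pos_of_pos hs
  have := Real.rpow_pos_of_pos hr (-s)
  nlinarith [mul_pos this (Real.Gamma_pos_of_pos hs)]

lemma q_prod_int {s k : ℝ} (hs : 1/2 < s) (hk : 0 < k) :
    Integrable (Function.uncurry fun (σ t : ℝ) => σ ^ (s-1) * Real.exp (-((k^2+t^2)*σ)))
      ((volume.restrict (Set.Ioi 0)).prod volume) := by
  have hms : AEStronglyMeasurable (Function.uncurry fun (σ t : ℝ) => σ ^ (s-1) * Real.exp (-((k^2+t^2)*σ)))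
      ((volume.restrict (Set.Ioi 0)).prod volume) := by
    apply Measurable.aestronglyMeasurable
    unfold Function.uncurry
    fun_prop
  rw [integrable_prod_iff hms]
  have key : ∀ σ : ℝ, ∀ t : ℝ, Real.exp (-((k^2+t^2)*σ)) = Real.exp (-(k^2*σ)) * Real.exp (-σ * t^2) := by
    intro σ t; rw [← Real.exp_add]; ring_nf
  constructor
  · filter_upwards [ae_restrict_mem measurableSet_Ioi] with σ hσ
    simp only [Function.uncurry, key]
    exact ((integrable_exp_neg_mul_sq hσ).const_mul _).const_mul _
  · have := (integrable_rpow_exp (s := s - 1/2) (r := k^2) (by positivity) (by linarith)).const_mul (Real.sqrt Real.pi)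
    refine this.congr ?_
    filter_upwards [ae_restrict_mem measurableSet_Ioi] with σ hσ
    have hσ' : (0:ℝ) < σ := hσ
    simp only [Function.uncurry, key, norm_mul, Real.norm_eq_abs, Real.abs_exp]
    rw [integral_const_mul, integral_const_mul, integral_gaussian, abs_of_nonneg (Real.rpow_nonneg hσ'.le _),
      Real.sqrt_div Real.pi_pos.le, Real.sqrt_eq_rpow σ, show s - 1/2 - 1 = (s-1) - 1/2 by ring, Real.rpow_sub hσ' (s-1) (1/2)]
    ring

lemma q_eq {s k : ℝ} (hs : 1/2 < s) (hk : 0 < k) (t : ℝ) :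
    ∫ σ in Set.Ioi (0:ℝ), σ ^ (s-1) * Real.exp (-((k^2+t^2)*σ)) = (k^2+t^2) ^ (-s) * Real.Gamma s :=
  rpow_neg_subord (by positivity) (by linarith)

lemma q_int {s k : ℝ} (hs : 1/2 < s) (hk : 0 < k) : Integrable (fun t : ℝ => (k^2+t^2) ^ (-s)) := by
  have := (q_prod_int hs hk).swap.integral_prod_left
  simp only [Function.comp_def, Prod.swap, Function.uncurry, q_eq hs hk] at this
  refine (this.mul_const (Real.Gamma s)⁻¹).congr (ae_of_all _ fun t => ?_)
  have := (Real.Gamma_pos_of_pos (by linarith : 0 < s)).ne'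
  field_simp

lemma q_integral {s k : ℝ} (hs : 1/2 < s) (hk : 0 < k) :
    ∫ t : ℝ, (k^2+t^2) ^ (-s) = Real.sqrt Real.pi * Real.Gamma (s-1/2) / Real.Gamma s * k ^ (1-2*s) := by
  have hG := (Real.Gamma_pos_of_pos (by linarith : 0 < s)).ne'
  have key : ∀ σ : ℝ, ∀ t : ℝ, Real.exp (-((k^2+t^2)*σ)) = Real.exp (-(k^2*σ)) * Real.exp (-σ * t^2) := by
    intro σ t; rw [← Real.exp_add]; ring_nf
  have h1 : ∫ t : ℝ, (k^2+t^2) ^ (-s) * Real.Gamma s = Real.sqrt Real.pi * (k ^ (1-2*s) * Real.Gamma (s-1/2)) := by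
    simp only [← q_eq hs hk]
    have h2 := integral_integral_swap (q_prod_int hs hk)
    rw [← h2, show k ^ (1-2*s) = (k^2) ^ (-(s-1/2)) by
      rw [← Real.rpow_natCast, ← Real.rpow_mul hk.le]; push_cast; ring_nf,
      ← rpow_neg_subord (by positivity) (by linarith), ← integral_const_mul]
    refine setIntegral_congr_fun measurableSet_Ioi fun σ hσ => ?_
    have hσ' : (0:ℝ) < σ := hσ
    simp only [key]
    rw [integral_const_mul, integral_const_mul, integral_gaussian,
      Real.sqrt_div Real.pi_pos.le, Real.sqrt_eq_rpow σ, show s - 1/2 - 1 = (s-1) - 1/2 by ring, Real.rpow_sub hσ' (s-1) (1/2)]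
    ring
  rw [integral_mul_const] at h1
  field_simp at h1 ⊢
  linarith
end

section
variable {n m : ℕ}

/-- last basis vector -/
def en (m : ℕ) : Fin (m+1) → ℝ := fun j => if j = Fin.last m then 1 else 0
lemma rc_en : rc (en m) = ee (Fin.last m) := by
  ext j; simp [rc, en, ee]; split_ifs <;> simp
/-- the unit vector in direction ξ', extended by zero -/
def om (x : Rn m) : Fin (m+1) → ℝ := fun j => if h : (j:ℕ) < m then ‖x‖⁻¹ * x ⟨j, h⟩ else 0
lemma om_castSucc (x : Rn m) (j : Fin m) : om x j.castSucc = ‖x‖⁻¹ * x j := by simp [om]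
lemma om_last (x : Rn m) : om x (Fin.last m) = 0 := by simp [om]
lemma rc_om (x : Rn m) : rc (om x) = exz (rc (‖x‖⁻¹ • x)) := by
  ext j
  refine Fin.lastCases ?_ (fun i => ?_) j
  · simp [rc, om_last, exz_last]
  · rw [exz_castSucc]; simp [rc, om_castSucc]

lemma sum_sq_eq (x : Rn m) : ∑ j, x j * x j = ‖x‖^2 := by
  rw [EuclideanSpace.norm_sq_eq]; simp [sq]
lemma norm_ap_sq (x : Rn m) (t : ℝ) : ‖ap x t‖^2 = ‖x‖^2 + t^2 := by
  rw [← sum_sq_eq, ← sum_sq_eq, Fin.sum_univ_castSucc]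
  simp only [ap_castSucc, ap_last]; ring
lemma norm_ap (x : Rn m) (t : ℝ) : ‖ap x t‖ = Real.sqrt (‖x‖^2 + t^2) := by
  rw [← norm_ap_sq, Real.sqrt_sq (norm_nonneg _)]
lemma norm_ap_rpow (x : Rn m) (t r : ℝ) : ‖ap x t‖ ^ r = (‖x‖^2 + t^2) ^ (r/2) := by
  rw [norm_ap, Real.sqrt_eq_rpow, ← Real.rpow_mul (by positivity)]; ring_nf
lemma rc_ap (x : Rn m) (hx : x ≠ 0) (t : ℝ) :
    rc (ap x t) = (‖x‖:ℂ) • rc (om x) + (t:ℂ) • ee (Fin.last m) := by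
  have : ‖x‖ ≠ 0 := norm_ne_zero_iff.2 hx
  ext j
  refine Fin.lastCases ?_ (fun i => ?_) j
  · simp [rc, ap_last, om_last, ee]
  · simp only [rc, ap_castSucc, Pi.add_apply, Pi.smul_apply, om_castSucc, ee, (Fin.castSucc_lt_last i).ne, if_false, smul_eq_mul]
    rw [← Complex.ofReal_mul, mul_inv_cancel_left₀ this]; simp
lemma rc_smul (c : ℝ) (x : Rn n) : rc (c • x) = (c:ℂ) • rc x := by ext j; simp [rc]
lemma sum_om (x : Rn m) (hx : x ≠ 0) : ∑ j, rc (om x) j * rc (om x) j = 1 := by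
  have hk : ‖x‖ ≠ 0 := norm_ne_zero_iff.2 hx
  rw [Fin.sum_univ_castSucc]
  simp only [rc, om_castSucc, om_last]
  have : ∑ j, (‖x‖⁻¹ * x j) * (‖x‖⁻¹ * x j) = 1 := by
    have h := sum_sq_eq x
    calc _ = ‖x‖⁻¹^2 * ∑ j, x j * x j := by rw [Finset.mul_sum]; exact Finset.sum_congr rfl fun _ _ => by ring
      _ = 1 := by rw [h]; field_simp
  have h2 := congrArg (fun r : ℝ => (r:ℂ)) this
  push_cast at h2 ⊢
  rw [h2]; simp
lemma sum_om_en (x : Rn m) : ∑ j, rc (om x) j * ee (Fin.last m) j = 0 := by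
  rw [Fin.sum_univ_castSucc]
  simp [rc, om_last, ee, (Fin.castSucc_lt_last _).ne]
lemma sum_en_om (x : Rn m) : ∑ j, ee (Fin.last m) j * rc (om x) j = 0 := by
  rw [← sum_om_en x]; exact Finset.sum_congr rfl fun _ _ => mul_comm _ _
lemma sum_en_en : ∑ j, ee (Fin.last m) j * ee (Fin.last m) j = 1 := by
  rw [Fin.sum_univ_castSucc]
  simp [ee, (Fin.castSucc_lt_last _).ne]

/-- first radial profile -/
def C0 (μ M k t : ℝ) : ℝ := (k^2+t^2) ^ (-(μ/2)) + 2*μ/M * k^2 * (k^2+t^2) ^ (-(μ/2)-1)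
/-- second radial profile -/
def B0 (μ M k t : ℝ) : ℝ := 2*μ/M * k * t * (k^2+t^2) ^ (-(μ/2)-1)
/-- the common fiber form -/
def Fib (μ M k : ℝ) (ω : Fin (m+1) → ℂ) (α γ : Lam (m+1)) (t : ℝ) : Lam (m+1) :=
  (((k^2+t^2) ^ (-(μ/2)) : ℝ) : ℂ) • α + ((C0 μ M k t : ℝ):ℂ) • eps ω γ
    + ((B0 μ M k t : ℝ):ℂ) • eps (ee (Fin.last m)) γ

/-- annihilated by both interior multiplications -/
def Tang (ω : Fin (m+1) → ℂ) (α : Lam (m+1)) : Prop :=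
  iot ω α = 0 ∧ iot (ee (Fin.last m)) α = 0

lemma iot_zero (x : Fin n → ℂ) : iot x 0 = 0 := (iotL x).map_zero
lemma eps_zero (x : Fin n → ℂ) : eps x 0 = 0 := (epsL x).map_zero

lemma iot_comb (x : Rn m) (hx : x ≠ 0) (α γ : Lam (m+1)) (hα : Tang (rc (om x)) α) (hγ : Tang (rc (om x)) γ)
    (A C B k t : ℂ) :
    iot (k • rc (om x) + t • ee (Fin.last m)) (A • α + C • eps (rc (om x)) γ + B • eps (ee (Fin.last m)) γ)
     = (k*C+t*B) • γ := by
  have h1 := iot_eps (rc (om x)) (rc (om x)) γ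
  have h2 := iot_eps (rc (om x)) (ee (Fin.last m)) γ
  have h3 := iot_eps (ee (Fin.last m)) (rc (om x)) γ
  have h4 := iot_eps (ee (Fin.last m)) (ee (Fin.last m)) γ
  rw [hγ.1, eps_zero, add_zero] at h1 h2
  rw [hγ.2, eps_zero, add_zero] at h3 h4
  rw [sum_om x hx] at h1; rw [sum_om_en] at h2; rw [sum_en_om] at h3; rw [sum_en_en] at h4
  simp only [iot_add_left, iot_smul_left, iot_add, iot_smul, h1, h2, h3, h4, hα.1, hα.2]
  simp only [smul_zero, zero_add, add_zero, zero_smul, one_smul]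
  module

lemma normsq_eq_inner (v : Lam n) : ((‖v‖^2 : ℝ) : ℂ) = inner ℂ v v := by
  rw [inner_self_ofReal]

lemma normsq_comb (x : Rn m) (hx : x ≠ 0) (α γ : Lam (m+1)) (hα : Tang (rc (om x)) α) (hγ : Tang (rc (om x)) γ)
    (A C B : ℝ) :
    ‖(A:ℂ) • α + (C:ℂ) • eps (rc (om x)) γ + (B:ℂ) • eps (ee (Fin.last m)) γ‖^2
     = A^2*‖α‖^2 + (C^2+B^2)*‖γ‖^2 := by
  set G := (A:ℂ) • α + (C:ℂ) • eps (rc (om x)) γ + (B:ℂ) • eps (ee (Fin.last m)) γ with hG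
  have i1 : iot (rc (om x)) G = (C:ℂ) • γ := by
    have := iot_comb x hx α γ hα hγ A C B 1 0
    rw [← hG, one_smul, zero_smul, add_zero] at this
    rw [this, one_mul, zero_mul, add_zero]
  have i2 : iot (rc (en m)) G = (B:ℂ) • γ := by
    have := iot_comb x hx α γ hα hγ A C B 0 1
    rw [← hG, one_smul, zero_smul, zero_add] at this
    rw [rc_en, this, one_mul, zero_mul, zero_add]
  have e1 : inner ℂ G α = (A:ℂ) * inner ℂ α α := by
    rw [hG, ← rc_en, inner_add_left, inner_add_left, inner_smul_left, inner_smul_left, inner_smul_left]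
    rw [← inner_conj_symm (eps (rc (om x)) γ), ← inner_conj_symm (eps (rc (en m)) γ), inner_eps, inner_eps, hα.1, rc_en, hα.2]
    simp
  have : ((‖G‖^2 : ℝ) : ℂ) = ((A^2*‖α‖^2 + (C^2+B^2)*‖γ‖^2 : ℝ) : ℂ) := by
    rw [normsq_eq_inner]
    conv_lhs => rw [hG]
    rw [← hG] 
    nth_rewrite 2 [hG]
    rw [inner_add_right, inner_add_right, inner_smul_right, inner_smul_right, inner_smul_right, e1, inner_eps, i1,
      ← rc_en, inner_eps, i2, inner_smul_left, inner_smul_left, ← normsq_eq_inner, ← normsq_eq_inner]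
    push_cast
    simp only [Complex.conj_ofReal]
    ring
  exact_mod_cast this

lemma energy_pt {μ M k t : ℝ} (hM : 0 < M) (hk : 0 < k) :
    (k * C0 μ M k t + t * B0 μ M k t) = (M + 2*μ)/M * k * (k^2+t^2) ^ (-(μ/2)) ∧
    (t * C0 μ M k t - k * B0 μ M k t) = t * (k^2+t^2) ^ (-(μ/2)) := by
  have hq : 0 < k^2+t^2 := by positivity
  unfold C0 B0
  have : (k^2+t^2) ^ (-(μ/2)) = (k^2+t^2) ^ (-(μ/2)-1) * (k^2+t^2) := by
    rw [← Real.rpow_add_one hq.ne']; ring_nf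
  rw [this]
  generalize (k^2+t^2) ^ (-(μ/2)-1) = z
  constructor <;> field_simp <;> ring

lemma energy_pt2 {μ M k t A2 G2 : ℝ} (hM : 0 < M) (hk : 0 < k) :
    (k^2+t^2) ^ (μ/2) * ((M+2*μ)/2 * (((k^2+t^2) ^ (-(μ/2)))^2 * A2 + ((C0 μ M k t)^2 + (B0 μ M k t)^2) * G2)
      - μ * ((k * C0 μ M k t + t * B0 μ M k t)^2 * G2 / (k^2+t^2)))
    = (M+2*μ)/2 * ((k^2+t^2) ^ (-(μ/2)) * (A2 + G2) + 2*μ/M * k^2 * (k^2+t^2) ^ (-(μ/2+1)) * G2) := by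
  have hq : 0 < k^2+t^2 := by positivity
  obtain ⟨h1, h2⟩ := energy_pt (μ := μ) (t := t) hM hk
  have h3 : (k^2+t^2) * ((C0 μ M k t)^2 + (B0 μ M k t)^2)
     = ((M + 2*μ)/M * k * (k^2+t^2) ^ (-(μ/2)))^2 + (t * (k^2+t^2) ^ (-(μ/2)))^2 := by
    rw [← h1, ← h2]; ring
  have h4 : (C0 μ M k t)^2 + (B0 μ M k t)^2
     = (((M + 2*μ)/M * k * (k^2+t^2) ^ (-(μ/2)))^2 + (t * (k^2+t^2) ^ (-(μ/2)))^2) / (k^2+t^2) := by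
    rw [← h3]; field_simp
  rw [h4, h1]
  have e1 : (k^2+t^2) ^ (-(μ/2)) = (k^2+t^2) ^ (-(μ/2+1)) * (k^2+t^2) := by
    rw [← Real.rpow_add_one hq.ne']; ring_nf
  have e2 : (k^2+t^2) ^ (μ/2) * ((k^2+t^2) ^ (-(μ/2+1)) * (k^2+t^2)) = 1 := by
    rw [← e1, ← Real.rpow_add hq]; simp
  rw [e1]
  generalize (k^2+t^2) ^ (μ/2) = z at *
  generalize (k^2+t^2) ^ (-(μ/2+1)) = w at *
  have : z = 1 / (w * (k^2+t^2)) := by rw [eq_div_iff]; exact e2; intro h; rw [h] at e2; simp at e2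
  have hw : w ≠ 0 := by rintro rfl; simp at e2
  rw [this]
  field_simp
  ring
end

section
variable {n m : ℕ}

lemma sum_unit (x : Rn n) (hx : x ≠ 0) : ∑ j, (‖x‖⁻¹ • x) j * (‖x‖⁻¹ • x) j = 1 := by
  rw [sum_sq_eq, norm_smul, norm_inv, norm_norm, inv_mul_cancel₀ (norm_ne_zero_iff.2 hx)]; simp

lemma norm_iot_unit (x : Rn n) (v : Lam n) : ‖iot (rc (‖x‖⁻¹ • x)) v‖^2 = ‖iot (rc x) v‖^2 / ‖x‖^2 := by
  rw [show rc ((‖x‖⁻¹ • x) : Rn n) = ((‖x‖⁻¹:ℝ):ℂ) • rc x from rc_smul _ _, iot_smul_left, norm_smul]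
  simp; ring

lemma ap_ne_zero (x : Rn m) (hx : x ≠ 0) (t : ℝ) : ap x t ≠ 0 := by
  intro h
  have := norm_ap_sq x t
  rw [h] at this
  have : 0 < ‖x‖^2 := by have := norm_pos_iff.2 hx; positivity
  simp at *
  nlinarith [sq_nonneg t]

/-- the energy density -/
def edens (c lam : ℝ) (g : Rn n → Lam n) (ξ : Rn n) : ℝ :=
  ‖ξ‖ ^ (-(2*lam)) * (inner ℂ (g ξ) (opC c lam (‖ξ‖⁻¹ • ξ) (g ξ)) : ℂ).re

lemma edens_eq (c lam : ℝ) (g : Rn n → Lam n) (ξ : Rn n) (h : ξ ≠ 0) :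
    edens c lam g ξ = ‖ξ‖ ^ (-(2*lam)) * ((c-lam)*‖g ξ‖^2 + 2*lam*(‖iot (rc ξ) (g ξ)‖^2/‖ξ‖^2)) := by
  unfold edens
  rw [← WithLp.ofLp_smul, re_inner_opC _ _ _ (sum_unit ξ h), norm_iot_unit]

lemma fib_edens {μ M : ℝ} (hM : 0 < M) (x : Rn m) (hx : x ≠ 0) (α γ : Lam (m+1))
    (hα : Tang (rc (om x)) α) (hγ : Tang (rc (om x)) γ) (g : Rn (m+1) → Lam (m+1)) (t : ℝ)
    (hg : g (ap x t) = Fib μ M ‖x‖ (rc (om x)) α γ t) :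
    edens ((M+μ)/2) (-(μ/2)) g (ap x t) = (M+2*μ)/2 * ((‖x‖^2+t^2) ^ (-(μ/2)) * (‖α‖^2 + ‖γ‖^2)
      + 2*μ/M * ‖x‖^2 * (‖x‖^2+t^2) ^ (-(μ/2+1)) * ‖γ‖^2) := by
  have hk := norm_pos_iff.2 hx
  rw [edens_eq _ _ _ _ (ap_ne_zero x hx t), norm_ap_sq, norm_ap_rpow, hg, rc_ap x hx]
  unfold Fib
  rw [iot_comb x hx α γ hα hγ, normsq_comb x hx α γ hα hγ, norm_smul, mul_pow,
    ← energy_pt2 hM hk, ← Complex.ofReal_mul, ← Complex.ofReal_mul, ← Complex.ofReal_add, Complex.norm_real,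
    Real.norm_eq_abs, sq_abs]
  rw [show -(2 * -(μ/2))/2 = μ/2 by ring]
  ring

/-- normalization integral -/
def II (μ : ℝ) : ℝ := Real.sqrt Real.pi * Real.Gamma ((μ-1)/2) / Real.Gamma (μ/2)

lemma II_pos {μ : ℝ} (hμ : 1 < μ) : 0 < II μ := by
  unfold II
  have := Real.Gamma_pos_of_pos (show 0 < (μ-1)/2 by linarith)
  have := Real.Gamma_pos_of_pos (show 0 < μ/2 by linarith)
  have := Real.pi_pos
  positivity

lemma q_integral1 {μ k : ℝ} (hμ : 1 < μ) (hk : 0 < k) :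
    ∫ t : ℝ, (k^2+t^2) ^ (-(μ/2)) = II μ * k ^ (1-μ) := by
  rw [q_integral (by linarith) hk, II]; ring_nf
lemma q_integral2 {μ k : ℝ} (hμ : 1 < μ) (hk : 0 < k) :
    k^2 * ∫ t : ℝ, (k^2+t^2) ^ (-(μ/2+1)) = II μ * k ^ (1-μ) * ((μ-1)/μ) := by
  rw [q_integral (by linarith) hk, II, show μ/2+1-1/2 = (μ-1)/2 + 1 by ring,
    Real.Gamma_add_one (by linarith), Real.Gamma_add_one (by linarith),
    show 1 - 2*(μ/2+1) = (1-μ) - (2:ℕ) by push_cast; ring, Real.rpow_sub_natCast hk.ne']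
  have := (Real.Gamma_pos_of_pos (show 0 < μ/2 by linarith)).ne'
  field_simp

/-- the trace relation between the data and the fiber coefficients -/
def TrRel (μ M : ℝ) (x : Rn m) (α γ : Lam (m+1)) (h : Lam m) : Prop :=
  inc h = (((2*Real.pi) ^ (-(1:ℝ)/2) * (II μ * ‖x‖ ^ (1-μ)) : ℝ) : ℂ) •
    (α + (((M + 2*μ - 2)/M : ℝ) : ℂ) • eps (rc (om x)) γ)

lemma base_edens {μ M : ℝ} (hμ : 1 < μ) (hM : 0 < M) (x : Rn m) (hx : x ≠ 0) (α γ : Lam (m+1))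
    (hα : Tang (rc (om x)) α) (hγ : Tang (rc (om x)) γ) (h : Rn m → Lam m) (ht : TrRel μ M x α γ (h x)) :
    edens ((M+μ-1)/2) (-((μ-1)/2)) h x = 
     (II μ)^2/(2*Real.pi) * ‖x‖ ^ (1-μ) * ((M+2*μ-2)/2) * (‖α‖^2 + (M+2*μ-2)/M * ‖γ‖^2) := by
  have hk := norm_pos_iff.2 hx
  unfold TrRel at ht
  set κ := (2*Real.pi) ^ (-(1:ℝ)/2) * (II μ * ‖x‖ ^ (1-μ)) with hκ
  have hκ2 : κ^2 = (II μ)^2/(2*Real.pi) * (‖x‖ ^ (1-μ))^2 := by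
    rw [hκ, mul_pow, ← Real.rpow_natCast _ 2, ← Real.rpow_mul (by have := Real.pi_pos; positivity), mul_pow]
    norm_num
    rw [Real.rpow_neg_one]; field_simp
  have ht' : inc (h x) = ((κ:ℝ):ℂ) • α + ((κ * ((M+2*μ-2)/M) : ℝ):ℂ) • eps (rc (om x)) γ + ((0:ℝ):ℂ) • eps (ee (Fin.last m)) γ := by
    rw [ht]; push_cast; module
  have n1 : ‖h x‖^2 = κ^2*(‖α‖^2 + ((M+2*μ-2)/M)^2 * ‖γ‖^2) := by
    rw [← norm_inc, ht', normsq_comb x hx α γ hα hγ]; ring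
  have n2 : ‖iot (rc (‖x‖⁻¹ • x)) (h x)‖^2 = κ^2*((M+2*μ-2)/M)^2 * ‖γ‖^2 := by
    rw [← norm_inc, ← iot_inc, ← rc_om, ht']
    have := iot_comb x hx α γ hα hγ (κ:ℝ) ((κ * ((M+2*μ-2)/M) : ℝ):ℂ) ((0:ℝ):ℂ) 1 0
    rw [one_smul, zero_smul, add_zero] at this
    rw [this, norm_smul, mul_pow, one_mul, zero_mul, add_zero, Complex.norm_real, Real.norm_eq_abs, sq_abs]; ring
  unfold edens
  rw [← WithLp.ofLp_smul, re_inner_opC _ _ _ (sum_unit x hx), n1, n2, hκ2]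
  have : ‖x‖ ^ (-(2 * -((μ-1)/2))) = (‖x‖ ^ (1-μ))⁻¹ := by
    rw [← Real.rpow_neg hk.le]; ring_nf
  rw [this]
  have := (Real.rpow_pos_of_pos hk (1-μ)).ne'
  have := Real.pi_pos
  field_simp
  ring

lemma fib_energy {μ M : ℝ} (hμ : 1 < μ) (hM : 0 < M) (x : Rn m) (hx : x ≠ 0) (α γ : Lam (m+1))
    (hα : Tang (rc (om x)) α) (hγ : Tang (rc (om x)) γ) (g : Rn (m+1) → Lam (m+1))
    (hg : ∀ᵐ t : ℝ, g (ap x t) = Fib μ M ‖x‖ (rc (om x)) α γ t)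
    (h : Rn m → Lam m) (ht : TrRel μ M x α γ (h x)) :
    ∫ t : ℝ, edens ((M+μ)/2) (-(μ/2)) g (ap x t)
     = (2*Real.pi*(M+2*μ)/(II μ * (M+2*μ-2))) * edens ((M+μ-1)/2) (-((μ-1)/2)) h x := by
  have hk := norm_pos_iff.2 hx
  rw [base_edens hμ hM x hx α γ hα hγ h ht]
  have hI := II_pos hμ
  have : ∀ᵐ t : ℝ, edens ((M+μ)/2) (-(μ/2)) g (ap x t) = (M+2*μ)/2 * ((‖x‖^2+t^2) ^ (-(μ/2)) * (‖α‖^2 + ‖γ‖^2)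
      + (‖x‖^2+t^2) ^ (-(μ/2+1)) * (2*μ/M * ‖x‖^2 * ‖γ‖^2)) := by
    filter_upwards [hg] with t h1
    rw [fib_edens hM x hx α γ hα hγ g t h1]; ring
  rw [integral_congr_ae this, integral_const_mul, integral_add ((q_int (by linarith) hk).mul_const _)
     ((q_int (by linarith) hk).mul_const _), integral_mul_const, integral_mul_const, q_integral1 hμ hk]
  have h2 := q_integral2 hμ hk
  have h3 : (∫ t : ℝ, (‖x‖^2+t^2) ^ (-(μ/2+1))) = II μ * ‖x‖ ^ (1-μ) * ((μ-1)/μ) / ‖x‖^2 := by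
    rw [← h2]; field_simp
  rw [h3]
  have := Real.pi_pos
  have : M+2*μ-2 ≠ 0 := by intro h; linarith
  field_simp
  ring
end

section
variable {n m : ℕ}

/-- splitting off the last coordinate -/
def apE (m : ℕ) : (Rn m × ℝ) ≃ᵐ Rn (m+1) :=
  ((MeasurableEquiv.prodComm.trans
    ((MeasurableEquiv.refl ℝ).prodCongr (MeasurableEquiv.toLp 2 (Fin m → ℝ)).symm)).trans
    (MeasurableEquiv.piFinSuccAbove (fun _ : Fin (m+1) => ℝ) (Fin.last m)).symm).trans
    (MeasurableEquiv.toLp 2 (Fin (m+1) → ℝ))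
lemma apE_apply (z : Rn m × ℝ) : apE m z = ap z.1 z.2 := by
  ext j
  refine Fin.lastCases ?_ (fun i => ?_) j
  · rw [ap_last]; simp [apE, MeasurableEquiv.piFinSuccAbove, MeasurableEquiv.prodComm]; rfl
  · rw [ap_castSucc]; simp [apE, MeasurableEquiv.piFinSuccAbove, MeasurableEquiv.prodComm]; rfl
lemma mp_apE : MeasurePreserving (apE m) (volume.prod volume) volume := by
  unfold apE
  have h1 : MeasurePreserving (MeasurableEquiv.prodComm : (Rn m × ℝ) ≃ᵐ ℝ × Rn m) (volume.prod volume) (volume.prod volume) :=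
    Measure.measurePreserving_swap
  have h2 : MeasurePreserving ((MeasurableEquiv.refl ℝ).prodCongr (MeasurableEquiv.toLp 2 (Fin m → ℝ)).symm) 
     ((volume : Measure ℝ).prod (volume : Measure (Rn m))) (volume.prod volume) :=
    (MeasurePreserving.id volume).prod (PiLp.volume_preserving_ofLp (Fin m))
  have h3 := (volume_preserving_piFinSuccAbove (fun _ : Fin (m+1) => ℝ) (Fin.last m)).symm
  have h4 := PiLp.volume_preserving_toLp (Fin (m+1))
  exact h4.comp (h3.comp (h2.comp h1))

lemma mp_ap : MeasurePreserving (fun z : Rn m × ℝ => ap z.1 z.2) (volume.prod volume) volume := by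
  have : (fun z : Rn m × ℝ => ap z.1 z.2) = apE m := by ext1 z; rw [apE_apply]
  rw [this]; exact mp_apE
lemma me_ap : MeasurableEmbedding (fun z : Rn m × ℝ => ap z.1 z.2) := by
  have : (fun z : Rn m × ℝ => ap z.1 z.2) = apE m := by ext1 z; rw [apE_apply]
  rw [this]; exact (apE m).measurableEmbedding

lemma integral_ap {E : Type*} [NormedAddCommGroup E] [NormedSpace ℝ E] (f : Rn (m+1) → E) (hf : Integrable f) :
    ∫ ξ, f ξ = ∫ x : Rn m, ∫ t : ℝ, f (ap x t) := by
  rw [← mp_ap.integral_comp me_ap, integral_prod]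
  exact (mp_ap.integrable_comp_emb me_ap).2 hf
lemma integrable_ap {E : Type*} [NormedAddCommGroup E] {f : Rn (m+1) → E} (hf : Integrable f) :
    Integrable (fun z : Rn m × ℝ => f (ap z.1 z.2)) (volume.prod volume) :=
  (mp_ap.integrable_comp_emb me_ap).2 hf

lemma norm_iot_le (x : Fin n → ℝ) (hx : ∑ j, x j * x j = 1) (v : Lam n) : ‖iot (rc x) v‖ ≤ ‖v‖ := by
  set w := iot (rc x) v with hw
  have h1 : inner ℂ v (eps (rc x) w) = ((‖w‖^2:ℝ):ℂ) := by rw [inner_eps, ← hw, normsq_eq_inner]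
  have h2 : ‖eps (rc x) w‖^2 = ‖w‖^2 := by
    have h0 : iot (rc x) w = 0 := iot_iot_self _ _
    have h3 := iot_eps (rc x) (rc x) w
    have h4 : ∑ j, rc x j * rc x j = 1 := by simp only [rc]; exact_mod_cast hx
    rw [h0, eps_zero, add_zero, h4, one_smul] at h3
    have : ((‖eps (rc x) w‖^2 : ℝ):ℂ) = ((‖w‖^2:ℝ):ℂ) := by
      rw [normsq_eq_inner, inner_eps, h3, normsq_eq_inner]
    exact_mod_cast this
  have h5 : ‖eps (rc x) w‖ = ‖w‖ := by
    rw [← Real.sqrt_sq (norm_nonneg (eps (rc x) w)), h2, Real.sqrt_sq (norm_nonneg _)]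
  have h6 := norm_inner_le_norm (𝕜 := ℂ) v (eps (rc x) w)
  rw [h1, h5, Complex.norm_real, Real.norm_eq_abs, abs_of_nonneg (sq_nonneg _)] at h6
  by_contra h
  push Not at h
  have := norm_nonneg v
  nlinarith

lemma cont_iot : Continuous (fun z : Rn n × Lam n => iot (rc z.1) z.2) := by
  have : (fun z : Rn n × Lam n => iot (rc z.1) z.2) = fun z => ∑ j, rc z.1 j • iot (ee j) z.2 := by
    ext1 z; exact iot_eq_sum _ _
  rw [this]
  refine continuous_finsetSum _ fun j _ => ?_
  have h1 : Continuous (fun z : Rn n × Lam n => rc z.1 j) := by simp only [rc]; fun_prop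
  have h2 : Continuous (fun z : Rn n × Lam n => iot (ee j) z.2) :=
    (iotL (ee j)).continuous.comp continuous_snd
  exact h1.smul h2

lemma Hdot_ne (hn : n ≠ 0) : ∀ᵐ ξ : Rn n, ξ ≠ 0 := by
  have : Nonempty (Fin n) := ⟨⟨0, by omega⟩⟩
  have : Nontrivial (Rn n) := inferInstance
  exact Measure.ae_ne volume 0

lemma integrable_edens (hn : n ≠ 0) {c lam s : ℝ} {p : ℕ} (hs : 2*s = -(2*lam)) (g : Rn n → Lam n) (hg : g ∈ Hdot n s p) :
    Integrable (edens c lam g) := by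
  obtain ⟨h1, h2, h3⟩ := hg
  have hne := Hdot_ne hn
  refine Integrable.mono' (h3.const_mul (|c-lam| + |2*lam|)) ?_ ?_
  · have : AEStronglyMeasurable (fun ξ : Rn n => ‖ξ‖ ^ (-(2*lam)) * ((c-lam)*‖g ξ‖^2 + 2*lam*(‖iot (rc ξ) (g ξ)‖^2/‖ξ‖^2))) volume := by
      have e1 : AEStronglyMeasurable (fun ξ : Rn n => iot (rc ξ) (g ξ)) volume :=
        Continuous.comp_aestronglyMeasurable (g := fun z : Rn n × Lam n => iot (rc z.1) z.2)
          (f := fun ξ : Rn n => (ξ, g ξ)) cont_iot (AEStronglyMeasurable.prodMk aestronglyMeasurable_id h1)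
      have e2 : AEStronglyMeasurable (fun ξ : Rn n => ‖ξ‖ ^ (-(2*lam))) volume :=
        (measurable_norm.pow_const _).aestronglyMeasurable
      have e3 : AEStronglyMeasurable (fun ξ : Rn n => (‖ξ‖^2)⁻¹) volume := by
        apply Measurable.aestronglyMeasurable; fun_prop
      simp only [div_eq_mul_inv]
      exact e2.mul (((h1.norm.pow 2).const_mul _).add (((e1.norm.pow 2).mul e3).const_mul _))
    refine this.congr ?_
    filter_upwards [hne] with ξ hξ
    rw [edens_eq _ _ _ _ hξ]
  · filter_upwards [hne] with ξ hξ
    rw [edens, ← WithLp.ofLp_smul, re_inner_opC _ _ _ (sum_unit ξ hξ), hs, norm_mul, Real.norm_of_nonneg (Real.rpow_nonneg (norm_nonneg ξ) (-(2*lam)))]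
    have := norm_iot_le (‖ξ‖⁻¹ • ξ : Rn n) (sum_unit ξ hξ) (g ξ)
    have h5 : ‖iot (rc (‖ξ‖⁻¹ • ξ : Rn n)) (g ξ)‖^2 ≤ ‖g ξ‖^2 := by gcongr
    have h6 : ‖(c - lam) * ‖g ξ‖ ^ 2 + 2 * lam * ‖iot (rc (‖ξ‖⁻¹ • ξ : Rn n)) (g ξ)‖ ^ 2‖ ≤ (|c-lam| + |2*lam|) * ‖g ξ‖^2 := by
      refine (norm_add_le _ _).trans ?_
      rw [norm_mul, norm_mul]
      simp only [Real.norm_eq_abs, abs_pow, abs_norm]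
      rw [add_mul]
      gcongr
    have := Real.rpow_nonneg (norm_nonneg ξ) (-(2*lam))
    nlinarith [mul_le_mul_of_nonneg_left h6 this]

theorem assemble {μ M : ℝ} (hμ : 1 < μ) (hM : 0 < M) (hm : m ≠ 0) {p : ℕ} (g : Rn (m+1) → Lam (m+1))
    (hg : g ∈ Hdot (m+1) (μ/2) p) (h : Rn m → Lam m)
    (H : ∀ᵐ x : Rn m, ∃ α γ, Tang (rc (om x)) α ∧ Tang (rc (om x)) γ ∧
      (∀ᵐ t : ℝ, g (ap x t) = Fib μ M ‖x‖ (rc (om x)) α γ t) ∧ TrRel μ M x α γ (h x)) :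
    cSq ((M+μ)/2) (-(μ/2)) g
     = (2*Real.pi*(M+2*μ)/(II μ * (M+2*μ-2))) * cSq ((M+μ-1)/2) (-((μ-1)/2)) h := by
  have e : cSq ((M+μ)/2) (-(μ/2)) g = ∫ ξ, edens ((M+μ)/2) (-(μ/2)) g ξ := rfl
  have e' : cSq ((M+μ-1)/2) (-((μ-1)/2)) h = ∫ ξ, edens ((M+μ-1)/2) (-((μ-1)/2)) h ξ := rfl
  rw [e, e', integral_ap _ (integrable_edens (by omega) (by ring) g hg), ← integral_const_mul]
  refine integral_congr_ae ?_
  filter_upwards [H, Hdot_ne hm] with x ⟨α, γ, h1, h2, h3, h4⟩ hx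
  exact fib_energy hμ hM x hx α γ h1 h2 g h3 h h4
end

section
variable {E : Type*} [NormedAddCommGroup E]

section kap
variable [NormedSpace ℝ E] [CompleteSpace E]

lemma kappa_zero {k μ : ℝ} {A A' B : ℝ → E} (κ : E)
    (hA : ∀ t, HasDerivAt A (A' t) t) (hB : Continuous B)
    (hAi : Integrable A) (hBi : Integrable B)
    (h : ∀ t, (k^2+t^2) • A' t + (μ*t) • A t + (2*k) • B t = κ) (hk : 0 < k) : κ = 0 := by
  have hAc : Continuous A := continuous_iff_continuousAt.2 fun t => (hA t).continuousAt
  have hq : ∀ t : ℝ, k^2+t^2 ≠ 0 := fun t => by positivity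
  have hA'e : ∀ t, A' t = (k^2+t^2)⁻¹ • (κ - (μ*t) • A t - (2*k) • B t) := by
    intro t; rw [← h t, eq_inv_smul_iff₀ (hq t)]; module
  have hA'c : Continuous A' := by
    rw [show A' = _ from funext hA'e]
    refine Continuous.smul (Continuous.inv₀ (by fun_prop) hq) (by fun_prop)
  set K : ℝ := 6 + |μ| + 2*k with hK
  -- main estimate
  have main : ∀ R : ℝ, 1 ≤ R → k ≤ R → ‖κ‖ / 6 ≤ K * ∫ t in Set.Ioi R, (‖A t‖ + ‖B t‖) := by
    intro R hR1 hkR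
    have hR : 0 < R := by linarith
    let φ : ℝ → ℝ := fun t => (t-R)*(2*R-t)/R^3
    let φ' : ℝ → ℝ := fun t => (3*R-2*t)/R^3
    have hφ : ∀ t, HasDerivAt φ (φ' t) t := by
      intro t
      have := (((hasDerivAt_id t).sub_const R).mul ((hasDerivAt_id t).const_sub (2*R))).div_const (R^3)
      refine this.congr_deriv ?_
      simp only [φ', id]; ring
    have hqd : ∀ t : ℝ, HasDerivAt (fun t => k^2+t^2) (2*t) t := by
      intro t
      have := ((hasDerivAt_id t).pow 2).const_add (k^2)
      refine this.congr_deriv ?_; simp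
    have hd : ∀ t, HasDerivAt (fun t => ((k^2+t^2) * φ t) • A t)
        (((k^2+t^2) * φ t) • A' t + ((2*t) * φ t + (k^2+t^2) * φ' t) • A t) t := by
      intro t
      exact ((hqd t).mul (hφ t)).smul (hA t)
    have hφc : Continuous φ := by simp only [φ]; fun_prop
    have hφ'c : Continuous φ' := by simp only [φ']; fun_prop
    have hc : Continuous (fun t => ((k^2+t^2) * φ t) • A' t + ((2*t) * φ t + (k^2+t^2) * φ' t) • A t) := by
      fun_prop
    have i0 : ∫ t in R..(2*R), (((k^2+t^2) * φ t) • A' t + ((2*t) * φ t + (k^2+t^2) * φ' t) • A t) = 0 := by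
      rw [intervalIntegral.integral_eq_sub_of_hasDerivAt (fun t _ => hd t) (hc.intervalIntegrable _ _)]
      simp [φ]
    have i1 : ∫ t in R..(2*R), φ t • κ = (1/6:ℝ) • κ := by
      rw [intervalIntegral.integral_smul_const]
      congr 1
      have hΦ : ∀ t, HasDerivAt (fun t : ℝ => (3*R*t^2/2 - t^3/3 - 2*R^2*t)/R^3) (φ t) t := by
        intro t
        have := (((((hasDerivAt_id t).pow 2).const_mul (3*R)).div_const 2).sub (((hasDerivAt_id t).pow 3).div_const 3)).sub ((hasDerivAt_id t).const_mul (2*R^2))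
        refine (this.div_const (R^3)).congr_deriv ?_
        simp only [φ, id]; norm_num; ring
      rw [intervalIntegral.integral_eq_sub_of_hasDerivAt (fun t _ => hΦ t) (hφc.intervalIntegrable _ _)]
      field_simp; ring
    have i2 : (1/6:ℝ) • κ = ∫ t in R..(2*R), ((μ*t*φ t - (2*t*φ t + (k^2+t^2)*φ' t)) • A t + (2*k*φ t) • B t) := by
      have hc2 : Continuous (fun t => φ t • κ) := by fun_prop
      rw [← i1, ← sub_zero (∫ t in R..(2*R), φ t • κ), ← i0, ← intervalIntegral.integral_sub (hc2.intervalIntegrable _ _) (hc.intervalIntegrable _ _)]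
      refine intervalIntegral.integral_congr fun t _ => ?_
      rw [← h t]; module
    have bd : ∀ t ∈ Set.Icc R (2*R), ‖(μ*t*φ t - (2*t*φ t + (k^2+t^2)*φ' t)) • A t + (2*k*φ t) • B t‖ ≤ K * (‖A t‖ + ‖B t‖) := by
      intro t ht
      have ht1 := ht.1
      have ht2 := ht.2
      have f1 : 0 ≤ φ t := by
        simp only [φ]; apply div_nonneg (mul_nonneg (by linarith) (by linarith)) (by positivity)
      have f2 : φ t ≤ 1/(4*R) := by
        simp only [φ]; rw [div_le_div_iff₀ (by positivity) (by positivity)]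
        nlinarith [sq_nonneg (2*t-3*R), mul_nonneg hR.le (sq_nonneg (2*t-3*R))]
      have f3 : t * φ t ≤ 1/2 := by
        calc t * φ t ≤ (2*R) * (1/(4*R)) := by gcongr
          _ = 1/2 := by field_simp; norm_num
      have f3' : 0 ≤ t * φ t := mul_nonneg (by linarith) f1
      have f4 : |φ' t| ≤ 1/R^2 := by
        simp only [φ']
        rw [abs_div, abs_of_pos (by positivity : (0:ℝ) < R^3), div_le_div_iff₀ (by positivity) (by positivity)]
        have : |3*R-2*t| ≤ R := by rw [abs_le]; constructor <;> linarith
        calc |3*R-2*t| * R^2 ≤ R * R^2 := by gcongr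
          _ = 1 * R^3 := by ring
      have f5 : (k^2+t^2) * |φ' t| ≤ 5 := by
        have : k^2+t^2 ≤ 5*R^2 := by nlinarith
        calc (k^2+t^2) * |φ' t| ≤ 5*R^2 * (1/R^2) := by gcongr
          _ = 5 := by field_simp
      have f6 : φ t ≤ 1 := f2.trans (by rw [div_le_one (by positivity)]; linarith)
      have c1 : |μ*t*φ t - (2*t*φ t + (k^2+t^2)*φ' t)| ≤ K := by
        have : |μ*t*φ t| ≤ |μ| := by
          rw [mul_assoc, abs_mul, abs_of_nonneg f3']
          nlinarith [abs_nonneg μ]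
        have h2 : |2*t*φ t| ≤ 1 := by rw [mul_assoc, abs_of_nonneg (by positivity)]; linarith
        have h3 : |(k^2+t^2)*φ' t| ≤ 5 := by rw [abs_mul, abs_of_nonneg (by positivity)]; exact f5
        calc _ ≤ |μ*t*φ t| + |2*t*φ t + (k^2+t^2)*φ' t| := abs_sub _ _
          _ ≤ |μ*t*φ t| + (|2*t*φ t| + |(k^2+t^2)*φ' t|) := by gcongr; exact abs_add_le _ _
          _ ≤ K := by rw [hK]; linarith
      have c2 : |2*k*φ t| ≤ K := by
        rw [abs_of_nonneg (by positivity), hK]; nlinarith [abs_nonneg μ]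
      calc _ ≤ |μ*t*φ t - (2*t*φ t + (k^2+t^2)*φ' t)| * ‖A t‖ + |2*k*φ t| * ‖B t‖ := by
            refine (norm_add_le _ _).trans ?_
            rw [norm_smul, norm_smul, Real.norm_eq_abs, Real.norm_eq_abs]
        _ ≤ K * ‖A t‖ + K * ‖B t‖ := by gcongr
        _ = _ := by ring
    have hInt : Integrable (fun t => K * (‖A t‖ + ‖B t‖)) := (hAi.norm.add hBi.norm).const_mul K
    calc ‖κ‖/6 = ‖(1/6:ℝ) • κ‖ := by rw [norm_smul]; norm_num; ring
      _ ≤ ∫ t in R..(2*R), K * (‖A t‖ + ‖B t‖) := by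
          rw [i2]
          refine intervalIntegral.norm_integral_le_of_norm_le (by linarith) ?_ hInt.intervalIntegrable
          exact ae_of_all _ fun t ht => bd t ⟨ht.1.le, ht.2⟩
      _ ≤ ∫ t in Set.Ioi R, K * (‖A t‖ + ‖B t‖) := by
          rw [intervalIntegral.integral_of_le (by linarith)]
          refine setIntegral_mono_set hInt.integrableOn ?_ (Set.Ioc_subset_Ioi_self.eventuallyLE)
          exact ae_of_all _ fun t => by positivity
      _ = _ := by rw [integral_const_mul]
  have lim : Filter.Tendsto (fun R : ℝ => K * ∫ t in Set.Ioi R, (‖A t‖ + ‖B t‖)) Filter.atTop (nhds (K * 0)) := by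
    refine Filter.Tendsto.const_mul _ ?_
    have := tendsto_setIntegral_of_antitone (μ := volume) (s := fun R : ℝ => Set.Ioi R) (f := fun t => ‖A t‖ + ‖B t‖) (fun R => measurableSet_Ioi)
      (fun a b hab => Set.Ioi_subset_Ioi hab) ⟨0, (hAi.norm.add hBi.norm).integrableOn⟩
    have he : (⋂ R : ℝ, Set.Ioi R) = (∅ : Set ℝ) := by
      ext x; simp only [Set.mem_iInter, Set.mem_Ioi, Set.mem_empty_iff_false, iff_false, not_forall, not_lt]
      exact ⟨x, le_rfl⟩
    rw [he] at this
    simpa using this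
  rw [mul_zero] at lim
  have : ‖κ‖/6 ≤ 0 := by
    refine ge_of_tendsto lim ?_
    filter_upwards [Filter.eventually_ge_atTop (max 1 k)] with R hR
    exact main R ((le_max_left _ _).trans hR) ((le_max_right _ _).trans hR)
  have : ‖κ‖ ≤ 0 := by linarith
  exact norm_le_zero_iff.1 this
end kap

section conv
variable [InnerProductSpace ℝ E]

lemma conv_half {k μ M : ℝ} {X P P' : ℝ → E} (hk : 0 < k) (hM : 0 < M)
    (hX : ∀ t, HasDerivAt X (P t) t) (hP : ∀ t, HasDerivAt P (P' t) t)
    (h : ∀ t, (k^2+t^2) • P' t + ((μ+2)*t) • P t = M • X t)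
    (g : ℝ → ℝ) (hg : Integrable g) (hb : ∀ t, ‖X t‖ ≤ (|t|+k) * g t)
    (t0 : ℝ) (h0 : 0 ≤ inner ℝ (X t0) (P t0)) : X t0 = 0 := by
  by_contra hne
  have hq : ∀ t : ℝ, 0 < k^2+t^2 := fun t => by positivity
  let s : ℝ → ℝ := fun t => (k^2+t^2) ^ (μ/2+1) * inner ℝ (X t) (P t)
  have hs : ∀ t, HasDerivAt s ((k^2+t^2) ^ (μ/2+1) * (‖P t‖^2 + M/(k^2+t^2) * ‖X t‖^2)) t := by
    intro t
    have h1 : HasDerivAt (fun t => k^2+t^2) (2*t) t := by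
      have := ((hasDerivAt_id t).pow 2).const_add (k^2)
      refine this.congr_deriv ?_; simp
    have h2 := h1.rpow_const (p := μ/2+1) (Or.inl (hq t).ne')
    have h3 := (hX t).inner ℝ (hP t)
    refine (h2.mul h3).congr_deriv ?_
    have h4 : P' t = (k^2+t^2)⁻¹ • (M • X t - ((μ+2)*t) • P t) := by
      rw [← h t, eq_inv_smul_iff₀ (hq t).ne']; module
    rw [h4, inner_smul_right, inner_sub_right, inner_smul_right, inner_smul_right,
      real_inner_self_eq_norm_sq, real_inner_self_eq_norm_sq, show μ/2+1-1 = (μ/2+1) - 1 by ring, Real.rpow_sub_one (hq t).ne']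
    have := (hq t).ne'
    field_simp
    ring
  have smono : Monotone s := by
    refine monotone_of_hasDerivAt_nonneg hs fun t => ?_
    have := hq t
    simp only [Pi.zero_apply]
    positivity
  have hs0 : 0 ≤ s t0 := mul_nonneg (Real.rpow_nonneg (hq t0).le _) h0
  have hin : ∀ t, t0 ≤ t → 0 ≤ inner ℝ (X t) (P t) := by
    intro t ht
    have h1 : 0 ≤ s t := hs0.trans (smono ht)
    have := Real.rpow_pos_of_pos (hq t) (μ/2+1)
    exact nonneg_of_mul_nonneg_right h1 this
  have hnd : ∀ t, HasDerivAt (fun t => ‖X t‖^2) (2 * inner ℝ (X t) (P t)) t := fun t => (hX t).norm_sq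
  have hmono : MonotoneOn (fun t => ‖X t‖^2) (Set.Ici t0) := by
    refine monotoneOn_of_hasDerivWithinAt_nonneg (convex_Ici t0) (f' := fun t => 2 * inner ℝ (X t) (P t)) ?_ ?_ ?_
    · exact fun t _ => (hnd t).continuousAt.continuousWithinAt
    · exact fun t _ => (hnd t).hasDerivWithinAt
    · intro t ht; rw [interior_Ici] at ht; have := hin t (le_of_lt ht); positivity
  have hlow : ∀ t, t0 ≤ t → ‖X t0‖ ≤ ‖X t‖ := by
    intro t ht
    have := hmono Set.self_mem_Ici ht ht
    exact (sq_le_sq₀ (norm_nonneg _) (norm_nonneg _)).1 this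
  have hc : 0 < ‖X t0‖ := norm_pos_iff.2 hne
  apply not_integrableOn_Ioi_inv (a := max t0 k)
  refine Integrable.mono' ((hg.const_mul (2/‖X t0‖)).integrableOn) (measurable_inv.aestronglyMeasurable) ?_
  filter_upwards [ae_restrict_mem measurableSet_Ioi] with t ht
  have ht1 : t0 < t := (le_max_left _ _).trans_lt ht
  have ht2 : k < t := (le_max_right _ _).trans_lt ht
  have htp : 0 < t := hk.trans ht2
  have h1 := (hlow t ht1.le).trans (hb t)
  rw [abs_of_pos htp] at h1
  have hgn : 0 ≤ g t := by
    by_contra hneg; push Not at hneg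
    nlinarith
  rw [norm_inv, Real.norm_eq_abs, abs_of_pos htp, inv_le_iff_one_le_mul₀ htp, div_mul_eq_mul_div, div_mul_eq_mul_div, le_div_iff₀ hc]
  nlinarith

lemma conv_zero {k μ M : ℝ} {X P P' : ℝ → E} (hk : 0 < k) (hM : 0 < M)
    (hX : ∀ t, HasDerivAt X (P t) t) (hP : ∀ t, HasDerivAt P (P' t) t)
    (h : ∀ t, (k^2+t^2) • P' t + ((μ+2)*t) • P t = M • X t)
    (g : ℝ → ℝ) (hg : Integrable g) (hb : ∀ t, ‖X t‖ ≤ (|t|+k) * g t) (t0 : ℝ) : X t0 = 0 := by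
  rcases le_total 0 (inner ℝ (X t0) (P t0)) with h0 | h0
  · exact conv_half hk hM hX hP h g hg hb t0 h0
  · have := conv_half (X := fun t => X (-t)) (P := fun t => -P (-t)) (P' := fun t => P' (-t)) (μ := μ) hk hM ?_ ?_ ?_ (fun t => g (-t)) hg.comp_neg ?_ (-t0) ?_
    · simpa using this
    · intro t; have := (hX (-t)).scomp t (hasDerivAt_neg t); simpa [Function.comp_def] using this
    · intro t; have := ((hP (-t)).scomp t (hasDerivAt_neg t)).neg; simpa [Function.comp_def, Pi.neg_def] using this
    · intro t; rw [← h (-t)]; simp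
    · intro t; have := hb (-t); simpa using this
    · simpa using h0
end conv
end

section
variable {E : Type*} [NormedAddCommGroup E] [InnerProductSpace ℝ E]

lemma hd_q (k t : ℝ) : HasDerivAt (fun t => k^2+t^2) (2*t) t := by
  have := ((hasDerivAt_id t).pow 2).const_add (k^2)
  refine this.congr_deriv ?_; simp
lemma hd_qr {k : ℝ} (hk : 0 < k) (r t : ℝ) : HasDerivAt (fun t => (k^2+t^2)^r) (2*r*t*(k^2+t^2)^(r-1)) t := by
  have := (hd_q k t).rpow_const (p := r) (Or.inl (by positivity))
  exact this.congr_deriv (by ring)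

lemma const_of_deriv_zero {f : ℝ → E} (h : ∀ t, HasDerivAt f 0 t) (t : ℝ) : f t = f 0 :=
  is_const_of_deriv_eq_zero (fun t => (h t).differentiableAt) (fun t => (h t).deriv) t 0

lemma sysA {k μ : ℝ} (hk : 0 < k) {A A' : ℝ → E} (hA : ∀ t, HasDerivAt A (A' t) t)
    (h : ∀ t, (k^2+t^2) • A' t + (μ*t) • A t = 0) : ∃ α : E, ∀ t, A t = ((k^2+t^2)^(-(μ/2))) • α := by
  have hq : ∀ t : ℝ, 0 < k^2+t^2 := fun t => by positivity
  have hd : ∀ t, HasDerivAt (fun t => ((k^2+t^2)^(μ/2)) • A t) 0 t := by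
    intro t
    refine ((hd_qr hk (μ/2) t).smul (hA t)).congr_deriv ?_
    have : (k^2+t^2)^(μ/2) = (k^2+t^2)^(μ/2-1) * (k^2+t^2) := by
      rw [← Real.rpow_add_one (hq t).ne']; ring_nf
    rw [this, mul_smul]
    have h2 : (k^2+t^2) • A' t = -((μ*t) • A t) := eq_neg_of_add_eq_zero_left (h t)
    rw [h2]; module
  refine ⟨((k^2+0^2)^(μ/2)) • A 0, fun t => ?_⟩
  rw [← const_of_deriv_zero hd t, smul_smul, ← Real.rpow_add (hq t)]; simp

/-- the first order system for the coupled components -/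
structure Sys (k μ M : ℝ) (C B b : ℝ → E) : Prop where
  hC : ∀ t, HasDerivAt C ((k^2+t^2)⁻¹ • (-((μ*t) • C t) - (2*k) • B t)) t
  hB : ∀ t, HasDerivAt B ((k^2+t^2)⁻¹ • (b t - (μ*t) • B t + (2*k) • C t)) t
  hb : ∀ t, HasDerivAt b ((M+μ) • B t) t

/-- first integral -/
def ee1 (k μ M : ℝ) (C B b : ℝ → E) (t : ℝ) : E :=
  ((k^2+t^2)*(1-M/2) - μ*t^2 - 2*k^2) • C t + (μ*t*k - 2*k*t) • B t - k • b t

lemma Sys.V {k μ M : ℝ} (hk : 0 < k) {C B b : ℝ → E} (h : Sys k μ M C B b) (t : ℝ) :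
    HasDerivAt (fun t => t • C t - k • B t) ((M/2) • C t + (k^2+t^2)⁻¹ • ee1 k μ M C B b t) t := by
  have hq : 0 < k^2+t^2 := by positivity
  refine (((hasDerivAt_id t).smul (h.hC t)).sub ((h.hB t).const_smul k)).congr_deriv ?_
  unfold ee1
  simp only [id]
  match_scalars <;> field_simp <;> ring

lemma Sys.zero {k μ M : ℝ} (hk : 0 < k) (hM : 0 < M) {C B b : ℝ → E} (h : Sys k μ M C B b)
    (he : ∀ t, ee1 k μ M C B b t = 0) (hCi : Integrable C) (hBi : Integrable B) (t : ℝ) : C t = 0 ∧ B t = 0 := by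
  have hV : ∀ t, HasDerivAt (fun t => t • C t - k • B t) ((M/2) • C t) t := by
    intro t; have := h.V hk t; rwa [he, smul_zero, add_zero] at this
  have z : ∀ t, t • C t - k • B t = 0 := by
    refine conv_zero (P' := fun t => (M/2) • ((k^2+t^2)⁻¹ • (-((μ*t) • C t) - (2*k) • B t))) (μ := μ) hk hM hV (fun t => (h.hC t).const_smul (M/2)) ?_ (fun t => ‖C t‖ + ‖B t‖)
      (hCi.norm.add hBi.norm) ?_
    · intro t
      have hq : 0 < k^2+t^2 := by positivity
      match_scalars <;> field_simp <;> ring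
    · intro t
      refine (norm_sub_le _ _).trans ?_
      rw [norm_smul, norm_smul, Real.norm_eq_abs, Real.norm_eq_abs, abs_of_pos hk]
      nlinarith [mul_nonneg (abs_nonneg t) (norm_nonneg (B t)), mul_nonneg hk.le (norm_nonneg (C t))]
  have hC0 : ∀ t, C t = 0 := by
    intro t
    have h1 := hV t
    rw [show (fun t => t • C t - k • B t) = fun _ => (0:E) from funext z] at h1
    have := h1.unique (hasDerivAt_const t 0)
    exact (smul_eq_zero.1 this).resolve_left (by positivity)
  refine ⟨hC0 t, ?_⟩
  have := z t
  rw [hC0, smul_zero, zero_sub, neg_eq_zero] at this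
  exact (smul_eq_zero.1 this).resolve_left hk.ne'

lemma Sys.ee1_const {k μ M : ℝ} (hk : 0 < k) {C B b : ℝ → E} (h : Sys k μ M C B b) (t : ℝ) :
    ((k^2+t^2)^(μ/2-1)) • ee1 k μ M C B b t = ((k^2+0^2)^(μ/2-1)) • ee1 k μ M C B b 0 := by
  refine const_of_deriv_zero (f := fun t => ((k^2+t^2)^(μ/2-1)) • ee1 k μ M C B b t) (fun t => ?_) t
  have hq : 0 < k^2+t^2 := by positivity
  have a1 : HasDerivAt (fun t => (k^2+t^2)*(1-M/2) - μ*t^2 - 2*k^2) (2*t*(1-M/2) - μ*(2*t)) t := by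
    have := (((hd_q k t).mul_const (1-M/2)).sub (((hasDerivAt_id t).pow 2).const_mul μ)).sub_const (2*k^2)
    exact this.congr_deriv (by simp)
  have a2 : HasDerivAt (fun t => μ*t*k - 2*k*t) (μ*k-2*k) t := by
    have := (((hasDerivAt_id t).const_mul μ).mul_const k).sub ((hasDerivAt_id t).const_mul (2*k))
    exact this.congr_deriv (by simp)
  have e' := ((a1.smul (h.hC t)).add (a2.smul (h.hB t))).sub ((h.hb t).const_smul k)
  refine ((hd_qr hk (μ/2-1) t).smul e').congr_deriv ?_
  have h1 : (k^2+t^2)^(μ/2-1) = (k^2+t^2)^(μ/2-1-1) * (k^2+t^2) := by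
    rw [← Real.rpow_add_one hq.ne']; ring_nf
  rw [h1]
  simp only [Pi.add_apply, Pi.sub_apply, Pi.smul_apply, Pi.smul_apply']
  match_scalars <;> field_simp <;> ring

/-- the third profile -/
def b0 (μ M k t : ℝ) : ℝ := -(2*k*((M+μ)/M) * (k^2+t^2)^(-(μ/2)))

lemma sys_part {k μ M : ℝ} (hk : 0 < k) (hM : 0 < M) (γ : E) :
    Sys k μ M (fun t => C0 μ M k t • γ) (fun t => B0 μ M k t • γ) (fun t => b0 μ M k t • γ) := by
  have hq : ∀ t : ℝ, 0 < k^2+t^2 := fun t => by positivity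
  have e1 : ∀ t : ℝ, (k^2+t^2)^(-(μ/2)) = (k^2+t^2)^(-(μ/2)-1-1) * (k^2+t^2)^2 := by
    intro t; rw [← Real.rpow_natCast (k^2+t^2) 2, ← Real.rpow_add (hq t)]; push_cast; ring_nf
  have e2 : ∀ t : ℝ, (k^2+t^2)^(-(μ/2)-1) = (k^2+t^2)^(-(μ/2)-1-1) * (k^2+t^2) := by
    intro t; rw [← Real.rpow_add_one (hq t).ne']; ring_nf
  constructor
  · intro t
    have := ((hd_qr hk (-(μ/2)) t).add ((hd_qr hk (-(μ/2)-1) t).const_mul (2*μ/M*k^2))).smul_const γ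
    refine this.congr_deriv ?_
    have := hq t
    rw [smul_sub, smul_neg, smul_smul, smul_smul, smul_smul, smul_smul, ← neg_smul, ← sub_smul]
    congr 1
    unfold C0 B0
    rw [e1, e2]
    field_simp; ring
  · intro t
    have := (((hasDerivAt_id t).const_mul (2*μ/M*k)).mul (hd_qr hk (-(μ/2)-1) t)).smul_const γ
    refine this.congr_deriv ?_
    have := hq t
    rw [smul_smul, smul_smul, ← sub_smul, ← add_smul, smul_smul]
    congr 1
    unfold C0 B0 b0
    rw [e1, e2]
    simp only [id]
    field_simp; ring
  · intro t
    have := (((hd_qr hk (-(μ/2)) t).const_mul (2*k*((M+μ)/M))).neg).smul_const γ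
    refine this.congr_deriv ?_
    rw [smul_smul]; congr 1
    unfold B0
    field_simp

lemma ee1_part {k μ M : ℝ} (hk : 0 < k) (hM : 0 < M) (γ : E) :
   ((k^2+0^2)^(μ/2-1)) • ee1 k μ M (fun t => C0 μ M k t • γ) (fun t => B0 μ M k t • γ) (fun t => b0 μ M k t • γ) 0 = (1-M/2-μ) • γ := by
  unfold ee1
  rw [smul_smul, smul_smul, smul_smul, ← add_smul, ← sub_smul, smul_smul]
  congr 1
  unfold C0 B0 b0
  have hq : (0:ℝ) < k^2+0^2 := by positivity
  have h1 : (k^2+0^2)^(-(μ/2)) = ((k^2+0^2)^(μ/2-1) * (k^2+0^2))⁻¹ := by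
    rw [← Real.rpow_add_one hq.ne', ← Real.rpow_neg hq.le]; ring_nf
  have h2 : (k^2+0^2)^(-(μ/2)-1) = ((k^2+0^2)^(μ/2-1) * (k^2+0^2)^2)⁻¹ := by
    rw [← Real.rpow_natCast (k^2+0^2) 2, ← Real.rpow_add hq, ← Real.rpow_neg hq.le]; push_cast; ring_nf
  rw [h1, h2]
  have := Real.rpow_pos_of_pos hq (μ/2-1)
  generalize (k^2+0^2)^(μ/2-1) = z at *
  norm_num
  field_simp
  ring

lemma Sys.sub {k μ M : ℝ} {C B b C' B' b' : ℝ → E} (h : Sys k μ M C B b) (h' : Sys k μ M C' B' b') :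
    Sys k μ M (fun t => C t - C' t) (fun t => B t - B' t) (fun t => b t - b' t) := by
  constructor
  · intro t; refine ((h.hC t).sub (h'.hC t)).congr_deriv ?_; module
  · intro t; refine ((h.hB t).sub (h'.hB t)).congr_deriv ?_; module
  · intro t; refine ((h.hb t).sub (h'.hb t)).congr_deriv ?_; module

lemma C0_int {k μ M : ℝ} (hk : 0 < k) (hμ : 1 < μ) : Integrable (C0 μ M k) := by
  have h1 := q_int (s := μ/2) (by linarith) hk
  have h2 := q_int (s := μ/2+1) (by linarith) hk
  unfold C0
  refine h1.add ?_
  simp only [show -(μ/2)-1 = -(μ/2+1) by ring]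
  exact h2.const_mul _
lemma B0_int {k μ M : ℝ} (hk : 0 < k) (hμ : 1 < μ) : Integrable (B0 μ M k) := by
  have h1 := q_int (s := μ/2) (by linarith) hk
  refine (h1.const_mul (|2*μ/M|)).mono' ?_ ?_
  · apply Measurable.aestronglyMeasurable; unfold B0; fun_prop
  · refine ae_of_all _ fun t => ?_
    have hq : 0 < k^2+t^2 := by positivity
    have : (k^2+t^2)^(-(μ/2)) = (k^2+t^2) * (k^2+t^2)^(-(μ/2)-1) := by
      rw [mul_comm, ← Real.rpow_add_one hq.ne']; ring_nf
    rw [this, B0, norm_mul, Real.norm_of_nonneg (Real.rpow_nonneg hq.le _), ← mul_assoc, mul_assoc (2*μ/M), norm_mul, Real.norm_eq_abs]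
    have := Real.rpow_nonneg hq.le (-(μ/2)-1)
    gcongr
    rw [Real.norm_eq_abs, abs_le]; constructor <;> nlinarith [sq_nonneg (k-t), sq_nonneg (k+t)]

lemma Sys.solve {k μ M : ℝ} (hk : 0 < k) (hμ : 1 < μ) (hM : 0 < M) {C B b : ℝ → E} (h : Sys k μ M C B b)
    (hCi : Integrable C) (hBi : Integrable B) : ∃ γ : E, ∀ t, C t = C0 μ M k t • γ ∧ B t = B0 μ M k t • γ := by
  set c := ((k^2+0^2)^(μ/2-1)) • ee1 k μ M C B b 0 with hc
  have hne : 1-M/2-μ ≠ 0 := by intro h; linarith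
  refine ⟨(1-M/2-μ)⁻¹ • c, fun t => ?_⟩
  set γ := (1-M/2-μ)⁻¹ • c with hγ
  have hs := h.sub (sys_part (μ := μ) hk hM γ)
  have hz : ∀ t, ee1 k μ M (fun t => C t - C0 μ M k t • γ) (fun t => B t - B0 μ M k t • γ) (fun t => b t - b0 μ M k t • γ) t = 0 := by
    intro t
    have h1 := hs.ee1_const hk t
    have h2 : ee1 k μ M (fun t => C t - C0 μ M k t • γ) (fun t => B t - B0 μ M k t • γ) (fun t => b t - b0 μ M k t • γ) 0
      = ee1 k μ M C B b 0 - ee1 k μ M (fun t => C0 μ M k t • γ) (fun t => B0 μ M k t • γ) (fun t => b0 μ M k t • γ) 0 := by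
      unfold ee1; module
    rw [h2, smul_sub, ee1_part hk hM, ← hc, hγ, smul_inv_smul₀ hne, sub_self] at h1
    exact (smul_eq_zero.1 h1).resolve_left (Real.rpow_pos_of_pos (by positivity) _).ne'
  have := hs.zero hk hM hz (hCi.sub ((C0_int hk hμ).smul_const γ)) (hBi.sub ((B0_int hk hμ).smul_const γ)) t
  exact ⟨sub_eq_zero.1 this.1, sub_eq_zero.1 this.2⟩
end

section
variable {n m : ℕ}

lemma iot_neg (x : Fin n → ℂ) (v : Lam n) : iot x (-v) = - iot x v := (iotL x).map_neg v
lemma eps_neg (x : Fin n → ℂ) (v : Lam n) : eps x (-v) = - eps x v := (epsL x).map_neg v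
lemma iot_sub (x : Fin n → ℂ) (v w : Lam n) : iot x (v-w) = iot x v - iot x w := (iotL x).map_sub v w
lemma eps_sub (x : Fin n → ℂ) (v w : Lam n) : eps x (v-w) = eps x v - eps x w := (epsL x).map_sub v w
lemma iot_rsmul (x : Fin n → ℂ) (c : ℝ) (v : Lam n) : iot x (c • v) = c • iot x v := by
  rw [← Complex.coe_smul, iot_smul, Complex.coe_smul]
lemma eps_rsmul (x : Fin n → ℂ) (c : ℝ) (v : Lam n) : eps x (c • v) = c • eps x v := by
  rw [← Complex.coe_smul, eps_smul, Complex.coe_smul]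

section car
variable (x : Rn m) (hx : x ≠ 0) (v : Lam (m+1))
/-- abbreviation for the last vector -/
abbrev el (m : ℕ) : Fin (m+1) → ℂ := ee (Fin.last m)
lemma car1 (x : Rn m) (hx : x ≠ 0) (v : Lam (m+1)) : iot (rc (om x)) (eps (rc (om x)) v) = v - eps (rc (om x)) (iot (rc (om x)) v) := by
  rw [eq_sub_iff_add_eq, iot_eps, sum_om x hx, one_smul]
lemma car2 : iot (rc (om x)) (eps (el m) v) = - eps (el m) (iot (rc (om x)) v) := by
  rw [eq_neg_iff_add_eq_zero, iot_eps, sum_om_en x, zero_smul]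
lemma car3 : iot (el m) (eps (rc (om x)) v) = - eps (rc (om x)) (iot (el m) v) := by
  rw [eq_neg_iff_add_eq_zero, iot_eps, sum_en_om x, zero_smul]
lemma car4 : iot (el m) (eps (el m) v) = v - eps (el m) (iot (el m) v) := by
  rw [eq_sub_iff_add_eq, iot_eps, sum_en_en, one_smul]
lemma car5 : iot (el m) (iot (rc (om x)) v) = - iot (rc (om x)) (iot (el m) v) := iot_iot _ _ _
lemma car6 : eps (el m) (eps (rc (om x)) v) = - eps (rc (om x)) (eps (el m) v) := eps_eps _ _ _
end car

/-- the coupling operator -/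
def TT (x : Rn m) : Lam (m+1) →L[ℂ] Lam (m+1) :=
  (‖x‖:ℂ) • (iotL (el m) ∘L epsL (rc (om x)) + epsL (el m) ∘L iotL (rc (om x)))
/-- the normal projection -/
def ZZ (m : ℕ) : Lam (m+1) →L[ℂ] Lam (m+1) := epsL (el m) ∘L iotL (el m)

/-- component projections -/
def LL1 (x : Rn m) : Lam (m+1) →L[ℂ] Lam (m+1) := iotL (rc (om x)) ∘L epsL (rc (om x)) ∘L iotL (el m) ∘L epsL (el m)
/-- component projections -/
def LL2 (x : Rn m) : Lam (m+1) →L[ℂ] Lam (m+1) := iotL (rc (om x)) ∘L iotL (el m)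
/-- component projections -/
def LL3 (x : Rn m) : Lam (m+1) →L[ℂ] Lam (m+1) := iotL (rc (om x)) ∘L iotL (el m) ∘L epsL (el m)
/-- component projections -/
def LL4 (x : Rn m) : Lam (m+1) →L[ℂ] Lam (m+1) := iotL (rc (om x)) ∘L epsL (rc (om x)) ∘L iotL (el m)

section ids

lemma decomp (x : Rn m) (hx : x ≠ 0) (v : Lam (m+1)) : v = LL1 x v + eps (rc (om x)) (LL3 x v) + eps (el m) (LL4 x v) + eps (el m) (eps (rc (om x)) (LL2 x v)) := by
  simp only [LL1, LL2, LL3, LL4, ContinuousLinearMap.comp_apply, iotL_apply, epsL_apply]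
  simp only [car1 x hx, car2 x, car3 x, car4, car5 x, car6 x, iot_iot_self, eps_eps_self, iot_add, eps_add, iot_sub, eps_sub, iot_neg, eps_neg, eps_zero, iot_zero]
  abel
lemma l1T (x : Rn m) (hx : x ≠ 0) (v : Lam (m+1)) : LL1 x (TT x v) = 0 := by
  simp only [LL1, TT, ContinuousLinearMap.comp_apply, iotL_apply, epsL_apply, ContinuousLinearMap.smul_apply, ContinuousLinearMap.add_apply, iot_smul, eps_smul]
  simp only [car1 x hx, car2 x, car3 x, car4, car5 x, car6 x, iot_iot_self, eps_eps_self, iot_add, eps_add, iot_sub, eps_sub, iot_neg, eps_neg, eps_zero, iot_zero]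
  module
lemma l1Z (x : Rn m) (hx : x ≠ 0) (v : Lam (m+1)) : LL1 x (ZZ m v) = 0 := by
  simp only [LL1, ZZ, ContinuousLinearMap.comp_apply, iotL_apply, epsL_apply]
  simp only [car1 x hx, car2 x, car3 x, car4, car5 x, car6 x, iot_iot_self, eps_eps_self, iot_add, eps_add, iot_sub, eps_sub, iot_neg, eps_neg, eps_zero, iot_zero]
  try module
lemma l2T (x : Rn m) (hx : x ≠ 0) (v : Lam (m+1)) : LL2 x (TT x v) = 0 := by
  simp only [LL2, TT, ContinuousLinearMap.comp_apply, iotL_apply, epsL_apply, ContinuousLinearMap.smul_apply, ContinuousLinearMap.add_apply, iot_smul, eps_smul]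
  simp only [car1 x hx, car2 x, car3 x, car4, car5 x, car6 x, iot_iot_self, eps_eps_self, iot_add, eps_add, iot_sub, eps_sub, iot_neg, eps_neg, eps_zero, iot_zero]
  module
lemma l2Z (x : Rn m) (hx : x ≠ 0) (v : Lam (m+1)) : LL2 x (ZZ m v) = LL2 x v := by
  simp only [LL2, ZZ, ContinuousLinearMap.comp_apply, iotL_apply, epsL_apply]
  simp only [car1 x hx, car2 x, car3 x, car4, car5 x, car6 x, iot_iot_self, eps_eps_self, iot_add, eps_add, iot_sub, eps_sub, iot_neg, eps_neg, eps_zero, iot_zero]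
  try module
lemma l3T (x : Rn m) (hx : x ≠ 0) (v : Lam (m+1)) : LL3 x (TT x v) = -((‖x‖:ℂ) • LL4 x v) := by
  simp only [LL3, LL4, TT, ContinuousLinearMap.comp_apply, iotL_apply, epsL_apply, ContinuousLinearMap.smul_apply, ContinuousLinearMap.add_apply, iot_smul, eps_smul]
  simp only [car1 x hx, car2 x, car3 x, car4, car5 x, car6 x, iot_iot_self, eps_eps_self, iot_add, eps_add, iot_sub, eps_sub, iot_neg, eps_neg, eps_zero, iot_zero]
  module
lemma l3Z (x : Rn m) (hx : x ≠ 0) (v : Lam (m+1)) : LL3 x (ZZ m v) = 0 := by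
  simp only [LL3, ZZ, ContinuousLinearMap.comp_apply, iotL_apply, epsL_apply]
  simp only [car1 x hx, car2 x, car3 x, car4, car5 x, car6 x, iot_iot_self, eps_eps_self, iot_add, eps_add, iot_sub, eps_sub, iot_neg, eps_neg, eps_zero, iot_zero]
  try module
lemma l4T (x : Rn m) (hx : x ≠ 0) (v : Lam (m+1)) : LL4 x (TT x v) = (‖x‖:ℂ) • LL3 x v := by
  simp only [LL3, LL4, TT, ContinuousLinearMap.comp_apply, iotL_apply, epsL_apply, ContinuousLinearMap.smul_apply, ContinuousLinearMap.add_apply, iot_smul, eps_smul]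
  simp only [car1 x hx, car2 x, car3 x, car4, car5 x, car6 x, iot_iot_self, eps_eps_self, iot_add, eps_add, iot_sub, eps_sub, iot_neg, eps_neg, eps_zero, iot_zero]
  module
lemma l4Z (x : Rn m) (hx : x ≠ 0) (v : Lam (m+1)) : LL4 x (ZZ m v) = LL4 x v := by
  simp only [LL4, ZZ, ContinuousLinearMap.comp_apply, iotL_apply, epsL_apply]
  simp only [car1 x hx, car2 x, car3 x, car4, car5 x, car6 x, iot_iot_self, eps_eps_self, iot_add, eps_add, iot_sub, eps_sub, iot_neg, eps_neg, eps_zero, iot_zero]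
  try module
lemma l1tang (x : Rn m) (hx : x ≠ 0) (v : Lam (m+1)) : Tang (rc (om x)) (LL1 x v) := by
  constructor <;>
  · simp only [LL1, ContinuousLinearMap.comp_apply, iotL_apply, epsL_apply]
    simp only [car1 x hx, car2 x, car3 x, car4, car5 x, car6 x, iot_iot_self, eps_eps_self, iot_add, eps_add, iot_sub, eps_sub, iot_neg, eps_neg, eps_zero, iot_zero]
    try module
lemma l3tang (x : Rn m) (hx : x ≠ 0) (v : Lam (m+1)) : Tang (rc (om x)) (LL3 x v) := by
  constructor <;>
  · simp only [LL3, ContinuousLinearMap.comp_apply, iotL_apply, epsL_apply]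
    simp only [car1 x hx, car2 x, car3 x, car4, car5 x, car6 x, iot_iot_self, eps_eps_self, iot_add, eps_add, iot_sub, eps_sub, iot_neg, eps_neg, eps_zero, iot_zero]
    try module
end ids

lemma tang_of_smul {x : Rn m} {c : ℝ} (hc : c ≠ 0) {v : Lam (m+1)} (h : Tang (rc (om x)) (c • v)) : Tang (rc (om x)) v := by
  refine ⟨(smul_eq_zero.1 ?_).resolve_left hc, (smul_eq_zero.1 ?_).resolve_left hc⟩
  · rw [← iot_rsmul]; exact h.1
  · rw [← iot_rsmul]; exact h.2

lemma hd_clm (L : Lam n →L[ℂ] Lam n) {f : ℝ → Lam n} {f' : Lam n} {t : ℝ} (h : HasDerivAt f f' t) :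
    HasDerivAt (fun t => L (f t)) (L f') t :=
  ((L.restrictScalars ℝ).hasFDerivAt.comp_hasDerivAt t h)

lemma clm_rsmul (L : Lam n →L[ℂ] Lam n) (c : ℝ) (v : Lam n) : L (c • v) = c • L v :=
  (L.restrictScalars ℝ).map_smul c v

theorem ode_fib {μ M : ℝ} (hμ : 1 < μ) (hM : 0 < M) (x : Rn m) (hx : x ≠ 0) (y w : ℝ → Lam (m+1))
    (hy : ∀ t, HasDerivAt y ((‖x‖^2+t^2)⁻¹ • (w t + (2:ℝ) • TT x (y t) - (μ*t) • y t)) t)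
    (hw : ∀ t, HasDerivAt w ((M+μ) • ZZ m (y t)) t) (hyi : Integrable y) :
    ∃ α γ, Tang (rc (om x)) α ∧ Tang (rc (om x)) γ ∧ ∀ t, y t = Fib μ M ‖x‖ (rc (om x)) α γ t := by
  have hk := norm_pos_iff.2 hx
  have hq : ∀ t : ℝ, ‖x‖^2+t^2 ≠ 0 := fun t => by positivity
  have hd : ∀ (L : Lam (m+1) →L[ℂ] Lam (m+1)) t, HasDerivAt (fun t => L (y t)) ((‖x‖^2+t^2)⁻¹ • (L (w t) + (2:ℝ) • L (TT x (y t)) - (μ*t) • L (y t))) t := by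
    intro L t
    refine (hd_clm L (hy t)).congr_deriv ?_
    rw [clm_rsmul, map_sub, map_add, clm_rsmul, clm_rsmul]
  have hdw : ∀ (L : Lam (m+1) →L[ℂ] Lam (m+1)) t, HasDerivAt (fun t => L (w t)) ((M+μ) • L (ZZ m (y t))) t := by
    intro L t
    refine (hd_clm L (hw t)).congr_deriv ?_
    rw [clm_rsmul]
  have hyc : Continuous y := continuous_iff_continuousAt.2 fun t => (hy t).continuousAt
  have hli : ∀ (L : Lam (m+1) →L[ℂ] Lam (m+1)), Integrable (fun t => L (y t)) := fun L => L.integrable_comp hyi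
  -- the first component
  have hA : ∃ α, ∀ t, LL1 x (y t) = ((‖x‖^2+t^2)^(-(μ/2))) • α := by
    have c1 : ∀ t, LL1 x (w t) = LL1 x (w 0) := by
      refine const_of_deriv_zero (fun t => ?_)
      have := hdw (LL1 x) t
      rwa [l1Z x hx, smul_zero] at this
    refine sysA hk (hd (LL1 x)) (fun t => ?_)
    have hz : LL1 x (w 0) = 0 := by
      refine kappa_zero (k := ‖x‖) (μ := μ) (B := fun _ => 0) _ (hd (LL1 x)) continuous_const (hli _) (integrable_zero _ _ _) (fun t => ?_) hk
      rw [smul_inv_smul₀ (hq t), l1T x hx, c1]; module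
    rw [smul_inv_smul₀ (hq t), l1T x hx, c1, hz]; module
  -- the coupled components
  have hCB : ∃ γ, ∀ t, LL3 x (y t) = C0 μ M ‖x‖ t • γ ∧ LL4 x (y t) = B0 μ M ‖x‖ t • γ := by
    have c1 : ∀ t, LL3 x (w t) = LL3 x (w 0) := by
      refine const_of_deriv_zero (fun t => ?_)
      have := hdw (LL3 x) t
      rwa [l3Z x hx, smul_zero] at this
    have hz : LL3 x (w 0) = 0 := by
      refine kappa_zero (k := ‖x‖) (μ := μ) (B := fun t => LL4 x (y t)) _ (hd (LL3 x)) ((LL4 x).continuous.comp hyc) (hli _) (hli _) (fun t => ?_) hk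
      rw [smul_inv_smul₀ (hq t), l3T x hx, c1, Complex.coe_smul]; module
    refine Sys.solve (b := fun t => LL4 x (w t)) hk hμ hM ⟨fun t => ?_, fun t => ?_, fun t => ?_⟩ (hli _) (hli _)
    · refine (hd (LL3 x) t).congr_deriv ?_
      rw [l3T x hx, c1, hz, Complex.coe_smul]; module
    · refine (hd (LL4 x) t).congr_deriv ?_
      rw [l4T x hx, Complex.coe_smul]; module
    · refine (hdw (LL4 x) t).congr_deriv ?_
      rw [l4Z x hx]
  -- the last component
  have hD : ∀ t, LL2 x (y t) = 0 := by
    have h1 : ∀ t, HasDerivAt (fun t => LL2 x (y t)) ((‖x‖^2+t^2)⁻¹ • (LL2 x (w t) - (μ*t) • LL2 x (y t))) t := by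
      intro t
      have := hd (LL2 x) t
      rwa [l2T x hx, smul_zero, add_zero] at this
    have h2 : ∀ t, HasDerivAt (fun t => LL2 x (w t)) ((M+μ) • LL2 x (y t)) t := by
      intro t; have := hdw (LL2 x) t; rwa [l2Z x hx] at this
    have h3 : ∀ t, HasDerivAt (fun t => (‖x‖^2+t^2)⁻¹ • (LL2 x (w t) - (μ*t) • LL2 x (y t))) 
       (((‖x‖^2+t^2)⁻¹ • ((M+μ) • LL2 x (y t) - ((μ*t) • ((‖x‖^2+t^2)⁻¹ • (LL2 x (w t) - (μ*t) • LL2 x (y t))) + μ • LL2 x (y t)))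
        + (-(2*t)/(‖x‖^2+t^2)^2) • (LL2 x (w t) - (μ*t) • LL2 x (y t)))) t := by
      intro t
      have e1 := (hd_q ‖x‖ t).inv (hq t)
      have e2 : HasDerivAt (fun t => μ * t) μ t := by simpa using (hasDerivAt_id t).const_mul μ
      exact e1.smul ((h2 t).sub (e2.smul (h1 t)))
    refine conv_zero (μ := μ) hk hM h1 h3 (fun t => ?_) (fun t => ‖x‖⁻¹ * ‖LL2 x (y t)‖) ((hli (LL2 x)).norm.const_mul _) (fun t => ?_)
    · have := hq t
      match_scalars <;> field_simp <;> ring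
    · have : ‖LL2 x (y t)‖ = ‖x‖ * (‖x‖⁻¹ * ‖LL2 x (y t)‖) := by field_simp
      calc _ = ‖x‖ * (‖x‖⁻¹ * ‖LL2 x (y t)‖) := this
        _ ≤ _ := by gcongr; linarith [abs_nonneg t]
  obtain ⟨α, hα⟩ := hA
  obtain ⟨γ, hγ⟩ := hCB
  have hC0 : 0 < C0 μ M ‖x‖ 0 := by unfold C0; positivity
  refine ⟨α, γ, ?_, ?_, fun t => ?_⟩
  · refine tang_of_smul (c := (‖x‖^2+0^2)^(-(μ/2))) (Real.rpow_pos_of_pos (by positivity) _).ne' ?_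
    rw [← hα]; exact l1tang x hx _
  · refine tang_of_smul hC0.ne' ?_
    rw [← (hγ 0).1]; exact l3tang x hx _
  · rw [decomp x hx (y t), hD, hα, (hγ t).1, (hγ t).2, eps_zero, eps_zero, add_zero, eps_rsmul, eps_rsmul]
    simp only [Fib, Complex.coe_smul]
end

section
variable {n m : ℕ}
section weak
variable {E : Type*} [NormedAddCommGroup E] [NormedSpace ℝ E] [CompleteSpace E]

/-- smooth compactly supported functions on the line -/
def Tst (η : ℝ → ℝ) : Prop := ContDiff ℝ ((⊤ : ℕ∞) : WithTop ℕ∞) η ∧ HasCompactSupport η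

lemma Tst.deriv {η : ℝ → ℝ} (h : Tst η) : Tst (deriv η) := by
  refine ⟨?_, h.2.deriv⟩
  have := (contDiff_infty_iff_deriv.1 h.1).2
  exact this

lemma Tst.c1 {η : ℝ → ℝ} (h : Tst η) : ContDiff ℝ 1 η := h.1.of_le (by exact_mod_cast le_top)
lemma Tst.hd {η : ℝ → ℝ} (h : Tst η) (t : ℝ) : HasDerivAt η (_root_.deriv η t) t :=
  (h.c1.differentiable (by norm_num) t).hasDerivAt
lemma Tst.int {η : ℝ → ℝ} (h : Tst η) : Integrable η := h.c1.continuous.integrable_of_hasCompactSupport h.2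
lemma Tst.int_smul {η : ℝ → ℝ} (h : Tst η) {g : ℝ → E} (hg : LocallyIntegrable g) :
    Integrable (fun t => η t • g t) :=
  hg.integrable_smul_left_of_hasCompactSupport h.c1.continuous h.2

lemma Tst.bd {η : ℝ → ℝ} (h : Tst η) : ∃ R : ℝ, 0 < R ∧ ∀ t, R ≤ |t| → η t = 0 := by
  obtain ⟨R, hR, h1⟩ := h.2.exists_pos_le_norm
  exact ⟨R, hR, h1⟩

lemma ibp_int {η : ℝ → ℝ} (h : Tst η) {G : ℝ → E} (hG : Integrable G) :
    ∫ t, deriv η t • ∫ s in Set.Iic t, G s = - ∫ t, η t • G t := by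
  have hF : Integrable (Function.uncurry fun (t s : ℝ) => if s ≤ t then deriv η t • G s else 0) (volume.prod volume) := by
    have h1 : Integrable (fun z : ℝ × ℝ => deriv η z.1 • G z.2) (volume.prod volume) := by
      exact Integrable.smul_prod h.deriv.int hG
    have h2 := h1.indicator (measurableSet_le measurable_snd measurable_fst)
    refine h2.congr (ae_of_all _ fun z => ?_)
    simp [Set.indicator, Function.uncurry]
  have := integral_integral_swap hF
  have e1 : ∀ t, ∫ s, (if s ≤ t then deriv η t • G s else 0) = deriv η t • ∫ s in Set.Iic t, G s := by
    intro t
    rw [← integral_smul, ← integral_indicator measurableSet_Iic]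
    congr 1
  have e2 : ∀ s, ∫ t, (if s ≤ t then deriv η t • G s else 0) = - (η s • G s) := by
    intro s
    have : (fun t => if s ≤ t then deriv η t • G s else 0) = Set.indicator (Set.Ici s) (fun t => deriv η t • G s) := by
      ext t; simp [Set.indicator]
    rw [this, integral_indicator measurableSet_Ici, integral_Ici_eq_integral_Ioi, integral_smul_const,
      h.2.integral_Ioi_deriv_eq h.c1, neg_smul]
  simp only [e1, e2] at this
  rw [this, integral_neg]

lemma Tst.deriv_int {η : ℝ → ℝ} (h : Tst η) : ∫ t, _root_.deriv η t = 0 :=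
  integral_eq_zero_of_hasDerivAt_of_integrable (fun t => h.hd t) h.deriv.int h.int

lemma ibp_loc {η : ℝ → ℝ} (h : Tst η) {g : ℝ → E} (hg : LocallyIntegrable g) :
    ∫ t, deriv η t • ∫ s in (0:ℝ)..t, g s = - ∫ t, η t • g t := by
  obtain ⟨R1, hR1, hz1⟩ := h.bd
  obtain ⟨R2, hR2, hz2⟩ := h.deriv.bd
  set R := max R1 R2
  have hR : 0 < R := lt_max_of_lt_left hR1
  set G := Set.indicator (Set.Icc (-R) R) g with hGdef
  have hG : Integrable G := by
    rw [hGdef, integrable_indicator_iff measurableSet_Icc]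
    exact hg.integrableOn_isCompact isCompact_Icc
  have h1 := ibp_int h hG
  have e1 : ∫ t, η t • G t = ∫ t, η t • g t := by
    congr 1; ext t
    by_cases ht : |t| < R
    · rw [hGdef, Set.indicator_of_mem (by constructor <;> linarith [abs_lt.1 ht])]
    · rw [hz1 t ((le_max_left _ _).trans (not_lt.1 ht)), zero_smul, zero_smul]
  have hii : ∀ a b, IntervalIntegrable g volume a b := fun a b => (hg.integrableOn_isCompact isCompact_uIcc).intervalIntegrable
  have e2 : ∀ t, deriv η t • ∫ s in Set.Iic t, G s = deriv η t • (∫ s in (0:ℝ)..t, g s) + deriv η t • (∫ s in (-R)..0, g s) := by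
    intro t
    by_cases ht : |t| < R
    · rw [← smul_add]; congr 1
      rw [add_comm, intervalIntegral.integral_add_adjacent_intervals (hii _ _) (hii _ _),
        intervalIntegral.integral_of_le (by linarith [abs_lt.1 ht]), hGdef, setIntegral_indicator measurableSet_Icc, ← integral_Icc_eq_integral_Ioc]
      congr 2
      ext s; simp only [Set.mem_inter_iff, Set.mem_Iic, Set.mem_Icc]
      have := abs_lt.1 ht
      constructor
      · rintro ⟨a, b, c⟩; exact ⟨b, a⟩
      · rintro ⟨a, b⟩; exact ⟨b, a, by linarith⟩
    · rw [hz2 t ((le_max_right _ _).trans (not_lt.1 ht)), zero_smul, zero_smul, zero_smul, add_zero]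
  have hc : Continuous fun t => ∫ s in (0:ℝ)..t, g s := intervalIntegral.continuous_primitive (fun a b => hii a b) 0
  rw [integral_congr_ae (ae_of_all _ e2), integral_add (h.deriv.int_smul hc.locallyIntegrable) (h.deriv.int.smul_const _), integral_smul_const, h.deriv_int, zero_smul, add_zero, e1] at h1
  exact h1

lemma tst_prim {ψ : ℝ → ℝ} (h : Tst ψ) (h0 : ∫ t, ψ t = 0) : ∃ η, Tst η ∧ deriv η = ψ := by
  obtain ⟨R, hR, hz⟩ := h.bd
  have hc := h.c1.continuous
  let η : ℝ → ℝ := fun t => ∫ s in (-R)..t, ψ s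
  have hd : ∀ t, HasDerivAt η (ψ t) t := fun t =>
    intervalIntegral.integral_hasDerivAt_right (hc.intervalIntegrable _ _) (hc.stronglyMeasurableAtFilter _ _) hc.continuousAt
  have hde : deriv η = ψ := funext fun t => (hd t).deriv
  refine ⟨η, ⟨?_, ?_⟩, hde⟩
  · rw [contDiff_infty_iff_deriv]
    exact ⟨fun t => (hd t).differentiableAt, by rw [hde]; exact h.1⟩
  · refine HasCompactSupport.intro (isCompact_Icc (a := -R) (b := R)) fun t ht => ?_
    simp only [Set.mem_Icc, not_and_or, not_le] at ht
    simp only [η]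
    rcases ht with ht | ht
    · rw [intervalIntegral.integral_symm, intervalIntegral.integral_of_le ht.le]
      rw [setIntegral_congr_fun (g := fun _ => (0:ℝ)) measurableSet_Ioc]
      · simp
      · intro s hs; exact hz s (by rw [abs_of_neg (by linarith [hs.2])]; linarith [hs.2])
    · rw [intervalIntegral.integral_of_le (by linarith), ← h0, setIntegral_eq_integral_of_forall_compl_eq_zero]
      intro s hs
      simp only [Set.mem_Ioc, not_and_or, not_le, not_lt] at hs
      rcases hs with hs | hs
      · exact hz s (by rw [abs_of_nonpos (by linarith)]; linarith)
      · exact hz s (by rw [abs_of_pos (by linarith)]; linarith)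

lemma exists_rho : ∃ ρ : ℝ → ℝ, Tst ρ ∧ ∫ t, ρ t = 1 := by
  let f : ContDiffBump (0:ℝ) := ⟨1, 2, by norm_num, by norm_num⟩
  exact ⟨f.normed volume, ⟨f.contDiff_normed, f.hasCompactSupport_normed⟩, f.integral_normed⟩

lemma Tst.sub_smul {φ ρ : ℝ → ℝ} (h : Tst φ) (hr : Tst ρ) (c : ℝ) : Tst (fun t => φ t - c * ρ t) := by
  refine ⟨h.1.sub (contDiff_const.mul hr.1), ?_⟩
  exact h.2.sub (hr.2.mul_left)

lemma dbr1 {g : ℝ → E} (hg : LocallyIntegrable g) (h : ∀ η, Tst η → ∫ t, deriv η t • g t = 0) :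
    ∃ c : E, ∀ᵐ t, g t = c := by
  obtain ⟨ρ, hρ, h1⟩ := exists_rho
  refine ⟨∫ t, ρ t • g t, ?_⟩
  set c := ∫ t, ρ t • g t with hc
  have : ∀ᵐ t, g t - c = 0 := by
    refine ae_eq_zero_of_integral_contDiff_smul_eq_zero (hg.sub (locallyIntegrable_const c)) fun φ h2 h3 => ?_
    have hφ : Tst φ := ⟨h2, h3⟩
    obtain ⟨η, hη, he⟩ := tst_prim (hφ.sub_smul hρ (∫ t, φ t)) (by
      rw [integral_sub hφ.int (hρ.int.const_mul _), integral_const_mul, h1, mul_one, sub_self])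
    have h4 := h η hη
    rw [he] at h4
    simp only [sub_smul, mul_smul] at h4
    rw [integral_sub (hφ.int_smul hg) (show Integrable (fun t => (∫ t, φ t) • ρ t • g t) from (hρ.int_smul hg).smul _), integral_smul, ← hc, sub_eq_zero] at h4
    simp only [Pi.sub_apply, smul_sub]
    rw [integral_sub (hφ.int_smul hg) (hφ.int.smul_const c), h4, integral_smul_const, sub_self]
  filter_upwards [this] with t ht using sub_eq_zero.1 ht

lemma dbr2 {g : ℝ → E} (hg : LocallyIntegrable g) (h : ∀ η, Tst η → ∫ t, deriv (deriv η) t • g t = 0) :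
    ∃ c0 c1 : E, ∀ᵐ t : ℝ, g t = c0 + t • c1 := by
  obtain ⟨ρ, hρ, h1⟩ := exists_rho
  set c := ∫ t, deriv ρ t • g t with hc
  have hl : LocallyIntegrable (fun t : ℝ => t • c) := (by fun_prop : Continuous fun t : ℝ => t • c).locallyIntegrable
  have := dbr1 (g := fun t => g t + t • c) (hg.add hl) ?_
  · obtain ⟨c0, h0⟩ := this
    refine ⟨c0, -c, ?_⟩
    filter_upwards [h0] with t ht
    rw [← ht]; simp
  · intro φ hφ
    obtain ⟨η, hη, he⟩ := tst_prim (hφ.sub_smul hρ (∫ t, φ t)) (by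
      rw [integral_sub hφ.int (hρ.int.const_mul _), integral_const_mul, h1, mul_one, sub_self])
    have h4 := h η hη
    have hd : deriv (deriv η) = fun t => deriv φ t - (∫ t, φ t) * deriv ρ t := by
      rw [he]; ext t
      exact ((hφ.hd t).sub ((hρ.hd t).const_mul _)).deriv
    rw [hd] at h4
    simp only [sub_smul, mul_smul] at h4
    rw [integral_sub (hφ.deriv.int_smul hg) (show Integrable (fun t => (∫ t, φ t) • deriv ρ t • g t) from (hρ.deriv.int_smul hg).smul _), integral_smul, ← hc, sub_eq_zero] at h4
    simp only [smul_add]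
    rw [integral_add (hφ.deriv.int_smul hg) (hφ.deriv.int_smul hl), h4]
    have := ibp_loc hφ (locallyIntegrable_const c)
    simp only [intervalIntegral.integral_const, sub_zero] at this
    rw [this, integral_smul_const, add_neg_cancel]

lemma weak_reg {k μ a N : ℝ} (hk : 0 < k) (ha : μ = 2 - a) (T Z : E →L[ℝ] E) {Y : ℝ → E} (hY : Integrable Y)
    (H : ∀ η, Tst η → ∫ t : ℝ, (((k^2+t^2) * deriv (deriv η) t + a * t * deriv η t) • Y t
      + (2 * deriv η t) • T (Y t) - (N * η t) • Z (Y t)) = 0) :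
    ∃ y w : ℝ → E, (∀ᵐ t, Y t = y t) ∧
      (∀ t, HasDerivAt y ((k^2+t^2)⁻¹ • (w t + (2:ℝ) • T (y t) - (μ*t) • y t)) t) ∧
      (∀ t, HasDerivAt w (N • Z (y t)) t) := by
  have hq : ∀ t : ℝ, k^2+t^2 ≠ 0 := fun t => by positivity
  have cont : ∀ {f : ℝ → ℝ} {g : ℝ → E}, Continuous f → LocallyIntegrable g → LocallyIntegrable (fun t => f t • g t) := by
    intro f g hf hg
    have := LocallyIntegrable.locallyIntegrableOn hg Set.univ
    rw [← locallyIntegrableOn_univ]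
    exact this.continuousOn_smul (Or.inl isOpen_univ.isLocallyClosed |>.elim id id) hf.continuousOn
  have hYl := hY.locallyIntegrable
  have hTl : LocallyIntegrable (fun t => T (Y t)) := (T.integrable_comp hY).locallyIntegrable
  have hZl : LocallyIntegrable (fun t => Z (Y t)) := (Z.integrable_comp hY).locallyIntegrable
  set g0 : ℝ → E := fun t => (-N) • Z (Y t) with hg0
  have g0l : LocallyIntegrable g0 := cont continuous_const hZl
  set P0 : ℝ → E := fun t => ∫ s in (0:ℝ)..t, g0 s with hP0
  have ii : ∀ {g : ℝ → E}, LocallyIntegrable g → ∀ a b, IntervalIntegrable g volume a b :=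
    fun hg a b => (hg.integrableOn_isCompact isCompact_uIcc).intervalIntegrable
  have P0c : Continuous P0 := intervalIntegral.continuous_primitive (ii g0l) 0
  set h1 : ℝ → E := fun t => (a * t) • Y t + (2:ℝ) • T (Y t) - P0 t with hh1
  have l1 : LocallyIntegrable (fun t : ℝ => (a * t) • Y t) := cont (by fun_prop) hYl
  have l2 : LocallyIntegrable (fun t : ℝ => (2:ℝ) • T (Y t)) := cont (by fun_prop) hTl
  have h1l : LocallyIntegrable h1 := (l1.add l2).sub P0c.locallyIntegrable
  set P1 : ℝ → E := fun t => ∫ s in (0:ℝ)..t, h1 s with hP1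
  have P1c : Continuous P1 := intervalIntegral.continuous_primitive (ii h1l) 0
  have ql : LocallyIntegrable (fun t : ℝ => (k^2+t^2) • Y t) := cont (by fun_prop) hYl
  obtain ⟨c0, c1, hc⟩ := dbr2 (g := fun t => (k^2+t^2) • Y t - P1 t) (ql.sub P1c.locallyIntegrable) (by
    intro η hη
    have a0 := ibp_loc hη g0l
    have a1 := ibp_loc hη.deriv h1l
    rw [← H η hη]
    have i1 := hη.deriv.deriv.int_smul ql
    have i2 := hη.deriv.deriv.int_smul P1c.locallyIntegrable
    have i3 := hη.deriv.int_smul h1l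
    have i4 := hη.deriv.int_smul P0c.locallyIntegrable
    have i5 := hη.int_smul g0l
    have i13 : Integrable (fun t => (deriv (deriv η) t • (k^2+t^2) • Y t) + (deriv η t • h1 t)) := i1.add i3
    have i134 : Integrable (fun t => (deriv (deriv η) t • (k^2+t^2) • Y t) + (deriv η t • h1 t) + (deriv η t • P0 t)) := i13.add i4
    have e : ∀ t : ℝ, (((k^2+t^2) * deriv (deriv η) t + a * t * deriv η t) • Y t
      + (2 * deriv η t) • T (Y t) - (N * η t) • Z (Y t)) = (deriv (deriv η) t • (k^2+t^2) • Y t)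
        + (deriv η t • h1 t) + (deriv η t • P0 t) + (η t • g0 t) := by
      intro t; simp only [hh1, hg0]; module
    rw [integral_congr_ae (ae_of_all _ e), integral_add i134 i5, integral_add i13 i4, integral_add i1 i3]
    rw [eq_neg_iff_add_eq_zero] at a0 a1
    have a1' : ∫ t, deriv η t • h1 t = - ∫ t, deriv (deriv η) t • P1 t := eq_neg_of_add_eq_zero_right a1
    rw [add_assoc, a0, a1', add_zero, ← sub_eq_add_neg]
    simp only [smul_sub]
    rw [integral_sub i1 i2])
  let y : ℝ → E := fun t => (k^2+t^2)⁻¹ • (P1 t + (c0 + t • c1))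
  have hYy : ∀ᵐ t, Y t = y t := by
    filter_upwards [hc] with t ht
    simp only [y]
    rw [← ht, add_sub_cancel, inv_smul_smul₀ (hq t)]
  have yc : Continuous y := Continuous.smul (Continuous.inv₀ (by fun_prop) hq) (by fun_prop)
  have dP0 : ∀ t, HasDerivAt P0 ((-N) • Z (y t)) t := by
    intro t
    have : P0 = fun t => ∫ s in (0:ℝ)..t, (-N) • Z (y s) := by
      ext t; refine intervalIntegral.integral_congr_ae ?_
      filter_upwards [hYy] with s hs _
      simp only [hg0, hs]
    rw [this]
    have hc' : Continuous fun s => (-N) • Z (y s) := by fun_prop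
    exact intervalIntegral.integral_hasDerivAt_right (hc'.intervalIntegrable _ _) (hc'.stronglyMeasurableAtFilter _ _) hc'.continuousAt
  have dP1 : ∀ t, HasDerivAt P1 ((a * t) • y t + (2:ℝ) • T (y t) - P0 t) t := by
    intro t
    have : P1 = fun t => ∫ s in (0:ℝ)..t, ((a * s) • y s + (2:ℝ) • T (y s) - P0 s) := by
      ext t; refine intervalIntegral.integral_congr_ae ?_
      filter_upwards [hYy] with s hs _
      simp only [hh1, hs]
    rw [this]
    have hc' : Continuous fun s => ((a * s) • y s + (2:ℝ) • T (y s) - P0 s) := by fun_prop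
    exact intervalIntegral.integral_hasDerivAt_right (hc'.intervalIntegrable _ _) (hc'.stronglyMeasurableAtFilter _ _) hc'.continuousAt
  refine ⟨y, fun t => c1 - P0 t, hYy, fun t => ?_, fun t => ?_⟩
  · have hqd : HasDerivAt (fun t => k^2+t^2) (2*t) t := by
      have := ((hasDerivAt_id t).pow 2).const_add (k^2)
      refine this.congr_deriv ?_; simp
    have h2 := (hqd.inv (hq t)).smul ((dP1 t).add (((hasDerivAt_id t).smul_const c1).const_add c0))
    refine h2.congr_deriv ?_
    have e : P1 t + (c0 + t • c1) = (k^2+t^2) • y t := by simp only [y]; rw [smul_inv_smul₀ (hq t)]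
    simp only [Pi.add_apply, id, one_smul]
    rw [e, ha]
    generalize y t = yt
    rw [smul_smul (-(2*t)/(k^2+t^2)^2)]
    have : -(2 * t) / (k ^ 2 + t ^ 2) ^ 2 * (k ^ 2 + t ^ 2) = -(2*t) * (k^2+t^2)⁻¹ := by
      have := hq t; field_simp
    simp only [Pi.inv_apply]
    rw [this]
    module
  · refine ((dP0 t).const_sub c1).congr_deriv ?_
    module

end weak
end

section
variable {n m : ℕ}
section four
open scoped SchwartzMap FourierTransform LineDeriv

abbrev SL (n : ℕ) := SchwartzMap (Rn n) (Lam n)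

/-- scaling by (2π)⁻¹ -/
def scl (n : ℕ) : Rn n ≃L[ℝ] Rn n :=
  ContinuousLinearEquiv.smulLeft (R₁ := ℝ) (Units.mk0 ((2*Real.pi)⁻¹) (by positivity))

lemma scl_apply (x : Rn n) : scl n x = (2*Real.pi)⁻¹ • x := rfl

/-- unnormalized Fourier transform -/
def FS (ψ : SL n) : SL n := SchwartzMap.compCLMOfContinuousLinearEquiv ℂ (scl n) (𝓕 ψ)

lemma FS_smul (c : ℂ) (ψ : SL n) : FS (c • ψ) = c • FS ψ := by
  simp only [FS, FourierTransform.fourier_smul, map_smul]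
lemma FS_rsmul (c : ℝ) (ψ : SL n) : FS (c • ψ) = c • FS ψ := by
  have : c • ψ = (c:ℂ) • ψ := by ext1 x; simp
  rw [this, FS_smul]; ext1 x; simp
lemma FS_add (φ ψ : SL n) : FS (φ + ψ) = FS φ + FS ψ := by
  simp only [FS, FourierTransform.fourier_add, map_add]
lemma FS_neg (ψ : SL n) : FS (-ψ) = -FS ψ := by
  have := FS_smul (-1) ψ; simpa using this
lemma FS_sub (φ ψ : SL n) : FS (φ - ψ) = FS φ - FS ψ := by
  rw [sub_eq_add_neg, FS_add, FS_neg, sub_eq_add_neg]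
lemma FS_sum {ι : Type*} (s : Finset ι) (f : ι → SL n) : FS (∑ i ∈ s, f i) = ∑ i ∈ s, FS (f i) := by
  simp only [FS]
  rw [← map_sum]; congr 1
  exact map_sum (FourierTransform.fourierCLE ℂ (SL n)) f s

lemma inner_eq_sum (x y : Rn n) : inner ℝ x y = ∑ j, x j * y j := by
  simp [PiLp.inner_apply, mul_comm]

lemma FS_apply' (ψ : SL n) (x : Rn n) : FS ψ x = (𝓕 ψ : SL n) ((2*Real.pi)⁻¹ • x) := rfl

lemma FS_apply (ψ : SL n) (x : Rn n) :
    FS ψ x = ∫ y, Complex.exp (-(((∑ j, y j * x j : ℝ) : ℂ) * Complex.I)) • ψ y := by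
  rw [FS_apply', SchwartzMap.fourier_coe, Real.fourier_eq']
  congr 1; ext1 y
  congr 2
  rw [inner_smul_right, inner_eq_sum]
  have : -2 * Real.pi * ((2 * Real.pi)⁻¹ * ∑ j, y j * x j) = -∑ j, y j * x j := by
    field_simp
  rw [this]; push_cast; ring

lemma ft_eq_FS (ψ : SL n) (x : Rn n) : ft (fun y => ψ y) x = ((2 * Real.pi) ^ (-(n:ℝ)/2) : ℝ) • FS ψ x := by
  rw [FS_apply]; rfl

lemma ftInv_FS (ψ : SL n) (ξ : Rn n) : ftInv (fun y => FS ψ y) ξ = ((2 * Real.pi) ^ ((n:ℝ)/2) : ℝ) • ψ ξ := by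
  have h2 : (0:ℝ) < 2*Real.pi := by positivity
  have h1 : (𝓕⁻ (𝓕 ψ : SL n) : SL n) ξ = ψ ξ := by rw [FourierTransform.fourierInv_fourier_eq]
  rw [SchwartzMap.fourierInv_coe, Real.fourierInv_eq'] at h1
  unfold ftInv
  have h3 := Measure.integral_comp_smul (μ := (volume : Measure (Rn n))) (fun v : Rn n => Complex.exp ((↑(2 * Real.pi * inner ℝ v ξ) * Complex.I)) • (𝓕 ψ : SL n) v) ((2*Real.pi)⁻¹)
  rw [h1] at h3
  have h4 : ∀ x : Rn n, Complex.exp ((((∑ j, x j * ξ j : ℝ) : ℂ) * Complex.I)) • FS ψ x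
     = Complex.exp ((↑(2 * Real.pi * inner ℝ ((2*Real.pi)⁻¹ • x) ξ) * Complex.I)) • (𝓕 ψ : SL n) ((2*Real.pi)⁻¹ • x) := by
    intro x
    rw [FS_apply', real_inner_smul_left, inner_eq_sum, mul_inv_cancel_left₀ h2.ne']
  rw [integral_congr_ae (ae_of_all _ h4), h3, smul_smul]
  congr 1
  have h5 : |((2*Real.pi)⁻¹ ^ Module.finrank ℝ (Rn n))⁻¹| = (2*Real.pi)^(n:ℝ) := by
    rw [finrank_euclideanSpace_fin, inv_pow, inv_inv, abs_of_pos (by positivity), Real.rpow_natCast]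
  rw [h5, ← Real.rpow_add h2]; congr 1; ring

lemma coord_tg (j : Fin n) : (fun x : Rn n => x j).HasTemperateGrowth :=
  (EuclideanSpace.proj (𝕜 := ℝ) j : Rn n →L[ℝ] ℝ).hasTemperateGrowth

/-- multiplication by a coordinate -/
def MX (j : Fin n) (ψ : SL n) : SL n := SchwartzMap.smulLeftCLM (Lam n) (fun x : Rn n => x j) ψ
/-- partial derivative -/
def DX (j : Fin n) (ψ : SL n) : SL n := ∂_{(EuclideanSpace.single j (1:ℝ) : Rn n)} ψ

lemma MX_apply (j : Fin n) (ψ : SL n) (x : Rn n) : MX j ψ x = x j • ψ x := by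
  rw [MX, SchwartzMap.smulLeftCLM_apply_apply (coord_tg j)]
lemma DX_apply (j : Fin n) (ψ : SL n) (x : Rn n) : DX j ψ x = pd j (fun y => ψ y) x := rfl

lemma inner_single (j : Fin n) : (fun x : Rn n => inner ℝ x (EuclideanSpace.single j (1:ℝ))) = fun x => x j := by
  ext x; simp [inner_eq_sum, Pi.single_apply]

lemma pd_FS (j : Fin n) (ψ : SL n) (x : Rn n) : pd j (fun y => FS ψ y) x = FS (-I • MX j ψ) x := by
  have h1 := SchwartzMap.lineDerivOp_compCLMOfContinuousLinearEquiv (𝕜 := ℂ) (EuclideanSpace.single j (1:ℝ)) (scl n) (𝓕 ψ : SL n)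
  have h2 : pd j (fun y => FS ψ y) x = (∂_{(EuclideanSpace.single j (1:ℝ) : Rn n)} (FS ψ)) x := rfl
  rw [h2, FS, h1, scl_apply, LineDeriv.lineDerivOp_left_smul, SchwartzMap.lineDerivOp_fourier_eq, inner_single]
  have h3 : SchwartzMap.smulLeftCLM (Lam n) (fun x : Rn n => x j) ψ = MX j ψ := rfl
  rw [h3, FourierTransform.fourier_smul, FS_smul]
  rw [SchwartzMap.smul_apply]
  show (2*Real.pi)⁻¹ • -(2 * (Real.pi:ℂ) * I) • FS (MX j ψ) x = _
  rw [← Complex.coe_smul (2*Real.pi)⁻¹, smul_smul]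
  congr 1
  push_cast; field_simp

lemma mul_FS (j : Fin n) (ψ : SL n) (x : Rn n) : x j • FS ψ x = FS (-I • DX j ψ) x := by
  have h1 := SchwartzMap.fourier_lineDerivOp_eq ψ (EuclideanSpace.single j (1:ℝ))
  have h3 : FS (-I • DX j ψ) x = -I • (𝓕 (DX j ψ) : SL n) ((2*Real.pi)⁻¹ • x) := by
    rw [FS_apply', FourierTransform.fourier_smul]; rfl
  rw [h3, DX, h1, inner_single, FS_apply', SchwartzMap.smul_apply, SchwartzMap.smulLeftCLM_apply_apply (coord_tg j)]
  rw [← Complex.coe_smul (((2*Real.pi)⁻¹ • x) j), ← Complex.coe_smul (x j), smul_smul, smul_smul]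
  congr 1
  rw [PiLp.smul_apply, smul_eq_mul]
  push_cast; field_simp; ring_nf; simp

lemma clm_FS (L : Lam n →L[ℂ] Lam n) (ψ : SL n) (x : Rn n) :
    L (FS ψ x) = FS (SchwartzMap.postcompCLM L ψ) x := by
  rw [FS_apply, FS_apply, ← ContinuousLinearMap.integral_comp_comm]
  · congr 1; ext1 y; rw [map_smul]; rfl
  · have := ψ.integrable (μ := (volume : Measure (Rn n)))
    refine this.norm.mono' ?_ (ae_of_all _ fun y => ?_)
    · have hc : Continuous fun y : Rn n => Complex.exp (-(((∑ j, y j * x j : ℝ) : ℂ) * Complex.I)) := by fun_prop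
      exact hc.aestronglyMeasurable.smul this.1
    · rw [norm_smul, show -(((∑ j, y j * x j : ℝ):ℂ) * I) = ((-∑ j, y j * x j : ℝ):ℂ) * I by push_cast; ring,
        Complex.norm_exp_ofReal_mul_I, one_mul]

/-- the Fourier side of the transpose operator -/
def DH (a : ℝ) (p : ℕ) (ℓ : Fin n) (ψ : SL n) : SL n :=
  (∑ j, MX j (MX j (DX ℓ (DX ℓ ψ)))) + a • MX ℓ (DX ℓ ψ)
  + (2:ℝ) • (∑ j ∈ univ.erase ℓ, SchwartzMap.postcompCLM ((iotL (ee j)).comp (epsL (ee ℓ)) + (epsL (ee j)).comp (iotL (ee ℓ))) (DX ℓ (MX j ψ)))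
  - ((n:ℝ) - 2*p) • SchwartzMap.postcompCLM ((epsL (ee ℓ)).comp (iotL (ee ℓ))) ψ

lemma DapT_FS (a : ℝ) (p : ℕ) (ℓ : Fin n) (ψ : SL n) (x : Rn n) :
    DapT a p ℓ (fun y => FS ψ y) x = FS (DH a p ℓ ψ) x := by
  have e1 : (fun y : Rn n => y ℓ • FS ψ y) = fun y => FS (-I • DX ℓ ψ) y := funext fun y => mul_FS ℓ ψ y
  have e2 : (fun y : Rn n => (y ℓ)^2 • FS ψ y) = fun y => FS (-DX ℓ (DX ℓ ψ)) y := by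
    ext1 y
    rw [sq, mul_smul, mul_FS, mul_FS]
    congr 2
    have : DX ℓ (-I • DX ℓ ψ) = -I • DX ℓ (DX ℓ ψ) := LineDeriv.lineDerivOp_smul _ _ _
    rw [this, smul_smul]; simp
  have e3 : ∀ j (φ : SL n) (y : Rn n), pd j (pd j (fun y => FS φ y)) y = FS (- MX j (MX j φ)) y := by
    intro j φ y
    rw [show pd j (fun y => FS φ y) = fun y => FS (-I • MX j φ) y from funext fun y => pd_FS j φ y, pd_FS]
    congr 2
    have : MX j (-I • MX j φ) = -I • MX j (MX j φ) := by
      ext1 z; simp only [MX_apply, SchwartzMap.smul_apply]; rw [smul_comm]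
    rw [this, smul_smul]; simp
  unfold DapT
  rw [e1, e2]
  simp only [e3]
  have e4 : ∀ j, MX j (-DX ℓ (DX ℓ ψ)) = - MX j (DX ℓ (DX ℓ ψ)) := by
    intro j; ext1 z; simp [MX_apply]
  have e4' : ∀ j (φ : SL n), MX j (- φ) = - MX j φ := by
    intro j φ; ext1 z; simp [MX_apply]
  have e5 : pd ℓ (fun y => FS (-I • DX ℓ ψ) y) x = - FS (MX ℓ (DX ℓ ψ)) x := by
    rw [pd_FS, ← SchwartzMap.neg_apply, ← FS_neg]
    congr 2
    have : MX ℓ (-I • DX ℓ ψ) = -I • MX ℓ (DX ℓ ψ) := by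
      ext1 z; simp only [MX_apply, SchwartzMap.smul_apply]; rw [smul_comm]
    rw [this, smul_smul]; simp
  have e6 : ∀ j, x ℓ • (iot (ee j) (eps (ee ℓ) (pd j (fun y => FS ψ y) x)) + eps (ee j) (iot (ee ℓ) (pd j (fun y => FS ψ y) x)))
     = - FS (SchwartzMap.postcompCLM ((iotL (ee j)).comp (epsL (ee ℓ)) + (epsL (ee j)).comp (iotL (ee ℓ))) (DX ℓ (MX j ψ))) x := by
    intro j
    have : iot (ee j) (eps (ee ℓ) (pd j (fun y => FS ψ y) x)) + eps (ee j) (iot (ee ℓ) (pd j (fun y => FS ψ y) x))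
      = ((iotL (ee j)).comp (epsL (ee ℓ)) + (epsL (ee j)).comp (iotL (ee ℓ))) (pd j (fun y => FS ψ y) x) := rfl
    rw [this, ← clm_rsmul, pd_FS, mul_FS, clm_FS, ← SchwartzMap.neg_apply, ← FS_neg]
    congr 2
    have : DX ℓ (-I • MX j ψ) = -I • DX ℓ (MX j ψ) := LineDeriv.lineDerivOp_smul _ _ _
    rw [this, smul_smul, map_smul]; simp
  have e7 : eps (ee ℓ) (iot (ee ℓ) (FS ψ x)) = FS (SchwartzMap.postcompCLM ((epsL (ee ℓ)).comp (iotL (ee ℓ))) ψ) x := by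
    rw [← clm_FS]; rfl
  rw [e5, e7]
  simp only [e4, e4', neg_neg]
  rw [mul_smul, Finset.smul_sum, Finset.sum_congr rfl fun j _ => e6 j]
  simp only [DH, FS_sub, FS_add, FS_rsmul, FS_sum, SchwartzMap.add_apply, SchwartzMap.sub_apply, SchwartzMap.smul_apply, SchwartzMap.sum_apply]
  rw [Finset.sum_neg_distrib]
  module

lemma weak_FS {a : ℝ} {p : ℕ} {ℓ : Fin n} {g : Rn n → Lam n} (h : WeakEig a p ℓ g 0) (ψ : SL n) :
    ∫ ξ, blin (g ξ) (DH a p ℓ ψ ξ) = 0 := by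
  have h1 := h (FS ψ)
  unfold dpair at h1
  have e : (fun x => DapT a p ℓ (fun y => FS ψ y) x - (0:ℂ) • FS ψ x) = fun x => FS (DH a p ℓ ψ) x := by
    ext1 x; rw [zero_smul, sub_zero, DapT_FS]
  rw [e] at h1
  simp only [ftInv_FS] at h1
  have e2 : ∀ ξ, blin (g ξ) (((2 * Real.pi) ^ ((n:ℝ)/2) : ℝ) • DH a p ℓ ψ ξ) = (((2 * Real.pi) ^ ((n:ℝ)/2) : ℝ):ℂ) * blin (g ξ) (DH a p ℓ ψ ξ) := by
    intro ξ
    simp only [blin, Finset.mul_sum]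
    refine Finset.sum_congr rfl fun S _ => ?_
    rw [← Complex.coe_smul, PiLp.smul_apply, smul_eq_mul]; ring
  simp only [e2] at h1
  rw [integral_const_mul] at h1
  have h2 : ((((2 * Real.pi) ^ ((n:ℝ)/2) : ℝ)):ℂ) ≠ 0 := by
    norm_cast; positivity
  exact (mul_eq_zero.1 h1).resolve_left h2
end four
end

section
variable {n m : ℕ}

/-- test functions supported in [-R,R] -/
def TstR (R : ℕ) : Type := {η : ℝ → ℝ // Tst η ∧ ∀ t, (R:ℝ) ≤ |t| → η t = 0}

/-- the two-jet as a continuous map -/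
def jetR (R : ℕ) (η : TstR R) : C(Set.Icc (-(R:ℝ)) R, ℝ × ℝ × ℝ) :=
  ⟨fun t => (η.1 t, deriv η.1 t, deriv (deriv η.1) t), by
    have h1 := η.2.1.c1.continuous
    have h2 := η.2.1.deriv.c1.continuous
    have h3 := η.2.1.deriv.deriv.c1.continuous
    fun_prop⟩

lemma TstR_deriv0 {R : ℝ} {η : ℝ → ℝ} (h : ∀ t, R ≤ |t| → η t = 0) (t : ℝ) (ht : R < |t|) :
    deriv η t = 0 ∧ deriv (deriv η) t = 0 := by
  have ho : IsOpen {s : ℝ | R < |s|} := isOpen_lt continuous_const continuous_abs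
  have h1 : η =ᶠ[nhds t] fun _ => 0 := by
    filter_upwards [ho.mem_nhds ht] with s hs using h s hs.le
  have h2 := h1.deriv
  have h3 := h2.deriv
  exact ⟨by simpa using h1.deriv_eq, by simpa using h2.deriv_eq⟩

lemma dense_tst : ∃ D : Set (ℝ → ℝ), D.Countable ∧ (∀ d ∈ D, Tst d) ∧ ∀ η, Tst η → ∃ R : ℝ, 0 < R ∧
    ∀ ε > 0, ∃ d ∈ D, ∀ t, (|t| ≤ R → |η t - d t| ≤ ε ∧ |deriv η t - deriv d t| ≤ ε ∧
      |deriv (deriv η) t - deriv (deriv d) t| ≤ ε) ∧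
      (R < |t| → η t = d t ∧ deriv η t = deriv d t ∧ deriv (deriv η) t = deriv (deriv d) t) := by
  have key : ∀ R : ℕ, ∃ D : Set (TstR R), D.Countable ∧ ∀ η : TstR R, ∀ ε > 0, ∃ d ∈ D, dist (jetR R η) (jetR R d) < ε := by
    intro R
    letI : TopologicalSpace (TstR R) := TopologicalSpace.induced (jetR R) inferInstance
    haveI : SecondCountableTopology (TstR R) := TopologicalSpace.secondCountableTopology_induced _ _ (jetR R)
    obtain ⟨D, hD, hd⟩ := TopologicalSpace.exists_countable_dense (TstR R)
    refine ⟨D, hD, fun η ε hε => ?_⟩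
    have hc : Continuous (jetR R) := continuous_induced_dom
    have ho : IsOpen (jetR R ⁻¹' Metric.ball (jetR R η) ε) := Metric.isOpen_ball.preimage hc
    obtain ⟨d, hd1, hd2⟩ := hd.exists_mem_open ho ⟨η, by simp [hε]⟩
    refine ⟨d, hd1, ?_⟩
    rw [dist_comm]; exact hd2
  choose D hD hd using key
  refine ⟨⋃ R, Subtype.val '' D R, Set.countable_iUnion fun R => (hD R).image _, ?_, ?_⟩
  · intro d hd
    simp only [Set.mem_iUnion, Set.mem_image] at hd
    obtain ⟨R, x, -, rfl⟩ := hd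
    exact x.2.1
  · intro η hη
    obtain ⟨R0, hR0, h0⟩ := hη.bd
    obtain ⟨R, hR⟩ := exists_nat_gt R0
    have hRp : (0:ℝ) < R := hR0.trans hR
    refine ⟨R, hRp, fun ε hε => ?_⟩
    have hηR : ∀ t, (R:ℝ) ≤ |t| → η t = 0 := fun t ht => h0 t (hR.le.trans ht)
    obtain ⟨d, hdD, hdist⟩ := hd R ⟨η, hη, hηR⟩ ε hε
    refine ⟨d.1, Set.mem_iUnion.2 ⟨R, d, hdD, rfl⟩, fun t => ⟨fun ht => ?_, fun ht => ?_⟩⟩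
    · have hm : t ∈ Set.Icc (-(R:ℝ)) R := abs_le.1 ht
      have := (ContinuousMap.dist_le hε.le).1 hdist.le ⟨t, hm⟩
      simp only [jetR, ContinuousMap.coe_mk, Prod.dist_eq, Real.dist_eq, max_le_iff] at this
      exact this
    · have h1 := TstR_deriv0 hηR t ht
      have h2 := TstR_deriv0 d.2.2 t ht
      rw [h1.1, h1.2, h2.1, h2.2, hηR t ht.le, d.2.2 t ht.le]
      exact ⟨rfl, rfl, rfl⟩

section
variable {E : Type*} [NormedAddCommGroup E] [NormedSpace ℝ E] [CompleteSpace E]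
/-- the weak integrand -/
def Vd (k a N : ℝ) (T Z : E →L[ℝ] E) (Y : ℝ → E) (η : ℝ → ℝ) (t : ℝ) : E :=
  ((k^2+t^2) * deriv (deriv η) t + a * t * deriv η t) • Y t
      + (2 * deriv η t) • T (Y t) - (N * η t) • Z (Y t)

lemma bdd_smul_int {f : ℝ → ℝ} (hf : Continuous f) (hc : HasCompactSupport f) {Y : ℝ → E} (hY : Integrable Y) :
    Integrable (fun t => f t • Y t) :=
  hY.locallyIntegrable.integrable_smul_left_of_hasCompactSupport hf hc

lemma Vd_int (k a N : ℝ) (T Z : E →L[ℝ] E) {Y : ℝ → E} (hY : Integrable Y) {η : ℝ → ℝ} (h : Tst η) :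
    Integrable (Vd k a N T Z Y η) := by
  have c0 := h.c1.continuous
  have c1 := h.deriv.c1.continuous
  have c2 := h.deriv.deriv.c1.continuous
  have hT := T.integrable_comp hY
  have hZ := Z.integrable_comp hY
  have i1 : Integrable (fun t => ((k^2+t^2) * deriv (deriv η) t + a * t * deriv η t) • Y t) :=
    bdd_smul_int (by fun_prop) ((h.deriv.deriv.2.mul_left).add (h.deriv.2.mul_left)) hY
  have i2 : Integrable (fun t => (2 * deriv η t) • T (Y t)) := bdd_smul_int (by fun_prop) h.deriv.2.mul_left hT
  have i3 : Integrable (fun t => (N * η t) • Z (Y t)) := bdd_smul_int (by fun_prop) h.2.mul_left hZ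
  exact (i1.add i2).sub i3

lemma Vd_ext (k a N : ℝ) (T Z : E →L[ℝ] E) {Y : ℝ → E} (hY : Integrable Y) {D : Set (ℝ → ℝ)} (hD : ∀ d ∈ D, Tst d)
    (hV : ∀ d ∈ D, ∫ t, Vd k a N T Z Y d t = 0) {η : ℝ → ℝ} (h : Tst η) {R : ℝ} (hR : 0 < R)
    (happ : ∀ ε > 0, ∃ d ∈ D, ∀ t, (|t| ≤ R → |η t - d t| ≤ ε ∧ |deriv η t - deriv d t| ≤ ε ∧
      |deriv (deriv η) t - deriv (deriv d) t| ≤ ε) ∧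
      (R < |t| → η t = d t ∧ deriv η t = deriv d t ∧ deriv (deriv η) t = deriv (deriv d) t)) :
    ∫ t, Vd k a N T Z Y η t = 0 := by
  set C := (k^2+R^2) + |a| * R + 2 * ‖T‖ + |N| * ‖Z‖ with hC
  have hC0 : 0 ≤ C := by positivity
  have key : ∀ ε > 0, ‖∫ t, Vd k a N T Z Y η t‖ ≤ ε * (C * ∫ t, ‖Y t‖) := by
    intro ε hε
    obtain ⟨d, hd, hb⟩ := happ ε hε
    have e : ∫ t, Vd k a N T Z Y η t = ∫ t, (Vd k a N T Z Y η t - Vd k a N T Z Y d t) := by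
      rw [integral_sub (Vd_int k a N T Z hY h) (Vd_int k a N T Z hY (hD d hd)), hV d hd, sub_zero]
    rw [e, ← mul_assoc, ← integral_const_mul]
    refine norm_integral_le_of_norm_le (hY.norm.const_mul _) (ae_of_all _ fun t => ?_)
    have e2 : Vd k a N T Z Y η t - Vd k a N T Z Y d t =
       ((k^2+t^2) * (deriv (deriv η) t - deriv (deriv d) t) + a * t * (deriv η t - deriv d t)) • Y t
      + (2 * (deriv η t - deriv d t)) • T (Y t) - (N * (η t - d t)) • Z (Y t) := by
      unfold Vd; module
    rw [e2]
    rcases le_or_gt |t| R with ht | ht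
    · obtain ⟨b0, b1, b2⟩ := (hb t).1 ht
      have ht2 : t^2 ≤ R^2 := by rw [← sq_abs]; gcongr
      have n1 : ‖((k^2+t^2) * (deriv (deriv η) t - deriv (deriv d) t) + a * t * (deriv η t - deriv d t)) • Y t‖ ≤ ((k^2+R^2)*ε + |a| * R*ε)*‖Y t‖ := by
        rw [norm_smul]; gcongr
        refine (norm_add_le _ _).trans ?_
        rw [norm_mul, norm_mul, norm_mul, Real.norm_eq_abs, Real.norm_eq_abs, Real.norm_eq_abs, Real.norm_eq_abs, Real.norm_eq_abs,
          abs_of_nonneg (by positivity : 0 ≤ k^2+t^2)]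
        gcongr
      have n2 : ‖(2 * (deriv η t - deriv d t)) • T (Y t)‖ ≤ (2*ε)*(‖T‖*‖Y t‖) := by
        rw [norm_smul, norm_mul, Real.norm_eq_abs, Real.norm_eq_abs, abs_two]
        gcongr; exact T.le_opNorm _
      have n3 : ‖(N * (η t - d t)) • Z (Y t)‖ ≤ (|N| * ε)*(‖Z‖*‖Y t‖) := by
        rw [norm_smul, norm_mul, Real.norm_eq_abs, Real.norm_eq_abs]
        gcongr; exact Z.le_opNorm _
      refine ((norm_sub_le _ _).trans (add_le_add_left (norm_add_le _ _) _)).trans ?_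
      calc _ ≤ ((k^2+R^2)*ε + |a| * R*ε)*‖Y t‖ + (2*ε)*(‖T‖*‖Y t‖) + (|N| * ε)*(‖Z‖*‖Y t‖) := by gcongr
        _ = _ := by rw [hC]; ring
    · obtain ⟨b0, b1, b2⟩ := (hb t).2 ht
      rw [b0, b1, b2]; simp; positivity
  by_contra hne
  have hp : 0 < ‖∫ t, Vd k a N T Z Y η t‖ := norm_pos_iff.2 hne
  set A := C * ∫ t, ‖Y t‖ with hA
  have hA0 : 0 ≤ A := mul_nonneg hC0 (integral_nonneg fun t => norm_nonneg _)
  have := key (‖∫ t, Vd k a N T Z Y η t‖/(2*(A+1))) (by positivity)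
  have h2 : ‖∫ t, Vd k a N T Z Y η t‖/(2*(A+1)) * A < ‖∫ t, Vd k a N T Z Y η t‖ := by
    rw [div_mul_eq_mul_div, div_lt_iff₀ (by positivity)]
    nlinarith
  linarith
end
end

section
variable {n m : ℕ}

lemma blin_add_r (v w w' : Lam n) : blin v (w + w') = blin v w + blin v w' := by
  simp [blin, mul_add, Finset.sum_add_distrib]
lemma blin_sub_r (v w w' : Lam n) : blin v (w - w') = blin v w - blin v w' := by
  simp [blin, mul_sub, Finset.sum_sub_distrib]
lemma blin_smul_r (c : ℂ) (v w : Lam n) : blin v (c • w) = c * blin v w := by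
  simp only [blin, Finset.mul_sum, PiLp.smul_apply, smul_eq_mul]
  exact Finset.sum_congr rfl fun _ _ => by ring
lemma blin_rsmul_r (c : ℝ) (v w : Lam n) : blin v (c • w) = c * blin v w := by
  rw [← Complex.coe_smul, blin_smul_r]
lemma blin_sum_r {ι : Type*} (s : Finset ι) (v : Lam n) (f : ι → Lam n) : blin v (∑ i ∈ s, f i) = ∑ i ∈ s, blin v (f i) := by
  classical
  induction s using Finset.induction_on with
  | empty => simp [blin]
  | insert a s ha ih => rw [Finset.sum_insert ha, Finset.sum_insert ha, blin_add_r, ih]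

lemma TT_sum (x : Rn m) (v : Lam (m+1)) :
    TT x v = ∑ i : Fin m, x i • (iot (el m) (eps (ee i.castSucc) v) + eps (el m) (iot (ee i.castSucc) v)) := by
  by_cases hx : x = 0
  · subst hx; simp [TT]
  have hk : ‖x‖ ≠ 0 := norm_ne_zero_iff.2 hx
  have e1 : (‖x‖:ℂ) • eps (rc (om x)) v = ∑ i : Fin m, x i • eps (ee i.castSucc) v := by
    rw [eps_eq_sum, Finset.smul_sum, Fin.sum_univ_castSucc]
    simp only [rc, om_castSucc, om_last]
    simp only [Complex.ofReal_zero, zero_smul, smul_zero, add_zero]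
    refine Finset.sum_congr rfl fun i _ => ?_
    rw [smul_smul, ← Complex.coe_smul (x i)]
    congr 1; push_cast; field_simp
    exact mul_div_cancel_left₀ _ (by exact_mod_cast hk)
  have e2 : (‖x‖:ℂ) • iot (rc (om x)) v = ∑ i : Fin m, x i • iot (ee i.castSucc) v := by
    rw [iot_eq_sum, Finset.smul_sum, Fin.sum_univ_castSucc]
    simp only [rc, om_castSucc, om_last]
    simp only [Complex.ofReal_zero, zero_smul, smul_zero, add_zero]
    refine Finset.sum_congr rfl fun i _ => ?_
    rw [smul_smul, ← Complex.coe_smul (x i)]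
    congr 1; push_cast; field_simp
    exact mul_div_cancel_left₀ _ (by exact_mod_cast hk)
  have : TT x v = iotL (el m) ((‖x‖:ℂ) • eps (rc (om x)) v) + epsL (el m) ((‖x‖:ℂ) • iot (rc (om x)) v) := by
    rw [map_smul, map_smul, ← smul_add]; rfl
  rw [this, e1, e2, map_sum, map_sum, ← Finset.sum_add_distrib]
  refine Finset.sum_congr rfl fun i _ => ?_
  rw [clm_rsmul, clm_rsmul, smul_add]; rfl

/-- the first m coordinates -/
def rs : Rn (m+1) →L[ℝ] Rn m := LinearMap.toContinuousLinearMap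
  { toFun := fun z => WithLp.toLp 2 (fun i => z i.castSucc)
    map_add' := fun _ _ => rfl
    map_smul' := fun _ _ => rfl }
lemma rs_apply (z : Rn (m+1)) (i : Fin m) : rs z i = z i.castSucc := rfl
lemma rs_ap (x : Rn m) (t : ℝ) : rs (ap x t) = x := by ext i; rw [rs_apply, ap_castSucc]
lemma ap_rs (z : Rn (m+1)) : ap (rs z) (z (Fin.last m)) = z := by
  ext j; refine Fin.lastCases ?_ (fun i => ?_) j
  · rw [ap_last]
  · rw [ap_castSucc, rs_apply]
lemma cont_ap : Continuous (fun z : Rn m × ℝ => ap z.1 z.2) := by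
  refine (PiLp.continuous_toLp 2 _).comp (continuous_pi fun j => ?_)
  refine Fin.lastCases ?_ (fun i => ?_) j
  · simp; fun_prop
  · simp; fun_prop

/-- test functions on Rn -/
def TsM (χ : Rn m → ℝ) : Prop := ContDiff ℝ ((⊤ : ℕ∞) : WithTop ℕ∞) χ ∧ HasCompactSupport χ

lemma TsM.mulx {χ : Rn m → ℝ} (h : TsM χ) (i : Fin m) : TsM (fun x => x i * χ x) := by
  refine ⟨?_, h.2.mul_left⟩
  have := h.1
  have h2 : ContDiff ℝ ((⊤ : ℕ∞) : WithTop ℕ∞) (fun x : Rn m => x i) := (EuclideanSpace.proj (𝕜 := ℝ) i).contDiff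
  exact h2.mul this

/-- tensor test function -/
def tenF (χ : Rn m → ℝ) (η : ℝ → ℝ) (S : Finset (Fin (m+1))) (z : Rn (m+1)) : Lam (m+1) :=
  (χ (rs z) * η (z (Fin.last m))) • (EuclideanSpace.single S 1 : Lam (m+1))

lemma tenF_smooth {χ : Rn m → ℝ} (hχ : TsM χ) {η : ℝ → ℝ} (hη : Tst η) (S) : ContDiff ℝ ((⊤ : ℕ∞) : WithTop ℕ∞) (tenF χ η S) := by
  have h2 : ContDiff ℝ ((⊤ : ℕ∞) : WithTop ℕ∞) (fun x : Rn (m+1) => x (Fin.last m)) := (EuclideanSpace.proj (𝕜 := ℝ) (Fin.last m)).contDiff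
  exact ((hχ.1.comp rs.contDiff).mul (hη.1.comp h2)).smul contDiff_const

lemma tenF_supp {χ : Rn m → ℝ} (hχ : TsM χ) {η : ℝ → ℝ} (hη : Tst η) (S) : HasCompactSupport (tenF χ η S) := by
  refine HasCompactSupport.intro ((hχ.2.isCompact.prod hη.2.isCompact).image cont_ap) fun z hz => ?_
  unfold tenF
  have : χ (rs z) = 0 ∨ η (z (Fin.last m)) = 0 := by
    by_contra hc
    push Not at hc
    apply hz
    exact ⟨(rs z, z (Fin.last m)), ⟨subset_tsupport _ hc.1, subset_tsupport _ hc.2⟩, ap_rs z⟩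
  rcases this with h | h <;> rw [h] <;> simp

/-- as a Schwartz function -/
def ten {χ : Rn m → ℝ} (hχ : TsM χ) {η : ℝ → ℝ} (hη : Tst η) (S : Finset (Fin (m+1))) : SL (m+1) :=
  (tenF_supp hχ hη S).toSchwartzMap (tenF_smooth hχ hη S)

lemma ten_apply {χ : Rn m → ℝ} (hχ : TsM χ) {η : ℝ → ℝ} (hη : Tst η) (S) (z) : ten hχ hη S z = tenF χ η S z := rfl
lemma ten_ap {χ : Rn m → ℝ} (hχ : TsM χ) {η : ℝ → ℝ} (hη : Tst η) (S) (x t) :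
    ten hχ hη S (ap x t) = (χ x * η t) • (EuclideanSpace.single S 1 : Lam (m+1)) := by
  rw [ten_apply, tenF, rs_ap, ap_last]

lemma DX_ten {χ : Rn m → ℝ} (hχ : TsM χ) {η : ℝ → ℝ} (hη : Tst η) (S) : DX (Fin.last m) (ten hχ hη S) = ten hχ hη.deriv S := by
  ext1 z
  rw [DX_apply, pd]
  have h1 : HasFDerivAt (fun y => ten hχ hη S y) (fderiv ℝ (fun y => ten hχ hη S y) z) z := (ten hχ hη S).differentiableAt.hasFDerivAt
  have h2 := h1.hasLineDerivAt (EuclideanSpace.single (Fin.last m) 1)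
  have h3 : HasDerivAt (fun t : ℝ => ten hχ hη S (z + t • EuclideanSpace.single (Fin.last m) 1)) (ten hχ hη.deriv S z) 0 := by
    have e : (fun t : ℝ => ten hχ hη S (z + t • EuclideanSpace.single (Fin.last m) 1)) =
        fun t => (χ (rs z) * η (z (Fin.last m) + t)) • (EuclideanSpace.single S 1 : Lam (m+1)) := by
      ext1 t
      rw [ten_apply, tenF]
      have : rs (z + t • (EuclideanSpace.single (Fin.last m) (1:ℝ) : Rn (m+1))) = rs z := by
        ext i; simp [rs_apply, Fin.castSucc_ne_last]
      rw [this]; simp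
    rw [e, ten_apply, tenF]
    have h4 : HasDerivAt η (deriv η (z (Fin.last m))) (z (Fin.last m) + 0) := by rw [add_zero]; exact hη.hd _
    exact ((h4.comp_const_add _ _).const_mul _).smul_const _
  exact h2.unique h3

lemma MX_ten {χ : Rn m → ℝ} (hχ : TsM χ) {η : ℝ → ℝ} (hη : Tst η) (S) (i : Fin m) :
    MX i.castSucc (ten hχ hη S) = ten (hχ.mulx i) hη S := by
  ext1 z
  rw [MX_apply, ten_apply, ten_apply, tenF, tenF, smul_smul, rs_apply, mul_assoc]

lemma erase_last_sum {A : Type*} [AddCommGroup A] (f : Fin (m+1) → A) : ∑ j ∈ univ.erase (Fin.last m), f j = ∑ i : Fin m, f i.castSucc := by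
  rw [Finset.sum_erase_eq_sub (Finset.mem_univ _), Fin.sum_univ_castSucc]; abel

lemma SLsum_apply {ι : Type*} (s : Finset ι) (f : ι → SL n) (z) : (∑ i ∈ s, f i) z = ∑ i ∈ s, f i z := by
  classical
  induction s using Finset.induction_on with
  | empty => simp
  | insert a s ha ih => rw [Finset.sum_insert ha, Finset.sum_insert ha, ← ih]; rfl

/-- the weak integrand on the fiber -/
def VG (a : ℝ) (p : ℕ) (G : Rn (m+1) → Lam (m+1)) (η : ℝ → ℝ) (x : Rn m) (t : ℝ) : Lam (m+1) :=
  Vd ‖x‖ a ((m:ℝ)+1-2*p) ((TT x).restrictScalars ℝ) ((ZZ m).restrictScalars ℝ) (fun t => G (ap x t)) η t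

lemma DH_ten (a : ℝ) (p : ℕ) {χ : Rn m → ℝ} (hχ : TsM χ) {η : ℝ → ℝ} (hη : Tst η) (S) (G : Rn (m+1) → Lam (m+1)) (x : Rn m) (t : ℝ) :
    blin (G (ap x t)) (DH a p (Fin.last m) (ten hχ hη S) (ap x t)) = (χ x : ℂ) * (VG a p G η x t) S := by
  unfold DH
  simp only [DX_ten, erase_last_sum, MX_ten]
  simp only [SchwartzMap.add_apply, SchwartzMap.sub_apply, SchwartzMap.smul_apply, SLsum_apply, MX_apply, SchwartzMap.postcompCLM_apply, ten_ap, smul_smul]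
  simp only [blin_add_r, blin_sub_r, blin_rsmul_r, blin_sum_r]
  have q1 : ∀ i : Fin m, blin (G (ap x t)) ((iotL (ee i.castSucc) ∘SL epsL (ee (Fin.last m)) + epsL (ee i.castSucc) ∘SL iotL (ee (Fin.last m))) ((x i * χ x * deriv η t) • (EuclideanSpace.single S 1 : Lam (m+1))))
     = (x i * χ x * deriv η t) * (iot (el m) (eps (ee i.castSucc) (G (ap x t))) + eps (el m) (iot (ee i.castSucc) (G (ap x t)))) S := by
    intro i
    rw [clm_rsmul, blin_rsmul_r]
    simp only [Complex.ofReal_mul]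
    congr 1
    rw [ContinuousLinearMap.add_apply, blin_add_r]
    simp only [ContinuousLinearMap.comp_apply, epsL_apply, iotL_apply]
    rw [blin_iot, blin_eps, blin_eps, blin_iot, blin_single, blin_single]; rfl
  have q2 : blin (G (ap x t)) ((epsL (ee (Fin.last m)) ∘SL iotL (ee (Fin.last m))) ((χ x * η t) • (EuclideanSpace.single S 1 : Lam (m+1)))) = (χ x * η t) * (ZZ m (G (ap x t))) S := by
    rw [clm_rsmul, blin_rsmul_r]
    simp only [Complex.ofReal_mul]
    congr 1
    simp only [ContinuousLinearMap.comp_apply, epsL_apply, iotL_apply]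
    rw [blin_eps, blin_iot, blin_single]; rfl
  have q1' : ∀ i : Fin m, blin (G (ap x t)) ((iotL (ee i.castSucc) ∘SL epsL (ee (Fin.last m))) ((x i * χ x * deriv η t) • (EuclideanSpace.single S 1 : Lam (m+1))))
      + blin (G (ap x t)) ((epsL (ee i.castSucc) ∘SL iotL (ee (Fin.last m))) ((x i * χ x * deriv η t) • (EuclideanSpace.single S 1 : Lam (m+1))))
     = (x i * χ x * deriv η t) * (iot (el m) (eps (ee i.castSucc) (G (ap x t))) + eps (el m) (iot (ee i.castSucc) (G (ap x t)))) S := by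
    intro i
    rw [← q1 i, ← blin_add_r]; rfl
  rw [Finset.sum_congr rfl (fun i _ => q1' i)]
  simp only [q2, blin_single]
  have hs : ∑ j : Fin (m+1), ((ap x t) j * ((ap x t) j * (χ x * deriv (deriv η) t)) : ℝ) = (‖x‖^2+t^2) * (χ x * deriv (deriv η) t) := by
    rw [← norm_ap_sq, ← sum_sq_eq, Finset.sum_mul]
    exact Finset.sum_congr rfl fun _ _ => by ring
  have hs' : ∑ j : Fin (m+1), ((((ap x t) j * ((ap x t) j * (χ x * deriv (deriv η) t)) : ℝ) : ℂ) * (G (ap x t)) S) = (((‖x‖^2+t^2) * (χ x * deriv (deriv η) t) : ℝ) : ℂ) * (G (ap x t)) S := by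
    rw [← hs, ← Finset.sum_mul]; push_cast; rfl
  simp only [VG, Vd, ContinuousLinearMap.coe_restrictScalars', TT_sum]
  simp only [← Complex.coe_smul, PiLp.add_apply, PiLp.sub_apply, PiLp.smul_apply, smul_eq_mul, WithLp.ofLp_sum, Finset.sum_apply, ap_last] at *
  simp only [mul_assoc] at *
  rw [hs']
  simp only [Finset.mul_sum, mul_add, mul_sub]
  push_cast
  congr 1
  · congr 1
    · ring
    · exact Finset.sum_congr rfl fun i _ => by ring
  · ring
end

section
variable {n m : ℕ}

lemma norm_le_half {μ r g : ℝ} (hr : 0 < r) (hg : 0 ≤ g) : g ≤ r ^ μ * g^2 + r ^ (-μ) := by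
  have h1 : 0 < r ^ μ := Real.rpow_pos_of_pos hr _
  rw [Real.rpow_neg hr.le]
  set A := r ^ μ
  have : 0 ≤ A * (g - A⁻¹/2)^2 + (3/4)*A⁻¹ := by positivity
  have e : A * (g - A⁻¹/2)^2 + (3/4)*A⁻¹ = A * g^2 + A⁻¹ - g := by field_simp; ring
  linarith

lemma norm_ap_neg {μ : ℝ} (x : Rn m) (t : ℝ) : ‖ap x t‖ ^ (-μ) = (‖x‖^2+t^2) ^ (-(μ/2)) := by
  rw [norm_ap, Real.sqrt_eq_rpow, ← Real.rpow_mul (by positivity)]; congr 1; ring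

lemma Gmeas {G : Rn (m+1) → Lam (m+1)} (hG : AEStronglyMeasurable G volume) :
    AEStronglyMeasurable (fun z : Rn m × ℝ => G (ap z.1 z.2)) (volume.prod volume) :=
  hG.comp_quasiMeasurePreserving mp_ap.quasiMeasurePreserving

lemma Gfib {μ : ℝ} (hμ : 1 < μ) (hm : m ≠ 0) {p : ℕ} {G : Rn (m+1) → Lam (m+1)} (hG : G ∈ Hdot (m+1) (μ/2) p) :
    ∀ᵐ x : Rn m, Integrable (fun t => G (ap x t)) := by
  obtain ⟨h1, h2, h3⟩ := hG
  have h4 := (integrable_ap h3).prod_right_ae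
  have h5 := (Gmeas h1).prodMk_left
  filter_upwards [h4, h5, Hdot_ne hm] with x hx1 hx2 hx3
  have hk := norm_pos_iff.2 hx3
  have hq := q_int (s := μ/2) (by linarith) hk
  refine (hx1.add hq).mono' hx2 (ae_of_all _ fun t => ?_)
  have hp : 0 < ‖ap x t‖ := norm_pos_iff.2 (ap_ne_zero x hx3 t)
  have := norm_le_half (μ := μ) hp (norm_nonneg (G (ap x t)))
  rw [norm_ap_neg] at this
  have e : 2*(μ/2) = μ := by ring
  simpa only [Pi.add_apply, e] using this

lemma chiG {μ : ℝ} (hμ : 1 < μ) (hm : m ≠ 0) {p : ℕ} {G : Rn (m+1) → Lam (m+1)} (hG : G ∈ Hdot (m+1) (μ/2) p)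
    {χ : Rn m → ℝ} (hc : Continuous χ) (hs : HasCompactSupport χ) (h0 : tsupport χ ⊆ {0}ᶜ) :
    Integrable (fun z : Rn m × ℝ => χ z.1 • G (ap z.1 z.2)) (volume.prod volume) := by
  obtain ⟨h1, h2, h3⟩ := hG
  have h4 := integrable_ap h3
  obtain ⟨δ, hδ, hb⟩ : ∃ δ : ℝ, 0 < δ ∧ ∀ x, χ x ≠ 0 → δ ≤ ‖x‖ := by
    by_cases he : (tsupport χ).Nonempty
    · obtain ⟨x0, hx0, hmin⟩ := hs.isCompact.exists_isMinOn he continuous_norm.continuousOn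
      exact ⟨‖x0‖, norm_pos_iff.2 (by simpa using h0 hx0), fun x hx => hmin (subset_tsupport _ hx)⟩
    · refine ⟨1, one_pos, fun x hx => ?_⟩
      exact absurd ⟨x, subset_tsupport _ hx⟩ he
  obtain ⟨C, hC⟩ := hs.exists_bound_of_continuous hc
  have hq := q_int (s := μ/2) (by linarith) hδ
  have hχ : Integrable χ := hc.integrable_of_hasCompactSupport hs
  have i2 : Integrable (fun z : Rn m × ℝ => ‖χ z.1‖ * (δ^2+z.2^2) ^ (-(μ/2))) (volume.prod volume) :=
    Integrable.mul_prod hχ.norm hq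
  refine ((h4.const_mul C).add i2).mono' ((hc.comp continuous_fst).aestronglyMeasurable.smul (Gmeas h1)) (ae_of_all _ fun z => ?_)
  obtain ⟨x, t⟩ := z
  simp only [norm_smul, Pi.add_apply]
  by_cases hx : χ x = 0
  · rw [hx]; simp
    have := (norm_nonneg _).trans (hC x)
    positivity
  · have hx1 := hb x hx
    have hx3 : x ≠ 0 := norm_pos_iff.1 (hδ.trans_le hx1)
    have hp : 0 < ‖ap x t‖ := norm_pos_iff.2 (ap_ne_zero x hx3 t)
    have := norm_le_half (μ := μ) hp (norm_nonneg (G (ap x t)))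
    rw [norm_ap_neg] at this
    have e : 2*(μ/2) = μ := by ring
    rw [e]
    have h5 : (‖x‖^2+t^2) ^ (-(μ/2)) ≤ (δ^2+t^2) ^ (-(μ/2)) := by
      apply Real.rpow_le_rpow_of_nonpos (by positivity) _ (by linarith)
      gcongr
    have h6 : ‖χ x‖ * (‖ap x t‖ ^ μ * ‖G (ap x t)‖^2) ≤ C * (‖ap x t‖ ^ μ * ‖G (ap x t)‖^2) := by
      gcongr; exact hC x
    calc _ ≤ ‖χ x‖ * (‖ap x t‖ ^ μ * ‖G (ap x t)‖^2 + (δ^2+t^2) ^ (-(μ/2))) := by gcongr; linarith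
      _ ≤ _ := by rw [mul_add]; linarith

lemma ceG {μ : ℝ} (hμ : 1 < μ) (hm : m ≠ 0) {p : ℕ} {G : Rn (m+1) → Lam (m+1)} (hG : G ∈ Hdot (m+1) (μ/2) p)
    {χ : Rn m → ℝ} (hc : Continuous χ) (hs : HasCompactSupport χ) (h0 : tsupport χ ⊆ {0}ᶜ)
    {c : Rn m → ℝ} (hcc : Continuous c) {e : ℝ → ℝ} (he : Continuous e) (hes : HasCompactSupport e) (L : Lam (m+1) →L[ℂ] Lam (m+1)) :
    Integrable (fun z : Rn m × ℝ => (χ z.1 * (c z.1 * e z.2)) • L (G (ap z.1 z.2))) (volume.prod volume) := by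
  have h1 : Integrable (fun z : Rn m × ℝ => (fun x => c x * χ x) z.1 • G (ap z.1 z.2)) (volume.prod volume) :=
    chiG hμ hm hG (hcc.mul hc) hs.mul_left ((tsupport_mul_subset_right).trans h0)
  have h2 := L.integrable_comp h1
  obtain ⟨C, hC⟩ := hes.exists_bound_of_continuous he
  have h3 := h2.bdd_smul (φ := fun z : Rn m × ℝ => e z.2) C (he.comp continuous_snd).aestronglyMeasurable (ae_of_all _ fun z => hC z.2)
  refine h3.congr (ae_of_all _ fun z => ?_)
  simp only [Pi.smul_apply', clm_rsmul, smul_smul]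
  congr 1; ring

lemma mod_id {E : Type*} [AddCommGroup E] [Module ℝ E] (c k q1 b d e N : ℝ) (A B Z : E) :
    ((c*(k*q1)) • A + (c*(1*b)) • A + (c * d) • B) - (c*(N*e)) • Z = c • ((k*q1+b) • A + d • B - (N*e) • Z) := by module

lemma sum_TT (G : Lam (m+1)) (x : Rn m) (c d : ℝ) : ∑ i : Fin m, (c * (x i * d)) • ((iotL (el m) ∘L epsL (ee i.castSucc) + epsL (el m) ∘L iotL (ee i.castSucc)) G)
    = (c * d) • TT x G := by
  rw [TT_sum, Finset.smul_sum]
  refine Finset.sum_congr rfl fun i _ => ?_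
  rw [smul_smul]
  have : c * (x i * d) = c * d * x i := by ring
  rw [this]; rfl

lemma VG_eq (a : ℝ) (p : ℕ) (G : Rn (m+1) → Lam (m+1)) (χ : ℝ) (η : ℝ → ℝ) (x : Rn m) (t : ℝ) :
    ((χ * (‖x‖^2 * deriv (deriv η) t)) • (ContinuousLinearMap.id ℂ (Lam (m+1))) (G (ap x t)) 
      + (χ * (1 * (t^2*deriv (deriv η) t + a*t*deriv η t))) • (ContinuousLinearMap.id ℂ (Lam (m+1))) (G (ap x t))
      + ∑ i : Fin m, (χ * (x i * (2*deriv η t))) • ((iotL (el m) ∘L epsL (ee i.castSucc) + epsL (el m) ∘L iotL (ee i.castSucc)) (G (ap x t))))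
      - (χ * (((m:ℝ)+1-2*p) * η t)) • ZZ m (G (ap x t)) = χ • VG a p G η x t := by
  rw [sum_TT, ContinuousLinearMap.id_apply, mod_id, VG, Vd]
  congr 4
  ring

lemma VG_int {μ : ℝ} (hμ : 1 < μ) (hm : m ≠ 0) {p : ℕ} {G : Rn (m+1) → Lam (m+1)} (hG : G ∈ Hdot (m+1) (μ/2) p)
    {χ : Rn m → ℝ} (hc : Continuous χ) (hs : HasCompactSupport χ) (h0 : tsupport χ ⊆ {0}ᶜ) (a : ℝ) {η : ℝ → ℝ} (h : Tst η) :
    Integrable (fun z : Rn m × ℝ => χ z.1 • VG a p G η z.1 z.2) (volume.prod volume) := by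
  have c0 := h.c1.continuous
  have c1 := h.deriv.c1.continuous
  have c2 := h.deriv.deriv.c1.continuous
  have k1 := ceG hμ hm hG hc hs h0 (c := fun x => ‖x‖^2) (by fun_prop) c2 h.deriv.deriv.2 (ContinuousLinearMap.id ℂ _)
  have s1 : HasCompactSupport (fun t => t^2*deriv (deriv η) t) := HasCompactSupport.mul_left (f := fun t => t^2) h.deriv.deriv.2
  have s2 : HasCompactSupport (fun t => a*t*deriv η t) := HasCompactSupport.mul_left (f := fun t => a*t) h.deriv.2
  have s3 : HasCompactSupport (fun t => t^2*deriv (deriv η) t + a*t*deriv η t) := s1.add s2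
  have c3 : Continuous (fun t => t^2*deriv (deriv η) t + a*t*deriv η t) := by fun_prop
  have k2 := ceG hμ hm hG hc hs h0 (c := fun x => 1) (by fun_prop) c3 s3 (ContinuousLinearMap.id ℂ _)
  have k3 : ∀ i : Fin m, Integrable (fun z : Rn m × ℝ => (χ z.1 * (z.1 i * (2*deriv η z.2))) • (iotL (el m) ∘L epsL (ee i.castSucc) + epsL (el m) ∘L iotL (ee i.castSucc)) (G (ap z.1 z.2))) (volume.prod volume) := fun i =>
    ceG hμ hm hG hc hs h0 (c := fun x => x i) (by fun_prop) (e := fun t => 2*deriv η t) (by fun_prop) h.deriv.2.mul_left _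
  have k4 := ceG hμ hm hG hc hs h0 (c := fun x => ((m:ℝ)+1-2*p)) (by fun_prop) c0 h.2 (ZZ m)
  have k3' := integrable_finset_sum univ fun i _ => k3 i
  have k5 := (((k1.add k2).add k3').sub k4)
  refine k5.congr (ae_of_all _ fun z => ?_)
  obtain ⟨x, t⟩ := z
  have := VG_eq a p G (χ x) η x t
  simp only [Pi.add_apply, Pi.sub_apply, Finset.sum_apply]
  exact this
end

section
variable {n m : ℕ}

lemma bump_on {K : Set (Rn n)} (hK : IsCompact K) (h0 : K ⊆ {0}ᶜ) :
    ∃ χ : Rn n → ℝ, Continuous χ ∧ HasCompactSupport χ ∧ tsupport χ ⊆ {0}ᶜ ∧ ∀ x ∈ K, χ x = 1 := by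
  obtain ⟨k, k_comp, k_closed, sk, kt⟩ := exists_compact_closed_between hK isOpen_compl_singleton h0
  obtain ⟨f, f1, f0, fc, -⟩ := exists_continuous_one_zero_of_isCompact hK (isOpen_interior (s := k)).isClosed_compl
    (Set.disjoint_compl_right_iff_subset.mpr sk)
  refine ⟨f, f.continuous, fc, ?_, fun x hx => f1 hx⟩
  refine (closure_minimal ?_ k_closed).trans kt
  intro x hx
  by_contra hc
  exact hx (f0 fun h => hc (interior_subset h))

lemma W_zero {μ a : ℝ} (hμ : 1 < μ) (hm : m ≠ 0) {p : ℕ} {G : Rn (m+1) → Lam (m+1)} (hG : G ∈ Hdot (m+1) (μ/2) p)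
    (hW : WeakEig a p (Fin.last m) G 0) {η : ℝ → ℝ} (h : Tst η) :
    ∀ᵐ x : Rn m, ∫ t, VG a p G η x t = 0 := by
  have key : ∀ᵐ x : Rn m, x ∈ ({0}ᶜ : Set (Rn m)) → ∫ t, VG a p G η x t = 0 := by
    refine IsOpen.ae_eq_zero_of_integral_contDiff_smul_eq_zero isOpen_compl_singleton ?_ ?_
    · rw [locallyIntegrableOn_iff isOpen_compl_singleton.isLocallyClosed]
      intro K hK0 hK
      obtain ⟨χ, hc, hs, h0, h1⟩ := bump_on hK hK0
      have := (VG_int hμ hm hG hc hs h0 a h).integral_prod_left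
      simp only [integral_smul] at this
      refine (this.integrableOn (s := K)).congr_fun (fun x hx => ?_) hK.measurableSet
      simp only [h1 x hx, one_smul]
    · intro χ hχ hs h0
      have hχ' : TsM χ := ⟨hχ, hs⟩
      have hi := VG_int hμ hm hG hχ.continuous hs h0 a h
      have e : ∫ x, χ x • ∫ t, VG a p G η x t = ∫ x, ∫ t, χ x • VG a p G η x t := by
        simp only [integral_smul]
      rw [e, ← integral_prod _ hi]
      ext S
      have hS := (EuclideanSpace.proj (𝕜 := ℂ) S).integral_comp_comm hi
      simp only [PiLp.proj_apply] at hS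
      rw [← hS]
      have hw := weak_FS hW (ten hχ' h S)
      rw [← mp_ap.integral_comp me_ap] at hw
      simp only [DH_ten] at hw
      rw [PiLp.zero_apply, ← hw]
      refine integral_congr_ae (ae_of_all _ fun z => ?_)
      simp only [← Complex.coe_smul, PiLp.smul_apply, smul_eq_mul]
  filter_upwards [key, Hdot_ne hm] with x h1 h2 using h1 h2

lemma fib_form {μ M a : ℝ} (hμ : 1 < μ) (hM : 0 < M) (hm : m ≠ 0) {p : ℕ} (ha : μ = 2 - a) (hN : (m:ℝ)+1-2*p = M+μ)
    {G : Rn (m+1) → Lam (m+1)} (hG : G ∈ Hdot (m+1) (μ/2) p) (hW : WeakEig a p (Fin.last m) G 0) :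
    ∀ᵐ x : Rn m, ∃ α γ, Tang (rc (om x)) α ∧ Tang (rc (om x)) γ ∧ (∀ᵐ t : ℝ, G (ap x t) = Fib μ M ‖x‖ (rc (om x)) α γ t) := by
  obtain ⟨D, hDc, hDT, hD⟩ := dense_tst
  have h1 : ∀ᵐ x : Rn m, ∀ d ∈ D, ∫ t, VG a p G d x t = 0 := (ae_ball_iff hDc).2 fun d hd => W_zero hμ hm hG hW (hDT d hd)
  filter_upwards [h1, Gfib hμ hm hG, Hdot_ne hm] with x hx1 hx2 hx3
  have hk := norm_pos_iff.2 hx3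
  obtain ⟨y, w, hy0, hy, hw⟩ := weak_reg (N := (m:ℝ)+1-2*p) hk ha ((TT x).restrictScalars ℝ) ((ZZ m).restrictScalars ℝ) hx2 (fun η hη => by
    obtain ⟨R, hR, happ⟩ := hD η hη
    exact Vd_ext ‖x‖ a ((m:ℝ)+1-2*p) ((TT x).restrictScalars ℝ) ((ZZ m).restrictScalars ℝ) hx2 hDT hx1 hη hR happ)
  rw [hN] at hw
  obtain ⟨α, γ, hα, hγ, hf⟩ := ode_fib hμ hM x hx3 y w hy hw (hx2.congr hy0)
  refine ⟨α, γ, hα, hγ, ?_⟩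
  filter_upwards [hy0] with t ht
  rw [ht, hf t]
lemma C0_integral {k μ M : ℝ} (hk : 0 < k) (hμ : 1 < μ) (hM : 0 < M) : ∫ t, C0 μ M k t = II μ * k ^ (1-μ) * ((M+2*μ-2)/M) := by
  have h1 := q_int (s := μ/2) (by linarith) hk
  have h2 := q_int (s := μ/2+1) (by linarith) hk
  unfold C0
  simp only [show -(μ/2)-1 = -(μ/2+1) by ring]
  rw [integral_add h1 (h2.const_mul _), integral_const_mul, q_integral1 hμ hk]
  have := q_integral2 hμ hk
  rw [mul_assoc (2*μ/M), this]
  field_simp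
  ring

lemma trace_fib {μ M : ℝ} (hμ : 1 < μ) (hM : 0 < M) (x : Rn m) (hx : x ≠ 0) (α γ : Lam (m+1))
    (hα : Tang (rc (om x)) α) (hγ : Tang (rc (om x)) γ) (G : Rn (m+1) → Lam (m+1))
    (hg : ∀ᵐ t : ℝ, G (ap x t) = Fib μ M ‖x‖ (rc (om x)) α γ t) (h : Rn m → Lam m) (ht : ftrace (n := m+1) G x = h x) :
    TrRel μ M x α γ (h x) := by
  have hk := norm_pos_iff.2 hx
  unfold TrRel
  rw [← ht]
  have e : ftrace (n := m+1) G x = ((2 * Real.pi) ^ (-(1:ℝ)/2) : ℝ) • ∫ t : ℝ, prj (G (ap x t)) := rfl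
  have e2 : ∫ t : ℝ, prj (G (ap x t)) = ∫ t : ℝ, ((((‖x‖^2+t^2) ^ (-(μ/2)) : ℝ) ) • prj α + (C0 μ M ‖x‖ t) • prj (eps (rc (om x)) γ)) := by
    refine integral_congr_ae ?_
    filter_upwards [hg] with t ht
    rw [ht, Fib, prj_add, prj_add, prj_smul, prj_smul, prj_smul, prj_eps_last, smul_zero, add_zero, Complex.coe_smul, Complex.coe_smul]
  have h3 : iot (ee (Fin.last m)) (eps (rc (om x)) γ) = 0 := by
    have := car3 x γ
    unfold el at this
    rw [this, hγ.2, eps_zero, neg_zero]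
  rw [e, e2, integral_add ((q_int (by linarith) hk).smul_const _) ((C0_int hk hμ).smul_const _), integral_smul_const, integral_smul_const,
    q_integral1 hμ hk, C0_integral hk hμ hM, ← Complex.coe_smul, ← Complex.coe_smul, ← Complex.coe_smul, inc_smul, inc_add, inc_smul, inc_smul, inc_prj _ hα.2, inc_prj _ h3]
  simp only [smul_add, smul_smul]
  push_cast
  congr 2
  ring

theorem part2 {μ M a : ℝ} (hμ : 1 < μ) (hM : 0 < M) (hm : m ≠ 0) {p : ℕ} (ha : μ = 2 - a) (hN : (m:ℝ)+1-2*p = M+μ)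
    {G : Rn (m+1) → Lam (m+1)} (hG : G ∈ Hdot (m+1) (μ/2) p) (hW : WeakEig a p (Fin.last m) G 0)
    (h : Rn m → Lam m) (ht : ∀ᵐ x : Rn m, ftrace (n := m+1) G x = h x) :
    cSq ((M+μ)/2) (-(μ/2)) G
     = (2*Real.pi*(M+2*μ)/(II μ * (M+2*μ-2))) * cSq ((M+μ-1)/2) (-((μ-1)/2)) h := by
  refine assemble hμ hM hm G hG h ?_
  filter_upwards [fib_form hμ hM hm ha hN hG hW, ht, Hdot_ne hm] with x ⟨α, γ, h1, h2, h3⟩ h4 h5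
  exact ⟨α, γ, h1, h2, h3, trace_fib hμ hM x h5 α γ h1 h2 G h3 h h4⟩
end

section
section GaussM
variable {V : Type*} [NormedAddCommGroup V] [InnerProductSpace ℝ V] [FiniteDimensional ℝ V] [MeasurableSpace V] [BorelSpace V]

/-- oscillating gaussian -/
def gs (s : ℝ) (ξ z : V) : ℂ := cexp (-(s:ℂ) * ‖z‖^2 + (-I) * ((inner ℝ ξ z : ℝ) : ℂ))

lemma gs_eq (s : ℝ) (ξ z : V) : gs s ξ z = ((Real.exp (-s * ‖z‖^2) : ℝ):ℂ) * cexp (-(((inner ℝ ξ z : ℝ) : ℂ) * I)) := by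
  unfold gs
  rw [Complex.exp_add]; push_cast; congr 2; ring

lemma norm_gs (s : ℝ) (ξ z : V) : ‖gs s ξ z‖ = Real.exp (-s * ‖z‖^2) := by
  rw [gs_eq, norm_mul, ← neg_mul, ← Complex.ofReal_neg, Complex.norm_exp_ofReal_mul_I, mul_one, Complex.norm_real, Real.norm_eq_abs, abs_of_pos (Real.exp_pos _)]

lemma cont_gs (s : ℝ) (ξ : V) : Continuous (gs s ξ) := by
  unfold gs
  fun_prop

lemma gs_integral {s : ℝ} (hs : 0 < s) (ξ : V) :
    ∫ z, gs s ξ z = (((Real.pi/s) ^ ((Module.finrank ℝ V : ℝ)/2) * Real.exp (-(‖ξ‖^2/(4*s))) : ℝ) : ℂ) := by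
  unfold gs
  rw [GaussianFourier.integral_cexp_neg_mul_sq_norm_add (by simpa using hs)]
  push_cast
  rw [Complex.ofReal_cpow (by positivity)]
  push_cast
  congr 2
  rw [neg_sq, I_sq]; ring

lemma gauss_int {s : ℝ} (hs : 0 < s) : Integrable (fun z : V => Real.exp (-s * ‖z‖^2)) := by
  have := (GaussianFourier.integrable_cexp_neg_mul_sq_norm_add (V := V) (b := (s:ℂ)) (by simpa using hs) 0 0).norm
  refine this.congr (ae_of_all _ fun z => ?_)
  simp only [inner_zero_left, Complex.ofReal_zero, mul_zero, add_zero]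
  rw [Complex.norm_exp]
  congr 1
  rw [← Complex.ofReal_pow, ← Complex.ofReal_neg, ← Complex.ofReal_mul, Complex.ofReal_re]

lemma gauss_sq_int {s : ℝ} (hs : 0 < s) : Integrable (fun z : V => (1 + ‖z‖^2) * Real.exp (-s * ‖z‖^2)) := by
  have h := (gauss_int (V := V) (half_pos hs)).const_mul (1 + 2/s)
  refine h.mono' ?_ (ae_of_all _ fun z => ?_)
  · apply Continuous.aestronglyMeasurable; fun_prop
  · rw [Real.norm_eq_abs, abs_of_nonneg (by positivity)]
    have e : Real.exp (-s * ‖z‖^2) = Real.exp (-(s/2) * ‖z‖^2) * Real.exp (-(s/2) * ‖z‖^2) := by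
      rw [← Real.exp_add]; ring_nf
    have h1 : (s/2) * ‖z‖^2 * Real.exp (-(s/2) * ‖z‖^2) ≤ 1 := by
      have h2 := Real.add_one_le_exp ((s/2) * ‖z‖^2)
      rw [neg_mul, Real.exp_neg, ← div_eq_mul_inv, div_le_one (Real.exp_pos _)]
      linarith
    have h3 : Real.exp (-(s/2) * ‖z‖^2) ≤ 1 := by
      rw [Real.exp_le_one_iff]; nlinarith [sq_nonneg ‖z‖]
    rw [e, ← mul_assoc]
    refine mul_le_mul_of_nonneg_right ?_ (Real.exp_pos _).le
    have h4 : ‖z‖^2 * Real.exp (-(s/2) * ‖z‖^2) ≤ 2/s := by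
      rw [le_div_iff₀ hs]; nlinarith
    nlinarith

/-- quadratically bounded continuous weights -/
lemma wgs_int {s : ℝ} (hs : 0 < s) (ξ : V) {w : V → ℂ} (hw : Continuous w) {C : ℝ} (hC : ∀ z, ‖w z‖ ≤ C * (1 + ‖z‖^2)) :
    Integrable (fun z => w z * gs s ξ z) := by
  refine ((gauss_sq_int (V := V) hs).const_mul C).mono' ((hw.mul (cont_gs s ξ)).aestronglyMeasurable) (ae_of_all _ fun z => ?_)
  rw [norm_mul, norm_gs, ← mul_assoc]
  exact mul_le_mul_of_nonneg_right (hC z) (Real.exp_pos _).le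

lemma gs_deriv (s : ℝ) (ξ z e : V) : HasLineDerivAt ℝ (gs s ξ) ((-2*s*((inner ℝ e z : ℝ):ℂ) - I * ((inner ℝ e ξ : ℝ):ℂ)) * gs s ξ z) z e := by
  unfold HasLineDerivAt
  have h1 : HasDerivAt (fun t : ℝ => ‖z + t • e‖^2) (2 * inner ℝ e z) 0 := by
    have h0 : (fun t : ℝ => ‖z + t • e‖^2) = fun t => ‖z‖^2 + t * (2 * inner ℝ e z) + t^2 * ‖e‖^2 := by
      ext t; rw [norm_add_sq_real, inner_smul_right, norm_smul, mul_pow, Real.norm_eq_abs, sq_abs, real_inner_comm]; ring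
    rw [h0]
    have := (((hasDerivAt_id (0:ℝ)).mul_const (2 * inner ℝ e z)).const_add (‖z‖^2)).add (((hasDerivAt_id (0:ℝ)).pow 2).mul_const (‖e‖^2))
    have h5 : HasDerivAt (fun t => ‖z‖ ^ 2 + t * (2 * inner ℝ e z) + t ^ 2 * ‖e‖ ^ 2) _ 0 := this
    convert h5 using 1
    simp
  have h2 : HasDerivAt (fun t : ℝ => (inner ℝ ξ (z + t • e) : ℝ)) (inner ℝ e ξ) 0 := by
    have h0 : (fun t : ℝ => (inner ℝ ξ (z + t • e) : ℝ)) = fun t => inner ℝ ξ z + t * inner ℝ e ξ := by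
      ext t; rw [inner_add_right, inner_smul_right, real_inner_comm e]
    rw [h0]
    simpa using ((hasDerivAt_id (0:ℝ)).mul_const (inner ℝ e ξ : ℝ)).const_add (inner ℝ ξ z)
  have h3 := ((h1.ofReal_comp.const_mul (-(s:ℂ))).add (h2.ofReal_comp.const_mul (-I))).cexp
  unfold gs
  simp only [Pi.add_apply] at h3
  convert h3 using 1
  · ext t; simp
  · simp
  · simp; ring

lemma abs_inner_le (e z : V) : ‖((inner ℝ e z : ℝ):ℂ)‖ ≤ ‖e‖ * (1+‖z‖^2) := by
  rw [Complex.norm_real]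
  refine (norm_inner_le_norm e z).trans (mul_le_mul_of_nonneg_left ?_ (norm_nonneg _))
  nlinarith [sq_nonneg (‖z‖ - 1)]

lemma abs_inner2_le (e e' z : V) : ‖((inner ℝ e z : ℝ):ℂ) * ((inner ℝ e' z : ℝ):ℂ)‖ ≤ (‖e‖ * ‖e'‖) * (1+‖z‖^2) := by
  rw [norm_mul, Complex.norm_real, Complex.norm_real]
  have h1 := norm_inner_le_norm (𝕜 := ℝ) e z
  have h2 := norm_inner_le_norm (𝕜 := ℝ) e' z
  calc _ ≤ (‖e‖*‖z‖) * (‖e'‖*‖z‖) := by gcongr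
    _ = (‖e‖*‖e'‖) * ‖z‖^2 := by ring
    _ ≤ _ := by gcongr; linarith

lemma cont_inC (e : V) : Continuous (fun z : V => ((inner ℝ e z : ℝ):ℂ)) := by fun_prop

lemma int0 {s : ℝ} (hs : 0 < s) (ξ : V) : Integrable (gs s ξ) := by
  have := wgs_int hs ξ (w := fun _ => 1) continuous_const (C := 1) (fun z => by simp)
  simpa using this
lemma int1 {s : ℝ} (hs : 0 < s) (ξ e : V) : Integrable (fun z => ((inner ℝ e z : ℝ):ℂ) * gs s ξ z) :=
  wgs_int hs ξ (cont_inC e) (abs_inner_le e)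
lemma int2 {s : ℝ} (hs : 0 < s) (ξ e e' : V) : Integrable (fun z => ((inner ℝ e z : ℝ):ℂ) * ((inner ℝ e' z : ℝ):ℂ) * gs s ξ z) :=
  wgs_int hs ξ ((cont_inC e).mul (cont_inC e')) (abs_inner2_le e e')

lemma mom1 {s : ℝ} (hs : 0 < s) (ξ e : V) :
    ∫ z, ((inner ℝ e z : ℝ):ℂ) * gs s ξ z = (-I * ((inner ℝ e ξ : ℝ):ℂ) / (2*s)) * ∫ z, gs s ξ z := by
  have hd := fun z => gs_deriv s ξ z e
  have hi : Integrable (fun z => (-2*s*((inner ℝ e z : ℝ):ℂ) - I * ((inner ℝ e ξ : ℝ):ℂ)) * gs s ξ z) := by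
    have := ((int1 hs ξ e).const_mul (-2*(s:ℂ))).sub ((int0 hs ξ).const_mul (I * ((inner ℝ e ξ : ℝ):ℂ)))
    refine this.congr (ae_of_all _ fun z => ?_)
    simp only [Pi.sub_apply]; ring
  have h := integral_bilinear_hasLineDerivAt_right_eq_neg_left_of_integrable (μ := (volume : Measure V)) (f := fun _ => (1:ℂ)) (f' := fun _ => 0)
    (g := gs s ξ) (v := e) (B := ContinuousLinearMap.mul ℝ ℂ) (by simp) (by simpa using hi) (by simpa using int0 hs ξ)
    (fun x _ => by unfold HasLineDerivAt; exact hasDerivAt_const _ _) (fun z _ => hd z)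
  simp only [ContinuousLinearMap.mul_apply', one_mul, zero_mul, integral_zero, neg_zero] at h
  have e1 : ∫ z, (-2*s*((inner ℝ e z : ℝ):ℂ) - I * ((inner ℝ e ξ : ℝ):ℂ)) * gs s ξ z
     = -2*(s:ℂ) * (∫ z, ((inner ℝ e z : ℝ):ℂ) * gs s ξ z) - I * ((inner ℝ e ξ : ℝ):ℂ) * ∫ z, gs s ξ z := by
    rw [← integral_const_mul, ← integral_const_mul, ← integral_sub ((int1 hs ξ e).const_mul _) ((int0 hs ξ).const_mul _)]
    congr 1; ext1 z; ring
  rw [e1] at h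
  have hs' : (s:ℂ) ≠ 0 := by exact_mod_cast hs.ne'
  field_simp
  linear_combination (-1:ℂ)*h

lemma mom2 {s : ℝ} (hs : 0 < s) (ξ e e' : V) :
    ∫ z, ((inner ℝ e z : ℝ):ℂ) * ((inner ℝ e' z : ℝ):ℂ) * gs s ξ z
     = (((inner ℝ e e' : ℝ):ℂ)/(2*s) - ((inner ℝ e ξ : ℝ):ℂ) * ((inner ℝ e' ξ : ℝ):ℂ) / (4*s^2)) * ∫ z, gs s ξ z := by
  have hd := fun z => gs_deriv s ξ z e
  have hi : Integrable (fun z => ((inner ℝ e' z : ℝ):ℂ) * ((-2*s*((inner ℝ e z : ℝ):ℂ) - I * ((inner ℝ e ξ : ℝ):ℂ)) * gs s ξ z)) := by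
    have := ((int2 hs ξ e e').const_mul (-2*(s:ℂ))).sub ((int1 hs ξ e').const_mul (I * ((inner ℝ e ξ : ℝ):ℂ)))
    refine this.congr (ae_of_all _ fun z => ?_)
    simp only [Pi.sub_apply]; ring
  have hl : ∀ z : V, HasLineDerivAt ℝ (fun z : V => ((inner ℝ e' z : ℝ):ℂ)) ((inner ℝ e e' : ℝ):ℂ) z e := by
    intro z
    unfold HasLineDerivAt
    have h0 : (fun t : ℝ => (inner ℝ e' (z + t • e) : ℝ)) = fun t => inner ℝ e' z + t * inner ℝ e e' := by
      ext t; rw [inner_add_right, inner_smul_right, real_inner_comm e]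
    have h1 : HasDerivAt (fun t : ℝ => (inner ℝ e' (z + t • e) : ℝ)) (inner ℝ e e') 0 := by
      rw [h0]
      simpa using ((hasDerivAt_id (0:ℝ)).mul_const (inner ℝ e e' : ℝ)).const_add (inner ℝ e' z)
    exact h1.ofReal_comp
  have h := integral_bilinear_hasLineDerivAt_right_eq_neg_left_of_integrable (μ := (volume : Measure V)) (f := fun z => ((inner ℝ e' z : ℝ):ℂ)) (f' := fun _ => ((inner ℝ e e' : ℝ):ℂ))
    (g := gs s ξ) (v := e) (B := ContinuousLinearMap.mul ℝ ℂ) ((int0 hs ξ).const_mul _) hi (int1 hs ξ e')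
    (fun z _ => hl z) (fun z _ => hd z)
  simp only [ContinuousLinearMap.mul_apply'] at h
  have e1 : ∫ z, ((inner ℝ e' z : ℝ):ℂ) * ((-2*s*((inner ℝ e z : ℝ):ℂ) - I * ((inner ℝ e ξ : ℝ):ℂ)) * gs s ξ z)
     = -2*(s:ℂ) * (∫ z, ((inner ℝ e z : ℝ):ℂ) * ((inner ℝ e' z : ℝ):ℂ) * gs s ξ z) - I * ((inner ℝ e ξ : ℝ):ℂ) * ∫ z, ((inner ℝ e' z : ℝ):ℂ) * gs s ξ z := by
    rw [← integral_const_mul, ← integral_const_mul, ← integral_sub ((int2 hs ξ e e').const_mul _) ((int1 hs ξ e').const_mul _)]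
    congr 1; ext1 z; ring
  rw [e1, integral_const_mul, mom1 hs] at h
  have hs' : (s:ℂ) ≠ 0 := by exact_mod_cast hs.ne'
  field_simp at h ⊢
  rw [I_sq] at h
  linear_combination (-2:ℂ)*h
end GaussM
end

section
/-- Bessel-type integral -/
def JJ (θ x k : ℝ) : ℝ := ∫ s in Set.Ioi (0:ℝ), s ^ (θ-1) * Real.exp (-(s*x^2) - k^2/(4*s))

lemma JJ_int {θ x : ℝ} (hθ : 0 < θ) (hx : x ≠ 0) (k : ℝ) :
    IntegrableOn (fun s : ℝ => s ^ (θ-1) * Real.exp (-(s*x^2) - k^2/(4*s))) (Set.Ioi 0) := by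
  have h := integrable_rpow_exp (r := x^2) (s := θ) (by positivity) hθ
  refine h.mono' ?_ ?_
  · apply Measurable.aestronglyMeasurable; fun_prop
  · filter_upwards [ae_restrict_mem measurableSet_Ioi] with s hs
    have hs' : (0:ℝ) < s := hs
    rw [Real.norm_eq_abs, abs_of_nonneg (by positivity)]
    gcongr
    have : 0 ≤ k^2/(4*s) := by positivity
    linarith

lemma JJ_int' {θ x k : ℝ} (hθ : 0 < θ) (hx : x ≠ 0) (hk : k ≠ 0) :
    IntegrableOn (fun s : ℝ => s ^ (θ-1-1) * Real.exp (-(s*x^2) - k^2/(4*s))) (Set.Ioi 0) := by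
  have h := (integrable_rpow_exp (r := x^2) (s := θ) (by positivity) hθ).const_mul (4/k^2)
  refine h.mono' ?_ ?_
  · apply Measurable.aestronglyMeasurable; fun_prop
  · filter_upwards [ae_restrict_mem measurableSet_Ioi] with s hs
    have hs' : (0:ℝ) < s := hs
    rw [Real.norm_eq_abs, abs_of_nonneg (by positivity), Real.rpow_sub_one hs'.ne', sub_eq_add_neg (-(s*x^2)), Real.exp_add]
    have h1 : k^2/(4*s) * Real.exp (-(k^2/(4*s))) ≤ 1 := by
      rw [Real.exp_neg, ← div_eq_mul_inv, div_le_one (Real.exp_pos _)]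
      have := Real.add_one_le_exp (k^2/(4*s)); linarith
    have h2 : s⁻¹ * Real.exp (-(k^2/(4*s))) ≤ 4/k^2 := by
      have hk2 : 0 < k^2 := by positivity
      rw [le_div_iff₀ hk2]
      calc _ = 4 * (k^2/(4*s) * Real.exp (-(k^2/(4*s)))) := by field_simp
        _ ≤ 4 := by linarith
    calc _ = (s⁻¹ * Real.exp (-(k^2/(4*s)))) * (s ^ (θ-1) * Real.exp (-(s*x^2))) := by rw [div_eq_mul_inv]; ring
      _ ≤ (4/k^2) * (s ^ (θ-1) * Real.exp (-(s*x^2))) := by gcongr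
      _ = _ := by rw [mul_comm s]

lemma JJ_scale (θ : ℝ) {x k : ℝ} (hx : x ≠ 0) (hk : k ≠ 0) : JJ θ x k = (k^2/x^2) ^ θ * JJ θ k x := by
  unfold JJ
  have hc : 0 < k^2/x^2 := by positivity
  have h := integral_comp_mul_left_Ioi (fun s : ℝ => s ^ (θ-1) * Real.exp (-(s*x^2) - k^2/(4*s))) 0 hc
  rw [mul_zero] at h
  rw [eq_comm, inv_smul_eq_iff₀ hc.ne'] at h
  rw [h, smul_eq_mul, ← integral_const_mul, ← integral_const_mul]
  refine setIntegral_congr_fun measurableSet_Ioi fun s hs => ?_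
  have hs' : (0:ℝ) < s := hs
  try simp only
  rw [Real.mul_rpow hc.le hs'.le, Real.rpow_sub_one hc.ne' θ]
  have : -(k^2/x^2*s*x^2) - k^2/(4*(k^2/x^2*s)) = -(s*k^2) - x^2/(4*s) := by field_simp
  rw [this]
  field_simp

section GaussM
variable {V : Type*} [NormedAddCommGroup V] [InnerProductSpace ℝ V] [FiniteDimensional ℝ V] [MeasurableSpace V] [BorelSpace V]

lemma Q_le {x : ℝ} (hx : x ≠ 0) (z : V) : 1 + ‖z‖^2 ≤ (1 + 1/x^2) * (‖z‖^2+x^2) := by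
  have h : (1 + 1/x^2) * (‖z‖^2+x^2) = 1 + ‖z‖^2 + (x^2 + ‖z‖^2/x^2) := by field_simp; ring
  rw [h]; have : 0 ≤ x^2 + ‖z‖^2/x^2 := by positivity
  linarith

lemma Q_pos {x : ℝ} (hx : x ≠ 0) (z : V) : 0 < ‖z‖^2+x^2 := by positivity

lemma Q_int {x b : ℝ} (hx : x ≠ 0) (hb : (Module.finrank ℝ V : ℝ) < 2*b) : Integrable (fun z : V => (‖z‖^2+x^2) ^ (-b)) := by
  have hb0 : 0 < b := by have : (0:ℝ) ≤ Module.finrank ℝ V := by positivity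
                         linarith
  have h := (integrable_rpow_neg_one_add_norm_sq (E := V) (μ := volume) hb).const_mul ((1+1/x^2)^b)
  refine h.mono' ?_ (ae_of_all _ fun z => ?_)
  · apply Measurable.aestronglyMeasurable; fun_prop
  · have hq := Q_pos hx z
    rw [Real.norm_eq_abs, abs_of_nonneg (by positivity), show -(2*b)/2 = -b by ring, Real.rpow_neg hq.le, Real.rpow_neg (by positivity), ← div_eq_mul_inv, le_div_iff₀ (by positivity), inv_mul_le_iff₀ (by positivity), ← Real.mul_rpow (by positivity) (by positivity), mul_comm (‖z‖^2+x^2)]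
    exact Real.rpow_le_rpow (by positivity) (Q_le hx z) hb0.le

lemma wQ_int {x b : ℝ} (hx : x ≠ 0) (hb : (Module.finrank ℝ V : ℝ) < 2*b) {w : V → ℂ} (hw : Continuous w) {C : ℝ} (hC : ∀ z, ‖w z‖ ≤ C * (1 + ‖z‖^2)) :
    Integrable (fun z : V => w z * (((‖z‖^2+x^2) ^ (-(b+1)) : ℝ):ℂ)) := by
  have hC0 : 0 ≤ C := by
    have := (norm_nonneg _).trans (hC 0); simpa using this
  refine ((Q_int (V := V) hx hb).const_mul (C*(1+1/x^2))).mono' ?_ (ae_of_all _ fun z => ?_)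
  · refine hw.aestronglyMeasurable.mul ?_
    apply Measurable.aestronglyMeasurable; fun_prop
  · have hq := Q_pos hx z
    rw [norm_mul, Complex.norm_real, Real.norm_eq_abs, abs_of_nonneg (by positivity), show -(b+1) = -b - 1 by ring, Real.rpow_sub_one hq.ne']
    calc _ ≤ (C * (1+‖z‖^2)) * ((‖z‖^2+x^2)^(-b) / (‖z‖^2+x^2)) := by gcongr; exact hC z
      _ ≤ (C * ((1+1/x^2) * (‖z‖^2+x^2))) * ((‖z‖^2+x^2)^(-b) / (‖z‖^2+x^2)) := by gcongr; exact Q_le hx z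
      _ = _ := by field_simp

lemma subord {x b : ℝ} (hx : x ≠ 0) (hb : 0 < b) (ξ : V) {w : V → ℂ} (hw : Continuous w)
    (hi : Integrable (fun z : V => w z * (((‖z‖^2+x^2) ^ (-b) : ℝ):ℂ))) :
    ∫ z, (w z * cexp (-(((inner ℝ ξ z : ℝ) : ℂ) * I))) * (((‖z‖^2+x^2) ^ (-b) : ℝ):ℂ)
     = ((Real.Gamma b)⁻¹ : ℂ) * ∫ s in Set.Ioi (0:ℝ), ((s ^ (b-1) * Real.exp (-(s*x^2)) : ℝ):ℂ) * ∫ z, w z * gs s ξ z := by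
  have hG := (Real.Gamma_pos_of_pos hb).ne'
  have hk : ∀ (s : ℝ) (z : V), ((s ^ (b-1) * Real.exp (-(s*x^2)) : ℝ):ℂ) * (w z * gs s ξ z)
     = (w z * cexp (-(((inner ℝ ξ z : ℝ) : ℂ) * I))) * ((s ^ (b-1) * Real.exp (-((‖z‖^2+x^2)*s)) : ℝ):ℂ) := by
    intro s z
    rw [gs_eq, show -((‖z‖^2+x^2)*s) = -(s*x^2) + -s*‖z‖^2 by ring, Real.exp_add]
    push_cast; ring
  have hms : AEStronglyMeasurable (Function.uncurry fun (s : ℝ) (z : V) => (w z * cexp (-(((inner ℝ ξ z : ℝ) : ℂ) * I))) * ((s ^ (b-1) * Real.exp (-((‖z‖^2+x^2)*s)) : ℝ):ℂ)) ((volume.restrict (Set.Ioi 0)).prod volume) := by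
    have h1 := hw.measurable
    apply Measurable.aestronglyMeasurable
    unfold Function.uncurry
    fun_prop
  have hno : ∀ z : V, ‖cexp (-(((inner ℝ ξ z : ℝ) : ℂ) * I))‖ = 1 := by
    intro z
    rw [← neg_mul, ← Complex.ofReal_neg, Complex.norm_exp_ofReal_mul_I]
  have hInt2 : Integrable (Function.uncurry fun (s : ℝ) (z : V) => (w z * cexp (-(((inner ℝ ξ z : ℝ) : ℂ) * I))) * ((s ^ (b-1) * Real.exp (-((‖z‖^2+x^2)*s)) : ℝ):ℂ)) ((volume.restrict (Set.Ioi 0)).prod volume) := by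
    rw [integrable_prod_iff' hms]
    constructor
    · refine ae_of_all _ fun z => ?_
      simp only [Function.uncurry]
      exact ((integrable_rpow_exp (Q_pos hx z) hb).ofReal).const_mul _
    · refine (hi.norm.mul_const (Real.Gamma b)).congr (ae_of_all _ fun z => ?_)
      simp only [Function.uncurry, norm_mul, hno, mul_one]
      rw [integral_const_mul, mul_assoc]
      congr 1
      rw [Complex.norm_real, Real.norm_eq_abs, abs_of_nonneg (by have := Q_pos hx z; positivity), ← rpow_neg_subord (Q_pos hx z) hb]
      refine setIntegral_congr_fun measurableSet_Ioi fun s hs => ?_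
      have hs' : (0:ℝ) < s := hs
      simp only [Complex.norm_real]
      rw [Real.norm_eq_abs, abs_of_nonneg (by positivity)]
  have hsw := integral_integral_swap hInt2
  have e1 : ∀ s : ℝ, ((s ^ (b-1) * Real.exp (-(s*x^2)) : ℝ):ℂ) * ∫ z, w z * gs s ξ z = ∫ z, (w z * cexp (-(((inner ℝ ξ z : ℝ) : ℂ) * I))) * ((s ^ (b-1) * Real.exp (-((‖z‖^2+x^2)*s)) : ℝ):ℂ) := by
    intro s; rw [← integral_const_mul]; congr 1; ext1 z; rw [hk]
  simp only [e1]
  rw [hsw, ← integral_const_mul]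
  congr 1; ext1 z
  rw [integral_const_mul, integral_complex_ofReal, rpow_neg_subord (Q_pos hx z) hb]
  have : (Real.Gamma b : ℂ) ≠ 0 := by exact_mod_cast hG
  push_cast
  field_simp

lemma pis {s b d : ℝ} (hs : 0 < s) (x k : ℝ) : (s ^ (b-1) * Real.exp (-(s*x^2))) * ((Real.pi/s) ^ d * Real.exp (-(k^2/(4*s))))
    = Real.pi ^ d * (s ^ (b-d-1) * Real.exp (-(s*x^2) - k^2/(4*s))) := by
  rw [Real.div_rpow Real.pi_pos.le hs.le, show b-d-1 = b-1-d by ring, Real.rpow_sub hs (b-1) d, sub_eq_add_neg (-(s*x^2)), Real.exp_add]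
  ring

lemma I0 {x b θ : ℝ} (hx : x ≠ 0) (hb : (Module.finrank ℝ V : ℝ) < 2*b) (hθ : θ = b - (Module.finrank ℝ V : ℝ)/2) (ξ : V) :
    ∫ z, cexp (-(((inner ℝ ξ z : ℝ) : ℂ) * I)) * (((‖z‖^2+x^2) ^ (-b) : ℝ):ℂ)
      = ((Real.pi ^ ((Module.finrank ℝ V : ℝ)/2) / Real.Gamma b * JJ θ x ‖ξ‖ : ℝ) : ℂ) := by
  have hb0 : 0 < b := by have : (0:ℝ) ≤ Module.finrank ℝ V := by positivity
                         linarith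
  have h := subord hx hb0 ξ (w := fun _ => 1) continuous_const (by simp only [one_mul]; exact (Q_int (V := V) hx hb).ofReal)
  simp only [one_mul, gs_integral] at h
  rw [h]
  have : ∫ s in Set.Ioi (0:ℝ), ((s ^ (b-1) * Real.exp (-(s*x^2)) : ℝ):ℂ) * ∫ z, gs s ξ z = ((Real.pi ^ ((Module.finrank ℝ V : ℝ)/2) * JJ θ x ‖ξ‖ : ℝ) : ℂ) := by
    rw [JJ, ← integral_const_mul, ← integral_complex_ofReal]
    refine setIntegral_congr_fun measurableSet_Ioi fun s hs => ?_
    try simp only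
    rw [gs_integral hs, ← Complex.ofReal_mul, pis hs, hθ]
  rw [this]; push_cast; ring

lemma I1 {x b θ : ℝ} (hx : x ≠ 0) (hb : (Module.finrank ℝ V : ℝ) < 2*b) (hθ : θ = b - (Module.finrank ℝ V : ℝ)/2) (ξ e : V) :
    ∫ z, (((inner ℝ e z : ℝ):ℂ) * cexp (-(((inner ℝ ξ z : ℝ) : ℂ) * I))) * (((‖z‖^2+x^2) ^ (-(b+1)) : ℝ):ℂ)
      = ((Real.pi ^ ((Module.finrank ℝ V : ℝ)/2) / Real.Gamma (b+1) * JJ θ x ‖ξ‖ : ℝ) : ℂ) * (-I * ((inner ℝ e ξ : ℝ):ℂ)/2) := by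
  have hb0 : 0 < b := by have : (0:ℝ) ≤ Module.finrank ℝ V := by positivity
                         linarith
  have h := subord hx (by linarith : 0 < b+1) ξ (cont_inC e) (wQ_int hx hb (cont_inC e) (abs_inner_le e))
  rw [h]
  have : ∫ s in Set.Ioi (0:ℝ), ((s ^ (b+1-1) * Real.exp (-(s*x^2)) : ℝ):ℂ) * ∫ z, ((inner ℝ e z : ℝ):ℂ) * gs s ξ z = ((Real.pi ^ ((Module.finrank ℝ V : ℝ)/2) * JJ θ x ‖ξ‖ : ℝ) : ℂ) * (-I * ((inner ℝ e ξ : ℝ):ℂ)/2) := by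
    rw [JJ, ← integral_const_mul, ← integral_complex_ofReal, ← integral_mul_const]
    refine setIntegral_congr_fun measurableSet_Ioi fun s hs => ?_
    have hs' : (0:ℝ) < s := hs
    have hs'' : (s:ℂ) ≠ 0 := by exact_mod_cast hs'.ne'
    try simp only
    rw [mom1 hs', gs_integral hs, hθ, ← pis hs, add_sub_cancel_right, Real.rpow_sub_one hs'.ne']
    push_cast
    field_simp
  rw [this]; push_cast; ring

lemma I2 {x b θ : ℝ} (hx : x ≠ 0) (hb : (Module.finrank ℝ V : ℝ) < 2*b) (hθ : θ = b - (Module.finrank ℝ V : ℝ)/2) (ξ e e' : V) (hξ : ξ ≠ 0) :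
    ∫ z, (((inner ℝ e z : ℝ):ℂ) * ((inner ℝ e' z : ℝ):ℂ) * cexp (-(((inner ℝ ξ z : ℝ) : ℂ) * I))) * (((‖z‖^2+x^2) ^ (-(b+1)) : ℝ):ℂ)
      = ((Real.pi ^ ((Module.finrank ℝ V : ℝ)/2) / Real.Gamma (b+1) * 
         (inner ℝ e e' / 2 * JJ θ x ‖ξ‖ - inner ℝ e ξ * inner ℝ e' ξ / 4 * JJ (θ-1) x ‖ξ‖) : ℝ) : ℂ) := by
  have hb0 : 0 < b := by have : (0:ℝ) ≤ Module.finrank ℝ V := by positivity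
                         linarith
  have hθ0 : 0 < θ := by linarith
  have h := subord hx (by linarith : 0 < b+1) ξ (w := fun z => ((inner ℝ e z : ℝ):ℂ) * ((inner ℝ e' z : ℝ):ℂ)) ((cont_inC e).mul (cont_inC e')) (wQ_int hx hb ((cont_inC e).mul (cont_inC e')) (abs_inner2_le e e'))
  rw [h]
  have : ∫ s in Set.Ioi (0:ℝ), ((s ^ (b+1-1) * Real.exp (-(s*x^2)) : ℝ):ℂ) * ∫ z, ((inner ℝ e z : ℝ):ℂ) * ((inner ℝ e' z : ℝ):ℂ) * gs s ξ z = ((Real.pi ^ ((Module.finrank ℝ V : ℝ)/2) *  (inner ℝ e e' / 2 * JJ θ x ‖ξ‖ - inner ℝ e ξ * inner ℝ e' ξ / 4 * JJ (θ-1) x ‖ξ‖) : ℝ) : ℂ) := by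
    rw [JJ, JJ, ← integral_const_mul, ← integral_const_mul, ← integral_sub ((JJ_int hθ0 hx _).const_mul _) ((JJ_int' hθ0 hx (norm_ne_zero_iff.2 hξ)).const_mul _), ← integral_const_mul, ← integral_complex_ofReal]
    refine setIntegral_congr_fun measurableSet_Ioi fun s hs => ?_
    have hs' : (0:ℝ) < s := hs
    have hs'' : (s:ℂ) ≠ 0 := by exact_mod_cast hs'.ne'
    try simp only
    rw [mom2 hs', gs_integral hs]
    have h1 := pis (b := b) (d := (Module.finrank ℝ V : ℝ)/2) hs' x ‖ξ‖
    rw [← hθ] at h1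
    rw [Real.rpow_sub_one hs'.ne' (θ-1)]
    have h2 : Real.pi ^ ((Module.finrank ℝ V : ℝ)/2) * (inner ℝ e e' / 2 * (s ^ (θ-1) * Real.exp (-(s*x^2) - ‖ξ‖^2/(4*s)))
        - inner ℝ e ξ * inner ℝ e' ξ / 4 * (s ^ (θ-1) / s * Real.exp (-(s*x^2) - ‖ξ‖^2/(4*s))))
      = (inner ℝ e e' / 2 - inner ℝ e ξ * inner ℝ e' ξ / (4 * s)) * (Real.pi ^ ((Module.finrank ℝ V : ℝ)/2) * (s ^ (θ-1) * Real.exp (-(s*x^2) - ‖ξ‖^2/(4*s)))) := by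
      field_simp
    rw [h2, ← h1, add_sub_cancel_right, Real.rpow_sub_one hs'.ne' b]
    push_cast
    field_simp
  rw [this]; push_cast; ring
end GaussM
end

section
variable {n m : ℕ}

lemma JJ_abs (θ k x : ℝ) : JJ θ k |x| = JJ θ k x := by simp [JJ]

lemma real_inner1 (a b : ℝ) : (inner ℝ a b : ℝ) = b * a := by simp [mul_comm]

lemma expo_eq (x t : ℝ) : cexp (-(((inner ℝ (-x) t : ℝ) : ℂ) * I)) = cexp (((x*t:ℝ):ℂ) * I) := by
  rw [real_inner1]; push_cast; ring_nf

lemma F0_int {μ k : ℝ} (hμ : 1 < μ) (hk : 0 < k) (x : ℝ) :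
    ∫ t : ℝ, cexp (((x*t:ℝ):ℂ) * I) * (((k^2+t^2) ^ (-(μ/2)) : ℝ):ℂ)
      = ((Real.sqrt Real.pi / Real.Gamma (μ/2) * JJ ((μ-1)/2) k x : ℝ):ℂ) := by
  have h := I0 (V := ℝ) (x := k) (b := μ/2) (θ := (μ-1)/2) hk.ne' (by simp; linarith) (by simp; ring) (-x)
  simp only [expo_eq, Module.finrank_self, norm_neg, Real.norm_eq_abs, JJ_abs, sq_abs] at h
  rw [Real.sqrt_eq_rpow]
  simp only [add_comm (k^2)]
  rw [h]; norm_num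

lemma F1_int {μ k : ℝ} (hμ : 1 < μ) (hk : 0 < k) (x : ℝ) :
    ∫ t : ℝ, cexp (((x*t:ℝ):ℂ) * I) * ((t * (k^2+t^2) ^ (-(μ/2)-1) : ℝ):ℂ)
      = ((Real.sqrt Real.pi / Real.Gamma (μ/2) * JJ ((μ-1)/2) k x / μ : ℝ):ℂ) * (I * x) := by
  have h := I1 (V := ℝ) (x := k) (b := μ/2) (θ := (μ-1)/2) hk.ne' (by simp; linarith) (by simp; ring) (-x) 1
  have hG := (Real.Gamma_pos_of_pos (show 0 < μ/2 by linarith)).ne'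
  simp only [expo_eq, Module.finrank_self, norm_neg, Real.norm_eq_abs, JJ_abs, sq_abs] at h
  rw [Real.Gamma_add_one (by linarith)] at h
  simp only [real_inner1, mul_one] at h
  rw [Real.sqrt_eq_rpow]
  rw [show ((1:ℕ):ℝ)/2 = 1/2 by norm_num] at h
  calc _ = _ := by
        congr 1; ext1 t; rw [show -(μ/2)-1 = -(μ/2+1) by ring, add_comm (k^2)]; push_cast; ring
    _ = _ := h
    _ = _ := by
      have h1 : (Real.Gamma (μ/2):ℂ) ≠ 0 := by exact_mod_cast hG
      have h2 : (μ:ℂ) ≠ 0 := by exact_mod_cast (by linarith : μ ≠ 0)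
      push_cast; field_simp

lemma F2_int {μ k x : ℝ} (hμ : 1 < μ) (hk : 0 < k) (hx : x ≠ 0) :
    ∫ t : ℝ, cexp (((x*t:ℝ):ℂ) * I) * ((t^2 * (k^2+t^2) ^ (-(μ/2)-1) : ℝ):ℂ)
      = ((Real.sqrt Real.pi / Real.Gamma (μ/2) / μ * (JJ ((μ-1)/2) k x - x^2/2 * JJ ((μ-1)/2-1) k x) : ℝ):ℂ) := by
  have h := I2 (V := ℝ) (x := k) (b := μ/2) (θ := (μ-1)/2) hk.ne' (by simp; linarith) (by simp; ring) (-x) 1 1 (by simpa using hx)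
  have hG := (Real.Gamma_pos_of_pos (show 0 < μ/2 by linarith)).ne'
  simp only [expo_eq, Module.finrank_self, norm_neg, Real.norm_eq_abs, JJ_abs, sq_abs] at h
  rw [Real.Gamma_add_one (by linarith)] at h
  simp only [real_inner1, mul_one] at h
  rw [Real.sqrt_eq_rpow]
  rw [show ((1:ℕ):ℝ)/2 = 1/2 by norm_num] at h
  calc _ = _ := by
        congr 1; ext1 t; rw [show -(μ/2)-1 = -(μ/2+1) by ring, add_comm (k^2)]; push_cast; ring
    _ = _ := h
    _ = _ := by
      congr 1
      have : μ ≠ 0 := by linarith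
      field_simp; ring

lemma cexp_norm (r : ℝ) : ‖cexp ((r:ℂ) * I)‖ = 1 := Complex.norm_exp_ofReal_mul_I r

lemma expI_int {f : ℝ → ℝ} (hf : Integrable f) (x : ℝ) : Integrable (fun t : ℝ => cexp (((x*t:ℝ):ℂ) * I) * (f t : ℂ)) := by
  refine hf.norm.mono' ?_ (ae_of_all _ fun t => ?_)
  · have : Continuous fun t : ℝ => cexp (((x*t:ℝ):ℂ) * I) := by fun_prop
    exact this.aestronglyMeasurable.mul hf.ofReal.aestronglyMeasurable
  · rw [norm_mul, cexp_norm, one_mul, Complex.norm_real]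

lemma t2_int {μ k : ℝ} (hμ : 1 < μ) (hk : 0 < k) : Integrable (fun t : ℝ => t^2 * (k^2+t^2) ^ (-(μ/2)-1)) := by
  refine (q_int (s := μ/2) (by linarith) hk).mono' ?_ (ae_of_all _ fun t => ?_)
  · apply Measurable.aestronglyMeasurable; fun_prop
  · have hq : 0 < k^2+t^2 := by positivity
    rw [Real.norm_eq_abs, abs_of_nonneg (by positivity), Real.rpow_sub_one hq.ne', mul_div_assoc', div_le_iff₀ hq]
    have := Real.rpow_pos_of_pos hq (-(μ/2))
    nlinarith [mul_pos this (pow_pos hk 2)]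

lemma C0_ft {μ M k x : ℝ} (hμ : 1 < μ) (hM : 0 < M) (hk : 0 < k) (hx : x ≠ 0) :
    ∫ t : ℝ, cexp (((x*t:ℝ):ℂ) * I) * ((C0 μ M k t : ℝ):ℂ)
      = ((Real.sqrt Real.pi / Real.Gamma (μ/2) * ((M+2*μ-2)/M * JJ ((μ-1)/2) k x + x^2 / M * JJ ((μ-1)/2-1) k x) : ℝ):ℂ) := by
  have e : ∀ t : ℝ, cexp (((x*t:ℝ):ℂ) * I) * ((C0 μ M k t : ℝ):ℂ) = ((1+2*μ/M : ℝ):ℂ) * (cexp (((x*t:ℝ):ℂ) * I) * (((k^2+t^2) ^ (-(μ/2)) : ℝ):ℂ))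
      - ((2*μ/M : ℝ):ℂ) * (cexp (((x*t:ℝ):ℂ) * I) * ((t^2 * (k^2+t^2) ^ (-(μ/2)-1) : ℝ):ℂ)) := by
    intro t
    have hq : 0 < k^2+t^2 := by positivity
    have : C0 μ M k t = (1+2*μ/M) * (k^2+t^2) ^ (-(μ/2)) - (2*μ/M) * (t^2 * (k^2+t^2) ^ (-(μ/2)-1)) := by
      unfold C0; rw [Real.rpow_sub_one hq.ne']; field_simp; ring
    rw [this]; push_cast; ring
  simp only [e]
  rw [integral_sub ((expI_int (q_int (s := μ/2) (by linarith) hk) x).const_mul _) ((expI_int (t2_int hμ hk) x).const_mul _), integral_const_mul, integral_const_mul, F0_int hμ hk, F2_int hμ hk hx,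
   ← Complex.ofReal_mul, ← Complex.ofReal_mul, ← Complex.ofReal_sub]
  congr 1
  have : μ ≠ 0 := by linarith
  have hG := (Real.Gamma_pos_of_pos (show 0 < μ/2 by linarith)).ne'
  field_simp; ring

lemma B0_ft {μ M k x : ℝ} (hμ : 1 < μ) (hM : 0 < M) (hk : 0 < k) :
    ∫ t : ℝ, cexp (((x*t:ℝ):ℂ) * I) * ((B0 μ M k t : ℝ):ℂ)
      = ((Real.sqrt Real.pi / Real.Gamma (μ/2) * (2/M * k * x * JJ ((μ-1)/2) k x) : ℝ):ℂ) * I := by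
  have e : ∀ t : ℝ, cexp (((x*t:ℝ):ℂ) * I) * ((B0 μ M k t : ℝ):ℂ) = ((2*μ/M*k : ℝ):ℂ) * (cexp (((x*t:ℝ):ℂ) * I) * ((t * (k^2+t^2) ^ (-(μ/2)-1) : ℝ):ℂ)) := by
    intro t; unfold B0; push_cast; ring
  simp only [e]
  rw [integral_const_mul, F1_int hμ hk]
  have : (μ:ℂ) ≠ 0 := by exact_mod_cast (by linarith : μ ≠ 0)
  push_cast; field_simp

lemma fib_ft {μ M k x : ℝ} (hμ : 1 < μ) (hM : 0 < M) (hk : 0 < k) (hx : x ≠ 0) (ω : Fin (m+1) → ℂ) (α γ : Lam (m+1)) :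
    ∫ t : ℝ, cexp (((x*t:ℝ):ℂ) * I) • Fib μ M k ω α γ t
     = ((Real.sqrt Real.pi / Real.Gamma (μ/2) * JJ ((μ-1)/2) k x : ℝ):ℂ) • α
      + ((Real.sqrt Real.pi / Real.Gamma (μ/2) * ((M+2*μ-2)/M * JJ ((μ-1)/2) k x + x^2 / M * JJ ((μ-1)/2-1) k x) : ℝ):ℂ) • eps ω γ
      + (((Real.sqrt Real.pi / Real.Gamma (μ/2) * (2/M * k * x * JJ ((μ-1)/2) k x) : ℝ):ℂ) * I) • eps (ee (Fin.last m)) γ := by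
  rw [← F0_int hμ hk, ← C0_ft hμ hM hk hx, ← B0_ft hμ hM hk, ← integral_smul_const, ← integral_smul_const, ← integral_smul_const]
  have i1 := (expI_int (q_int (s := μ/2) (by linarith) hk) x).smul_const α
  have i2 := (expI_int (C0_int (M := M) hk hμ) x).smul_const (eps ω γ)
  have i3 := (expI_int (B0_int (M := M) hk hμ) x).smul_const (eps (ee (Fin.last m)) γ)
  rw [← integral_add i1 i2]
  refine Eq.trans ?_ (integral_add (i1.add i2) i3)
  congr 1; ext1 t
  simp only [Fib, smul_add, smul_smul, Pi.add_apply]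

lemma eps_iot_normsq (x : Rn n) (w : Lam n) : ‖eps (rc x) w‖^2 + ‖iot (rc x) w‖^2 = ‖x‖^2 * ‖w‖^2 := by
  have h1 : inner ℂ (eps (rc x) w) (eps (rc x) w) = inner ℂ (iot (rc x) (eps (rc x) w)) w := inner_eps _ _ _
  have h2 : inner ℂ w (eps (rc x) (iot (rc x) w)) = inner ℂ (iot (rc x) w) (iot (rc x) w) := inner_eps _ _ _
  have h3 := congrArg (fun v => inner ℂ w v) (iot_eps (rc x) (rc x) w)
  simp only at h3
  rw [inner_add_right, h2, inner_smul_right, ← normsq_eq_inner, ← normsq_eq_inner] at h3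
  rw [← inner_conj_symm, ← h1, ← normsq_eq_inner, Complex.conj_ofReal] at h3
  have h4 : ∑ j, rc x j * rc x j = ((‖x‖^2 : ℝ):ℂ) := by
    rw [← sum_sq_eq]; simp [rc]
  rw [h4] at h3
  exact_mod_cast h3

lemma norm_eps_le' (x : Rn n) (w : Lam n) : ‖eps (rc x) w‖ ≤ ‖x‖ * ‖w‖ := by
  have := eps_iot_normsq x w
  refine abs_le_of_sq_le_sq' ?_ (by positivity) |>.2
  rw [mul_pow]; nlinarith [sq_nonneg ‖iot (rc x) w‖]
lemma norm_iot_le' (x : Rn n) (w : Lam n) : ‖iot (rc x) w‖ ≤ ‖x‖ * ‖w‖ := by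
  have := eps_iot_normsq x w
  refine abs_le_of_sq_le_sq' ?_ (by positivity) |>.2
  rw [mul_pow]; nlinarith [sq_nonneg ‖eps (rc x) w‖]

lemma norm_cmm_le (x : Rn n) (w : Lam n) : ‖cmm (rc x) w‖ ≤ 2 * ‖x‖^2 * ‖w‖ := by
  unfold cmm
  refine (norm_sub_le _ _).trans ?_
  have h1 := (norm_iot_le' x (eps (rc x) w)).trans (mul_le_mul_of_nonneg_left (norm_eps_le' x w) (norm_nonneg _))
  have h2 := (norm_eps_le' x (iot (rc x) w)).trans (mul_le_mul_of_nonneg_left (norm_iot_le' x w) (norm_nonneg _))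
  linarith

lemma cont_eps : Continuous (fun z : Rn n × Lam n => eps (rc z.1) z.2) := by
  have : (fun z : Rn n × Lam n => eps (rc z.1) z.2) = fun z => ∑ j, rc z.1 j • eps (ee j) z.2 := by
    ext1 z; exact eps_eq_sum _ _
  rw [this]
  refine continuous_finsetSum _ fun j _ => ?_
  have h1 : Continuous (fun z : Rn n × Lam n => rc z.1 j) := by simp only [rc]; fun_prop
  have h2 : Continuous (fun z : Rn n × Lam n => eps (ee j) z.2) :=
    (epsL (ee j)).continuous.comp continuous_snd
  exact h1.smul h2

lemma cont_cmm : Continuous (fun z : Rn n × Lam n => cmm (rc z.1) z.2) := by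
  unfold cmm
  refine Continuous.sub ?_ ?_
  · exact cont_iot.comp (continuous_fst.prodMk cont_eps)
  · exact cont_eps.comp (continuous_fst.prodMk cont_iot)
end

section
variable {n m : ℕ}

/-- coordinate basis vector -/
abbrev bs (j : Fin m) : Rn m := EuclideanSpace.single j 1

lemma inner_bs (j : Fin m) (z : Rn m) : (inner ℝ (bs j) z : ℝ) = z j := by
  simp [bs, inner_eq_sum, Pi.single_apply]

lemma inner_bs_bs (i j : Fin m) : (inner ℝ (bs i) (bs j) : ℝ) = if i = j then 1 else 0 := by
  rw [inner_bs]; simp [bs, Pi.single_apply]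

lemma cmm_ap (z : Rn m) (x : ℝ) (v : Lam (m+1)) (hv : iot (ee (Fin.last m)) v = 0) :
    cmm (rc (ap z x)) v = ((‖z‖^2+x^2 : ℝ):ℂ) • v
      - (∑ i : Fin m, ∑ j : Fin m, (2 * ((z i : ℂ) * (z j : ℂ))) • eps (ee i.castSucc) (iot (ee j.castSucc) v))
      - ∑ j : Fin m, (2 * (x * (z j:ℂ))) • eps (ee (Fin.last m)) (iot (ee j.castSucc) v) := by
  have h1 : iot (rc (ap z x)) v = ∑ j : Fin m, (z j : ℂ) • iot (ee j.castSucc) v := by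
    rw [iot_eq_sum, Fin.sum_univ_castSucc, hv, smul_zero, add_zero]
    refine Finset.sum_congr rfl fun j _ => ?_
    rw [show rc (ap z x) j.castSucc = (z j:ℂ) by simp only [rc, ap_castSucc]]
  have h2 : ∀ w, eps (rc (ap z x)) w = (∑ i : Fin m, (z i : ℂ) • eps (ee i.castSucc) w) + (x:ℂ) • eps (ee (Fin.last m)) w := by
    intro w
    rw [eps_eq_sum, Fin.sum_univ_castSucc]
    congr 1
    · refine Finset.sum_congr rfl fun j _ => ?_
      rw [show rc (ap z x) j.castSucc = (z j:ℂ) by simp only [rc, ap_castSucc]]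
    · rw [show rc (ap z x) (Fin.last m) = (x:ℂ) by simp only [rc, ap_last]]
  have h3 : ∀ (y : Fin (m+1) → ℂ), eps y (∑ j : Fin m, (z j : ℂ) • iot (ee j.castSucc) v) = ∑ j : Fin m, (z j : ℂ) • eps y (iot (ee j.castSucc) v) := by
    intro y
    have := map_sum (epsL y) (fun j : Fin m => (z j : ℂ) • iot (ee j.castSucc) v) univ
    simp only [map_smul, epsL_apply] at this
    exact this
  have h4 : ∑ j, rc (ap z x) j * rc (ap z x) j = ((‖z‖^2+x^2 : ℝ):ℂ) := by
    rw [← norm_ap_sq, ← sum_sq_eq]; simp [rc]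
  rw [cmm_eq, h4, h2, h1]
  simp only [h3]
  rw [smul_add, ← sub_sub]
  congr 1
  · congr 1
    rw [Finset.smul_sum]
    refine Finset.sum_congr rfl fun i _ => ?_
    rw [Finset.smul_sum, Finset.smul_sum]
    refine Finset.sum_congr rfl fun j _ => ?_
    rw [smul_smul, smul_smul]; congr 1; ring
  · rw [Finset.smul_sum, Finset.smul_sum]
    refine Finset.sum_congr rfl fun j _ => ?_
    rw [smul_smul, smul_smul]; congr 1; ring

/-- the kernel of the Poisson transform -/
def KK (β x : ℝ) (z : Rn m) (v : Lam (m+1)) : Lam (m+1) := (((‖z‖^2+x^2) ^ (-(β+1)) : ℝ):ℂ) • cmm (rc (ap z x)) v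

/-- phase -/
def ph (ξ z : Rn m) : ℂ := cexp (-(((inner ℝ ξ z : ℝ) : ℂ) * I))

lemma norm_ph (ξ z : Rn m) : ‖ph ξ z‖ = 1 := by
  unfold ph
  rw [← neg_mul, ← Complex.ofReal_neg, Complex.norm_exp_ofReal_mul_I]
lemma cont_ph (ξ : Rn m) : Continuous (ph ξ) := by unfold ph; fun_prop

lemma ph_int (ξ : Rn m) {f : Rn m → ℂ} (hf : Integrable f) : Integrable (fun z => ph ξ z * f z) := by
  refine hf.norm.mono' ((cont_ph ξ).aestronglyMeasurable.mul hf.aestronglyMeasurable) (ae_of_all _ fun z => ?_)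
  rw [norm_mul, norm_ph, one_mul]

lemma ker_ft {β ν x : ℝ} (hν : 0 < ν) (hβ : ν = β - (m:ℝ)/2) (hx : x ≠ 0) (ξ : Rn m) (hξ : ξ ≠ 0) {p : ℕ} (v : Lam (m+1))
    (hv : iot (ee (Fin.last m)) v = 0) (hp : IsForm p v) :
    ∫ z, ph ξ z • KK β x z v
     = ((Real.pi ^ ((m:ℝ)/2) / Real.Gamma (β+1) : ℝ):ℂ) • (
        (((β - p) * JJ ν x ‖ξ‖ : ℝ):ℂ) • v
        + ((‖ξ‖^2/2 * JJ (ν-1) x ‖ξ‖ : ℝ):ℂ) • eps (rc (om ξ)) (iot (rc (om ξ)) v)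
        + ((x * ‖ξ‖ * JJ ν x ‖ξ‖ : ℝ) * I) • eps (ee (Fin.last m)) (iot (rc (om ξ)) v)) := by
  have hfr : (Module.finrank ℝ (Rn m) : ℝ) = m := by rw [finrank_euclideanSpace_fin]
  have hb : (Module.finrank ℝ (Rn m) : ℝ) < 2*β := by rw [hfr]; linarith
  have hθ : ν = β - (Module.finrank ℝ (Rn m) : ℝ)/2 := by rw [hfr]; exact hβ
  have hβ0 : 0 < β := by have : (0:ℝ) ≤ m := by positivity
                         linarith
  have hk := norm_pos_iff.2 hξ
  set c : ℝ := Real.pi ^ ((m:ℝ)/2) / Real.Gamma (β+1) with hc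
  -- scalar integrals
  have s0 : ∫ z, ph ξ z * (((‖z‖^2+x^2) ^ (-β) : ℝ):ℂ) = ((c * β * JJ ν x ‖ξ‖ : ℝ):ℂ) := by
    have h := I0 hx hb hθ ξ
    rw [hfr] at h
    unfold ph; rw [h, hc, Real.Gamma_add_one hβ0.ne']
    have := (Real.Gamma_pos_of_pos hβ0).ne'
    congr 1; field_simp
  have s1 : ∀ j, ∫ z : Rn m, ph ξ z * ((2 * (x * (z j:ℂ))) * (((‖z‖^2+x^2) ^ (-(β+1)) : ℝ):ℂ)) = ((c * x * JJ ν x ‖ξ‖ : ℝ):ℂ) * (-I * (ξ j:ℂ)) := by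
    intro j
    have h := I1 hx hb hθ ξ (bs j)
    simp only [inner_bs] at h
    rw [hfr, ← hc] at h
    calc _ = ((2*x:ℝ):ℂ) * ∫ z : Rn m, ((z j:ℂ) * cexp (-(((inner ℝ ξ z : ℝ) : ℂ) * I))) * (((‖z‖^2+x^2) ^ (-(β+1)) : ℝ):ℂ) := by
          rw [← integral_const_mul]; congr 1; ext1 z; unfold ph; push_cast; ring
      _ = _ := by rw [h]; push_cast; ring
  have s2 : ∀ i j, ∫ z : Rn m, ph ξ z * ((2 * ((z i:ℂ) * (z j:ℂ))) * (((‖z‖^2+x^2) ^ (-(β+1)) : ℝ):ℂ))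
      = ((c * JJ ν x ‖ξ‖ : ℝ):ℂ) * (if i = j then 1 else 0) - ((c/2 * JJ (ν-1) x ‖ξ‖ : ℝ):ℂ) * ((ξ i:ℂ) * (ξ j:ℂ)) := by
    intro i j
    have h := I2 hx hb hθ ξ (bs i) (bs j) hξ
    simp only [inner_bs_bs] at h
    simp only [inner_bs] at h
    rw [hfr, ← hc] at h
    calc _ = 2 * ∫ z : Rn m, ((z i:ℂ) * (z j:ℂ) * cexp (-(((inner ℝ ξ z : ℝ) : ℂ) * I))) * (((‖z‖^2+x^2) ^ (-(β+1)) : ℝ):ℂ) := by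
          rw [← integral_const_mul]; congr 1; ext1 z; unfold ph; push_cast; ring
      _ = _ := by
        rw [h]
        split_ifs <;> (push_cast; ring)
  -- integrability
  have i0 : Integrable (fun z : Rn m => ph ξ z * (((‖z‖^2+x^2) ^ (-β) : ℝ):ℂ)) := ph_int ξ (Q_int hx hb).ofReal
  have i1 : ∀ j, Integrable (fun z : Rn m => ph ξ z * ((2 * (x * (z j:ℂ))) * (((‖z‖^2+x^2) ^ (-(β+1)) : ℝ):ℂ))) := by
    intro j
    have h := ((wQ_int hx hb (cont_inC (bs j)) (abs_inner_le (bs j))).const_mul (2*(x:ℂ)))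
    refine ph_int ξ (h.congr (ae_of_all _ fun z => ?_))
    simp only [inner_bs]; ring
  have i2 : ∀ i j, Integrable (fun z : Rn m => ph ξ z * ((2 * ((z i:ℂ) * (z j:ℂ))) * (((‖z‖^2+x^2) ^ (-(β+1)) : ℝ):ℂ))) := by
    intro i j
    have h := ((wQ_int hx hb (w := fun z => ((inner ℝ (bs i) z : ℝ):ℂ) * ((inner ℝ (bs j) z : ℝ):ℂ)) ((cont_inC (bs i)).mul (cont_inC (bs j))) (abs_inner2_le (bs i) (bs j))).const_mul 2)
    refine ph_int ξ (h.congr (ae_of_all _ fun z => ?_))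
    simp only [inner_bs]; ring
  have e : ∀ z : Rn m, ph ξ z • KK β x z v = 
      (ph ξ z * (((‖z‖^2+x^2) ^ (-β) : ℝ):ℂ)) • v
      - (∑ i : Fin m, ∑ j : Fin m, (ph ξ z * ((2 * ((z i:ℂ) * (z j:ℂ))) * (((‖z‖^2+x^2) ^ (-(β+1)) : ℝ):ℂ))) • eps (ee i.castSucc) (iot (ee j.castSucc) v))
      - ∑ j : Fin m, (ph ξ z * ((2 * (x * (z j:ℂ))) * (((‖z‖^2+x^2) ^ (-(β+1)) : ℝ):ℂ))) • eps (ee (Fin.last m)) (iot (ee j.castSucc) v) := by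
    intro z
    have hq : 0 < ‖z‖^2+x^2 := by positivity
    unfold KK
    rw [cmm_ap z x v hv, smul_sub, smul_sub, smul_sub, smul_sub]
    simp only [Finset.smul_sum, smul_smul]
    congr 1
    · congr 1
      · congr 1
        rw [show -(β+1) = -β - 1 by ring, Real.rpow_sub_one hq.ne', ← Complex.ofReal_mul, div_mul_cancel₀ _ hq.ne']
      · refine Finset.sum_congr rfl fun i _ => Finset.sum_congr rfl fun j _ => ?_
        congr 1; ring
    · refine Finset.sum_congr rfl fun j _ => ?_
      congr 1; ring
  have j2 : Integrable (fun z : Rn m => ∑ i : Fin m, ∑ j : Fin m, (ph ξ z * ((2 * ((z i:ℂ) * (z j:ℂ))) * (((‖z‖^2+x^2) ^ (-(β+1)) : ℝ):ℂ))) • eps (ee i.castSucc) (iot (ee j.castSucc) v)) :=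
    integrable_finset_sum _ fun i _ => integrable_finset_sum _ fun j _ => (i2 i j).smul_const _
  have j1 : Integrable (fun z : Rn m => ∑ j : Fin m, (ph ξ z * ((2 * (x * (z j:ℂ))) * (((‖z‖^2+x^2) ^ (-(β+1)) : ℝ):ℂ))) • eps (ee (Fin.last m)) (iot (ee j.castSucc) v)) :=
    integrable_finset_sum _ fun j _ => (i1 j).smul_const _
  have f2 : ∫ z, ∑ i : Fin m, ∑ j : Fin m, (ph ξ z * ((2 * ((z i:ℂ) * (z j:ℂ))) * (((‖z‖^2+x^2) ^ (-(β+1)) : ℝ):ℂ))) • eps (ee i.castSucc) (iot (ee j.castSucc) v)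
      = ∑ i : Fin m, ∑ j : Fin m, (((c * JJ ν x ‖ξ‖ : ℝ):ℂ) * (if i = j then 1 else 0) - ((c/2 * JJ (ν-1) x ‖ξ‖ : ℝ):ℂ) * ((ξ i:ℂ) * (ξ j:ℂ))) • eps (ee i.castSucc) (iot (ee j.castSucc) v) := by
    rw [integral_finset_sum _ fun i _ => integrable_finset_sum _ fun j _ => (i2 i j).smul_const _]
    refine Finset.sum_congr rfl fun i _ => ?_
    rw [integral_finset_sum _ fun j _ => (i2 i j).smul_const _]
    refine Finset.sum_congr rfl fun j _ => ?_
    rw [integral_smul_const, s2]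
  have f1 : ∫ z, ∑ j : Fin m, (ph ξ z * ((2 * (x * (z j:ℂ))) * (((‖z‖^2+x^2) ^ (-(β+1)) : ℝ):ℂ))) • eps (ee (Fin.last m)) (iot (ee j.castSucc) v)
     = ∑ j : Fin m, (((c * x * JJ ν x ‖ξ‖ : ℝ):ℂ) * (-I * (ξ j:ℂ))) • eps (ee (Fin.last m)) (iot (ee j.castSucc) v) := by
    rw [integral_finset_sum _ fun j _ => (i1 j).smul_const _]
    refine Finset.sum_congr rfl fun j _ => ?_
    rw [integral_smul_const, s1]
  simp only [e]
  have g0 : ∫ z, (ph ξ z * (((‖z‖^2+x^2) ^ (-β) : ℝ):ℂ)) • v = ((c * β * JJ ν x ‖ξ‖ : ℝ):ℂ) • v := by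
    rw [integral_smul_const, s0]
  have hom : ∀ j : Fin m, (ξ j : ℂ) = (‖ξ‖:ℂ) * rc (om ξ) j.castSucc := by
    intro j; simp only [rc, om_castSucc]; rw [← Complex.ofReal_mul, mul_inv_cancel_left₀ hk.ne']
  have t1 : ∑ j : Fin m, (ξ j : ℂ) • iot (ee j.castSucc) v = (‖ξ‖:ℂ) • iot (rc (om ξ)) v := by
    rw [iot_eq_sum (rc (om ξ)), Fin.sum_univ_castSucc, hv, smul_zero, add_zero, Finset.smul_sum]
    refine Finset.sum_congr rfl fun j _ => ?_
    rw [smul_smul, ← hom]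
  have t2 : ∀ w, ∑ j : Fin m, (ξ j : ℂ) • eps (ee j.castSucc) w = (‖ξ‖:ℂ) • eps (rc (om ξ)) w := by
    intro w
    rw [eps_eq_sum (rc (om ξ)), Fin.sum_univ_castSucc, show rc (om ξ) (Fin.last m) = 0 by simp [rc, om_last], zero_smul, add_zero, Finset.smul_sum]
    refine Finset.sum_congr rfl fun j _ => ?_
    rw [smul_smul, ← hom]
  have t3 : ∀ (y : Fin (m+1) → ℂ), ∑ j : Fin m, (ξ j : ℂ) • eps y (iot (ee j.castSucc) v) = (‖ξ‖:ℂ) • eps y (iot (rc (om ξ)) v) := by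
    intro y
    have := map_sum (epsL y) (fun j : Fin m => (ξ j : ℂ) • iot (ee j.castSucc) v) univ
    rw [t1] at this
    simp only [map_smul, epsL_apply] at this
    exact this.symm
  have t4 : ∑ i : Fin m, ∑ j : Fin m, ((ξ i:ℂ) * (ξ j:ℂ)) • eps (ee i.castSucc) (iot (ee j.castSucc) v) = ((‖ξ‖^2:ℝ):ℂ) • eps (rc (om ξ)) (iot (rc (om ξ)) v) := by
    simp only [mul_smul]
    simp only [← Finset.smul_sum, t3]
    have := t2 (iot (rc (om ξ)) v)
    rw [show ((‖ξ‖^2:ℝ):ℂ) = (‖ξ‖:ℂ) * (‖ξ‖:ℂ) by push_cast; ring, mul_smul, ← this, Finset.smul_sum]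
    refine Finset.sum_congr rfl fun j _ => ?_
    rw [smul_comm]
  have t5 : ∑ i : Fin m, eps (ee i.castSucc) (iot (ee i.castSucc) v) = (p:ℂ) • v := by
    have := sum_eps_iot v hp
    rw [Fin.sum_univ_castSucc, hv, eps_zero, add_zero] at this
    exact this
  have hf1 : ∑ j : Fin m, (((c * x * JJ ν x ‖ξ‖ : ℝ):ℂ) * (-I * (ξ j:ℂ))) • eps (ee (Fin.last m)) (iot (ee j.castSucc) v)
     = (((c * x * JJ ν x ‖ξ‖ : ℝ):ℂ) * -I) • ((‖ξ‖:ℂ) • eps (ee (Fin.last m)) (iot (rc (om ξ)) v)) := by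
    rw [← t3, Finset.smul_sum]
    refine Finset.sum_congr rfl fun j _ => ?_
    rw [smul_smul]; congr 1; ring
  have hf2 : ∑ i : Fin m, ∑ j : Fin m, (((c * JJ ν x ‖ξ‖ : ℝ):ℂ) * (if i = j then 1 else 0) - ((c/2 * JJ (ν-1) x ‖ξ‖ : ℝ):ℂ) * ((ξ i:ℂ) * (ξ j:ℂ))) • eps (ee i.castSucc) (iot (ee j.castSucc) v)
     = ((c * JJ ν x ‖ξ‖ : ℝ):ℂ) • ((p:ℂ) • v) - ((c/2 * JJ (ν-1) x ‖ξ‖ : ℝ):ℂ) • (((‖ξ‖^2:ℝ):ℂ) • eps (rc (om ξ)) (iot (rc (om ξ)) v)) := by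
    rw [← t4, ← t5]
    simp only [sub_smul, Finset.sum_sub_distrib, Finset.smul_sum, smul_smul]
    congr 1
    refine Finset.sum_congr rfl fun i _ => ?_
    rw [Finset.sum_eq_single i]
    · simp
    · intro j _ hj; rw [if_neg (Ne.symm hj)]; simp
    · simp
  have key : ∫ z, ((ph ξ z * (((‖z‖^2+x^2) ^ (-β) : ℝ):ℂ)) • v
      - (∑ i : Fin m, ∑ j : Fin m, (ph ξ z * ((2 * ((z i:ℂ) * (z j:ℂ))) * (((‖z‖^2+x^2) ^ (-(β+1)) : ℝ):ℂ))) • eps (ee i.castSucc) (iot (ee j.castSucc) v))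
      - ∑ j : Fin m, (ph ξ z * ((2 * (x * (z j:ℂ))) * (((‖z‖^2+x^2) ^ (-(β+1)) : ℝ):ℂ))) • eps (ee (Fin.last m)) (iot (ee j.castSucc) v))
     = (((c * β * JJ ν x ‖ξ‖ : ℝ):ℂ) • v) - (((c * JJ ν x ‖ξ‖ : ℝ):ℂ) • ((p:ℂ) • v) - ((c/2 * JJ (ν-1) x ‖ξ‖ : ℝ):ℂ) • (((‖ξ‖^2:ℝ):ℂ) • eps (rc (om ξ)) (iot (rc (om ξ)) v)))
       - (((c * x * JJ ν x ‖ξ‖ : ℝ):ℂ) * -I) • ((‖ξ‖:ℂ) • eps (ee (Fin.last m)) (iot (rc (om ξ)) v)) := by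
    rw [← g0, ← hf2, ← f2, ← hf1, ← f1]
    rw [← integral_sub (i0.smul_const v) j2]
    exact integral_sub ((i0.smul_const v).sub j2) j1
  rw [key]
  generalize eps (ee (Fin.last m)) (iot (rc (om ξ)) v) = B
  generalize eps (rc (om ξ)) (iot (rc (om ξ)) v) = A
  ext S
  simp only [PiLp.add_apply, PiLp.sub_apply, PiLp.smul_apply, smul_eq_mul]
  push_cast
  ring
end

section
variable {n m : ℕ}

/-- normalization -/
def kap (μ k : ℝ) : ℝ := (2*Real.pi) ^ ((1:ℝ)/2) / II μ * k ^ (μ-1)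

/-- tangential part -/
def alf (μ : ℝ) (ξ : Rn m) (w : Lam m) : Lam (m+1) :=
  ((kap μ ‖ξ‖ : ℝ):ℂ) • (inc w - eps (rc (om ξ)) (iot (rc (om ξ)) (inc w)))
/-- normal part -/
def gam (μ M : ℝ) (ξ : Rn m) (w : Lam m) : Lam (m+1) :=
  ((kap μ ‖ξ‖ * (M / (M+2*μ-2)) : ℝ):ℂ) • iot (rc (om ξ)) (inc w)

lemma kap_II {μ k : ℝ} (hμ : 1 < μ) (hk : 0 < k) : (2*Real.pi) ^ (-(1:ℝ)/2) * (II μ * k ^ (1-μ)) * kap μ k = 1 := by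
  unfold kap
  have h := II_pos hμ
  have h1 : (2*Real.pi) ^ (-(1:ℝ)/2) * (2*Real.pi) ^ ((1:ℝ)/2) = 1 := by
    rw [← Real.rpow_add (by positivity)]; norm_num
  have h2 : k ^ (1-μ) * k ^ (μ-1) = 1 := by
    rw [← Real.rpow_add hk]; simp
  have h3 : II μ * (II μ)⁻¹ = 1 := mul_inv_cancel₀ h.ne'
  rw [div_eq_mul_inv]
  calc _ = ((2*Real.pi) ^ (-(1:ℝ)/2) * (2*Real.pi) ^ ((1:ℝ)/2)) * (k ^ (1-μ) * k ^ (μ-1)) * (II μ * (II μ)⁻¹) := by ring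
    _ = 1 := by rw [h1, h2, h3]; norm_num

lemma kap_c {μ k : ℝ} (hμ : 1 < μ) : (2*Real.pi) ^ (-(1:ℝ)/2) * (Real.sqrt Real.pi / Real.Gamma (μ/2)) * kap μ k = k ^ (μ-1) / Real.Gamma ((μ-1)/2) := by
  unfold kap II
  have h1 : (2*Real.pi) ^ (-(1:ℝ)/2) * (2*Real.pi) ^ ((1:ℝ)/2) = 1 := by
    rw [← Real.rpow_add (by positivity)]; norm_num
  have g1 := (Real.Gamma_pos_of_pos (show 0 < (μ-1)/2 by linarith)).ne'
  have g2 := (Real.Gamma_pos_of_pos (show 0 < μ/2 by linarith)).ne'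
  have g3 : Real.sqrt Real.pi ≠ 0 := by positivity
  calc _ = ((2*Real.pi) ^ (-(1:ℝ)/2) * (2*Real.pi) ^ ((1:ℝ)/2)) * (Real.sqrt Real.pi / Real.Gamma (μ/2) / (Real.sqrt Real.pi * Real.Gamma ((μ-1)/2) / Real.Gamma (μ/2)) * k ^ (μ-1)) := by ring
    _ = _ := by rw [h1]; field_simp

lemma om_unit (ξ : Rn m) (hξ : ξ ≠ 0) : ∑ j, rc (om ξ) j * rc (om ξ) j = 1 := by
  have h := sum_om ξ hξ
  exact h

lemma iot_last_iot (ω : Fin (m+1) → ℂ) (w : Lam m) : iot (ee (Fin.last m)) (iot ω (inc w)) = 0 := by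
  rw [iot_iot, iot_last_inc, iot_zero, neg_zero]
lemma tang_gam (μ M : ℝ) (ξ : Rn m) (w : Lam m) : Tang (rc (om ξ)) (gam μ M ξ w) := by
  unfold Tang gam
  constructor
  · rw [iot_smul, iot_iot_self, smul_zero]
  · rw [iot_smul]
    rw [iot_last_iot, smul_zero]
lemma tang_alf (μ : ℝ) (ξ : Rn m) (hξ : ξ ≠ 0) (w : Lam m) : Tang (rc (om ξ)) (alf μ ξ w) := by
  unfold Tang alf
  have h1 := iot_eps (rc (om ξ)) (rc (om ξ)) (iot (rc (om ξ)) (inc w))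
  rw [iot_iot_self, eps_zero, om_unit ξ hξ, add_zero, one_smul] at h1
  have h2 := iot_eps (ee (Fin.last m)) (rc (om ξ)) (iot (rc (om ξ)) (inc w))
  have h3 : ∑ j, ee (Fin.last m) j * rc (om ξ) j = 0 := by
    simp [ee, rc, om_last]
  rw [iot_last_iot, eps_zero, h3, add_zero, zero_smul] at h2
  have hs : ∀ (y : Fin (m+1) → ℂ) (A B : Lam (m+1)), iot y (A - B) = iot y A - iot y B := fun y A B => (iotL y).map_sub A B
  constructor
  · rw [iot_smul, hs, h1, sub_self, smul_zero]
  · rw [iot_smul, hs, h2, iot_last_inc, sub_self, smul_zero]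
lemma trRel_ag {μ M : ℝ} (hμ : 1 < μ) (hM : 0 < M) (ξ : Rn m) (hξ : ξ ≠ 0) (w : Lam m) : TrRel μ M ξ (alf μ ξ w) (gam μ M ξ w) w := by
  have hk := norm_pos_iff.2 hξ
  unfold TrRel alf gam
  rw [eps_smul]
  have h := kap_II hμ hk
  generalize eps (rc (om ξ)) (iot (rc (om ξ)) (inc w)) = A
  generalize inc w = v
  set κ := kap μ ‖ξ‖
  set d := (2*Real.pi) ^ (-(1:ℝ)/2) * (II μ * ‖ξ‖ ^ (1-μ))
  have e : ((κ:ℝ):ℂ) • (v - A) + (((M+2*μ-2)/M:ℝ):ℂ) • (((κ * (M/(M+2*μ-2)):ℝ):ℂ) • A) = (κ:ℂ) • v := by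
    rw [smul_smul, ← Complex.ofReal_mul, show (M+2*μ-2)/M * (κ * (M/(M+2*μ-2))) = κ by
      have : M+2*μ-2 ≠ 0 := by linarith
      field_simp]
    rw [smul_sub, sub_add_cancel]
  rw [e, smul_smul, ← Complex.ofReal_mul, h]; simp

lemma fib_id {μ M a x : ℝ} {p : ℕ} (hμ : 1 < μ) (hM : 0 < M) (ha : μ = 2 - a) (hN : (m:ℝ)+1-2*p = M+μ) (hx : x ≠ 0)
    (ξ : Rn m) (hξ : ξ ≠ 0) (w : Lam m) (hw : IsForm p w) :
    ((cP (m+1) p a * |x| ^ (1-a) : ℝ):ℂ) • ∫ z, ph ξ z • KK (((m:ℝ)+1-a)/2) x z (inc w)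
     = (((2*Real.pi) ^ (-(1:ℝ)/2) : ℝ):ℂ) • ∫ t : ℝ, cexp (((x*t:ℝ):ℂ) * I) • Fib μ M ‖ξ‖ (rc (om ξ)) (alf μ ξ w) (gam μ M ξ w) t := by
  have hk := norm_pos_iff.2 hξ
  have hD : M+2*μ-2 ≠ 0 := by linarith
  set ν := (μ-1)/2 with hν
  have hν0 : 0 < ν := by rw [hν]; linarith
  set β := ((m:ℝ)+1-a)/2 with hβ
  have hβ1 : ν = β - (m:ℝ)/2 := by rw [hν, hβ, ha]; ring
  have hβ0 : 0 < β := by have : (0:ℝ) ≤ m := by positivity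
                         linarith
  rw [ker_ft hν0 hβ1 hx ξ hξ (inc w) (iot_last_inc w) (isForm_inc hw), fib_ft hμ hM hk hx]
  unfold alf gam
  rw [eps_smul, eps_smul]
  have hκ := kap_c (k := ‖ξ‖) hμ
  rw [← hν] at hκ
  rw [← hν]
  have e1 : |x| ^ (1-a) * JJ ν x ‖ξ‖ = ‖ξ‖ ^ (μ-1) * JJ ν ‖ξ‖ x := by
    rw [JJ_scale ν hx hk.ne', Real.div_rpow (by positivity) (by positivity), ← sq_abs x, ← Real.rpow_natCast |x|, ← Real.rpow_natCast ‖ξ‖,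
      ← Real.rpow_mul (abs_nonneg x), ← Real.rpow_mul hk.le, show ((2:ℕ):ℝ)*ν = μ - 1 by rw [hν]; push_cast; ring, show 1 - a = μ - 1 by rw [ha]; ring]
    have : 0 < |x| ^ (μ-1) := Real.rpow_pos_of_pos (abs_pos.2 hx) _
    field_simp
  have e2 : |x| ^ (1-a) * (‖ξ‖^2 * JJ (ν-1) x ‖ξ‖) = ‖ξ‖ ^ (μ-1) * (x^2 * JJ (ν-1) ‖ξ‖ x) := by
    rw [JJ_scale (ν-1) hx hk.ne', Real.rpow_sub_one (by positivity), Real.div_rpow (by positivity) (by positivity)]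
    have h1 : (‖ξ‖^2) ^ ν = ‖ξ‖ ^ (μ-1) := by
      rw [← Real.rpow_natCast ‖ξ‖, ← Real.rpow_mul hk.le, show ((2:ℕ):ℝ)*ν = μ - 1 by rw [hν]; push_cast; ring]
    have h2 : (x^2) ^ ν = |x| ^ (1-a) := by
      rw [← sq_abs x, ← Real.rpow_natCast |x|, ← Real.rpow_mul (abs_nonneg x), show ((2:ℕ):ℝ)*ν = μ - 1 by rw [hν]; push_cast; ring, show 1 - a = μ - 1 by rw [ha]; ring]
    rw [h1, h2]
    have : 0 < |x| ^ (1-a) := Real.rpow_pos_of_pos (abs_pos.2 hx) _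
    field_simp
  have e3 : cP (m+1) p a * (Real.pi ^ ((m:ℝ)/2) / Real.Gamma (β+1)) = 2 / ((M+2*μ-2) * Real.Gamma ν) := by
    unfold cP
    have q1 : (((m+1:ℕ):ℝ) - a + 2)/2 = β+1 := by rw [hβ]; push_cast; ring
    have q2 : (((m+1:ℕ):ℝ) - 1)/2 = (m:ℝ)/2 := by push_cast; ring
    have q3 : ((m+1:ℕ):ℝ) - 2*p - a = M+2*μ-2 := by push_cast; linarith
    have q4 : (1-a)/2 = ν := by rw [hν, ha]; ring
    rw [q1, q2, q3, q4]
    have g1 := (Real.Gamma_pos_of_pos hν0).ne'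
    have g2 := (Real.Gamma_pos_of_pos (show 0 < β+1 by linarith)).ne'
    have g3 : Real.pi ^ ((m:ℝ)/2) ≠ 0 := (Real.rpow_pos_of_pos Real.pi_pos _).ne'
    field_simp
  have hp : β - p = (M+2*μ-2)/2 := by rw [hβ]; linarith
  have g1 := (Real.Gamma_pos_of_pos hν0).ne'
  rw [hp]
  set c1 := Real.pi ^ ((m:ℝ)/2) / Real.Gamma (β+1)
  set P := cP (m+1) p a
  set X := |x| ^ (1-a)
  set J1 := JJ ν x ‖ξ‖
  set J2 := JJ (ν-1) x ‖ξ‖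
  set B1 := JJ ν ‖ξ‖ x
  set B2 := JJ (ν-1) ‖ξ‖ x
  set κ := kap μ ‖ξ‖
  set s := Real.sqrt Real.pi / Real.Gamma (μ/2)
  set d := (2*Real.pi) ^ (-(1:ℝ)/2)
  set K := ‖ξ‖ ^ (μ-1)
  set g := Real.Gamma ν
  set D := M+2*μ-2
  generalize eps (ee (Fin.last m)) (iot (rc (om ξ)) (inc w)) = Bv
  generalize eps (rc (om ξ)) (iot (rc (om ξ)) (inc w)) = Av
  generalize inc w = v
  -- three scalar identities
  have r1 : P * X * (c1 * (D/2*J1)) = d * (s * B1 * κ) := by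
    calc _ = (P*c1) * (D/2) * (X*J1) := by ring
      _ = K / g * B1 := by rw [e3, e1]; field_simp
      _ = d * s * κ * B1 := by rw [hκ]
      _ = _ := by ring
  have r2 : P * X * (c1 * (‖ξ‖^2/2*J2)) = d * (s * (D/M*B1 + x^2/M*B2) * (κ * (M/D)) - s*B1*κ) := by
    calc _ = (P*c1) * (1/2) * (X*(‖ξ‖^2*J2)) := by ring
      _ = K / g * (x^2*B2/D) := by rw [e3, e2]; field_simp
      _ = d * s * κ * (x^2*B2/D) := by rw [hκ]
      _ = _ := by field_simp; ring
  have r3 : P * X * (c1 * (x * ‖ξ‖ * J1)) = d * (s * (2/M*‖ξ‖*x*B1) * (κ * (M/D))) := by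
    calc _ = (P*c1) * (x*‖ξ‖) * (X*J1) := by ring
      _ = K / g * (2*x*‖ξ‖*B1/D) := by rw [e3, e1]; field_simp
      _ = d * s * κ * (2*x*‖ξ‖*B1/D) := by rw [hκ]
      _ = _ := by field_simp
  have r1' := congrArg (fun r : ℝ => (r:ℂ)) r1
  have r2' := congrArg (fun r : ℝ => (r:ℂ)) r2
  have r3' := congrArg (fun r : ℝ => (r:ℂ)) r3
  simp only [Complex.ofReal_mul, Complex.ofReal_sub] at r1' r2' r3'
  ext S
  simp only [PiLp.add_apply, PiLp.sub_apply, PiLp.smul_apply, smul_eq_mul, Complex.ofReal_mul]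
  linear_combination (v S) * r1' + (Av S) * r2' + (Bv S * I) * r3'
end

section
variable {n m : ℕ}

/-- normalized Fourier transform as a Schwartz function -/
def hS (ψ : SL n) : SL n := ((2 * Real.pi) ^ (-(n:ℝ)/2) : ℝ) • FS ψ

lemma ft_hS (ψ : SL n) : ft (fun y => ψ y) = fun x => hS ψ x := by
  ext1 x; rw [ft_eq_FS]; rfl

lemma hS_inv (ψ : SL n) (y : Rn n) : ftInv (fun y => hS ψ y) y = ψ y := by
  have h := ftInv_FS ψ y
  have e : ftInv (fun y => hS ψ y) y = ((2 * Real.pi) ^ (-(n:ℝ)/2) : ℝ) • ftInv (fun y => FS ψ y) y := by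
    unfold ftInv
    congr 1
    rw [← integral_smul]
    congr 1; ext1 x
    rw [smul_comm]; rfl
  rw [e, h, smul_smul, ← Real.rpow_add (by positivity)]
  rw [show -(n:ℝ)/2 + n/2 = 0 by ring]; simp

lemma isForm_ft {p : ℕ} (ψ : SL n) (h : ∀ y, IsForm p (ψ y)) (ξ : Rn n) : IsForm p (hS ψ ξ) := by
  intro S hS'
  have : hS ψ ξ = ((2 * Real.pi) ^ (-(n:ℝ)/2) : ℝ) • FS ψ ξ := rfl
  rw [this, FS_apply]
  have hi : Integrable (fun y => Complex.exp (-(((∑ j, y j * ξ j : ℝ) : ℂ) * Complex.I)) • ψ y) := by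
    refine ψ.integrable.norm.mono' ?_ (ae_of_all _ fun y => ?_)
    · have hc : Continuous (fun y : Rn n => Complex.exp (-(((∑ j, y j * ξ j : ℝ) : ℂ) * Complex.I))) := by fun_prop
      exact (hc.smul ψ.continuous).aestronglyMeasurable
    · rw [norm_smul, ← neg_mul, ← Complex.ofReal_neg, Complex.norm_exp_ofReal_mul_I, one_mul]
  have h2 := (EuclideanSpace.proj (𝕜 := ℂ) S : Lam n →L[ℂ] ℂ).integral_comp_comm hi
  simp only [PiLp.proj_apply] at h2
  rw [PiLp.smul_apply, ← h2]
  simp only [PiLp.smul_apply, h _ S hS', smul_zero, integral_zero]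

/-- positive phase -/
def pe (ξ z : Rn n) : ℂ := cexp (((∑ j, ξ j * z j : ℝ) : ℂ) * I)

lemma norm_pe (ξ z : Rn n) : ‖pe ξ z‖ = 1 := Complex.norm_exp_ofReal_mul_I _
lemma cont_pe : Continuous (fun z : Rn n × Rn n => pe z.1 z.2) := by unfold pe; fun_prop
lemma pe_sub (η x z : Rn m) : pe η (x - z) = pe η x * ph η z := by
  unfold pe ph
  rw [← inner_eq_sum, ← inner_eq_sum, inner_sub_right, ← Complex.exp_add]
  congr 1; push_cast; ring

/-- kernel as a linear map -/
def KL (β x : ℝ) (z : Rn m) : Lam (m+1) →L[ℂ] Lam (m+1) :=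
  (((‖z‖^2+x^2) ^ (-(β+1)) : ℝ):ℂ) • ((iotL (rc (ap z x))).comp (epsL (rc (ap z x))) - (epsL (rc (ap z x))).comp (iotL (rc (ap z x))))
lemma KL_apply (β x : ℝ) (z : Rn m) (v : Lam (m+1)) : KL β x z v = KK β x z v := rfl

lemma norm_KK {β x : ℝ} (hx : x ≠ 0) (z : Rn m) (v : Lam (m+1)) : ‖KK β x z v‖ ≤ 2 * (‖z‖^2+x^2) ^ (-β) * ‖v‖ := by
  have hq : 0 < ‖z‖^2+x^2 := by positivity
  unfold KK
  rw [norm_smul, Complex.norm_real, Real.norm_of_nonneg (by positivity)]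
  have h := norm_cmm_le (ap z x) v
  rw [norm_ap_sq] at h
  refine (mul_le_mul_of_nonneg_left h (by positivity)).trans (le_of_eq ?_)
  rw [show -(β+1) = -β - 1 by ring, Real.rpow_sub_one hq.ne']
  field_simp

lemma cont_KK {β x : ℝ} (hx : x ≠ 0) : Continuous (fun z : Rn m × Lam (m+1) => KK β x z.1 z.2) := by
  unfold KK
  have h1 : Continuous (fun z : Rn m × Lam (m+1) => (((‖z.1‖^2+x^2) ^ (-(β+1)) : ℝ):ℂ)) := by
    refine Complex.continuous_ofReal.comp (Continuous.rpow_const (by fun_prop) fun z => Or.inl ?_)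
    have : 0 < ‖z.1‖^2+x^2 := by positivity
    exact this.ne'
  have h : Continuous (fun z : Rn m × Lam (m+1) => (ap z.1 x, z.2)) :=
      (cont_ap.comp (continuous_fst.prodMk continuous_const)).prodMk continuous_snd
  have h2 : Continuous (fun z : Rn m × Lam (m+1) => cmm (rc (ap z.1 x)) z.2) := by
    have h3 := (cont_cmm (n := m+1)).comp h
    simp only [Function.comp_def] at h3
    exact h3
  exact h1.smul h2

lemma inc_cont : Continuous (inc : Lam m → Lam (m+1)) := (incC (m := m)).continuous

lemma conv_int {β x : ℝ} (hx : x ≠ 0) (hβ : (m:ℝ)/2 < β) (X : Rn m) (h : SL m) :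
    Integrable (fun z : Rn m × Rn m => pe z.2 z.1 • KK β x (X - z.1) (inc (h z.2))) (volume.prod volume) := by
  have hfr : (Module.finrank ℝ (Rn m) : ℝ) = m := by rw [finrank_euclideanSpace_fin]
  have hb : (Module.finrank ℝ (Rn m) : ℝ) < 2*β := by rw [hfr]; linarith
  have i1 : Integrable (fun y : Rn m => 2 * (‖X - y‖^2+x^2) ^ (-β)) := ((Q_int hx hb).comp_sub_left X).const_mul 2
  have i2 : Integrable (fun η : Rn m => ‖h η‖) := h.integrable.norm
  refine (i1.mul_prod i2).mono' (Continuous.aestronglyMeasurable ?_) (ae_of_all _ fun z => ?_)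
  · have e0 : Continuous (fun z : Rn m × Rn m => pe z.2 z.1) := cont_pe.comp continuous_swap
    have e : Continuous (fun z : Rn m × Rn m => (X - z.1, inc (h z.2))) :=
      (continuous_const.sub continuous_fst).prodMk (inc_cont.comp (h.continuous.comp continuous_snd))
    have e2 : Continuous (fun z : Rn m × Rn m => KK β x (X - z.1) (inc (h z.2))) := by
      have h3 := (cont_KK (m := m) (β := β) hx).comp e
      simp only [Function.comp_def] at h3
      exact h3
    exact e0.smul e2
  · rw [norm_smul, norm_pe, one_mul]
    have := norm_KK (β := β) hx (X - z.1) (inc (h z.2))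
    rwa [norm_inc] at this

lemma conv {β x : ℝ} (hx : x ≠ 0) (hβ : (m:ℝ)/2 < β) (X : Rn m) (f : SL m) :
    ∫ y, KK β x (X - y) (inc (f y)) = ((2 * Real.pi) ^ (-(m:ℝ)/2) : ℝ) • ∫ η, pe η X • ∫ z, ph η z • KK β x z (inc (hS f η)) := by
  have hi := conv_int hx hβ X (hS f)
  have e1 : ∀ y, KK β x (X - y) (inc (f y)) = ((2 * Real.pi) ^ (-(m:ℝ)/2) : ℝ) • ∫ η, pe η y • KK β x (X - y) (inc (hS f η)) := by
    intro y
    rw [← hS_inv f y]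
    unfold ftInv
    have hj : Integrable (fun η => pe η y • hS f η) := by
      refine (hS f).integrable.norm.mono' ?_ (ae_of_all _ fun y => ?_)
      · exact (Continuous.smul (cont_pe.comp (continuous_id.prodMk continuous_const)) (hS f).continuous).aestronglyMeasurable
      · rw [norm_smul, norm_pe, one_mul]
    have := ((KL β x (X-y)).comp (incC (m := m))).integral_comp_comm hj
    have e2 : KK β x (X-y) (inc (((2 * Real.pi) ^ (-(m:ℝ)/2) : ℝ) • ∫ η, pe η y • hS f η)) 
       = ((2 * Real.pi) ^ (-(m:ℝ)/2) : ℝ) • ((KL β x (X-y)).comp (incC (m := m))) (∫ η, pe η y • hS f η) := by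
      exact ContinuousLinearMap.map_smul_of_tower ((KL β x (X-y)).comp (incC (m := m))) _ _
    refine Eq.trans e2 ?_
    rw [← this]
    congr 1
    congr 1; ext1 η
    rw [map_smul]; rfl
  simp only [e1]
  rw [integral_smul, integral_integral_swap hi]
  congr 1; congr 1; ext1 η
  rw [← integral_sub_left_eq_self (fun y => pe η y • KK β x (X - y) (inc (hS f η))) volume X]
  rw [← integral_smul]
  congr 1; ext1 z
  rw [pe_sub, sub_sub_cancel, mul_smul]
end

section
variable {n m : ℕ}

/-- fiberwise model -/
def Gz (μ M : ℝ) (h : Rn m → Lam m) (z : Rn m × ℝ) : Lam (m+1) :=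
  Fib μ M ‖z.1‖ (rc (om z.1)) (alf μ z.1 (h z.1)) (gam μ M z.1 (h z.1)) z.2
/-- model solution on the Fourier side -/
def Gn (μ M : ℝ) (h : Rn m → Lam m) (ξ : Rn (m+1)) : Lam (m+1) := Gz μ M h (rs ξ, ξ (Fin.last m))
lemma Gn_ap (μ M : ℝ) (h : Rn m → Lam m) (x : Rn m) (t : ℝ) : Gn μ M h (ap x t) = Gz μ M h (x, t) := by
  unfold Gn; rw [rs_ap, ap_last]

/-- om as a Euclidean vector -/
def omE (x : Rn m) : Rn (m+1) := WithLp.toLp 2 (om x)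
lemma omE_rc (x : Rn m) : rc (omE x) = rc (om x) := rfl
lemma omE_norm (x : Rn m) (hx : x ≠ 0) : ‖omE x‖ = 1 := by
  have h := sum_om x hx
  have h2 : ∑ j, om x j * om x j = 1 := by
    have : ((∑ j, om x j * om x j : ℝ):ℂ) = 1 := by rw [← h]; push_cast; rfl
    exact_mod_cast this
  have h3 : ‖omE x‖^2 = 1 := by
    rw [EuclideanSpace.norm_sq_eq, ← h2]
    refine Finset.sum_congr rfl fun j _ => ?_
    rw [Real.norm_eq_abs, sq_abs, sq]; rfl
  have := norm_nonneg (omE x)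
  nlinarith

lemma meas_omE : Measurable (omE (m := m)) := by
  have h : Measurable (om (m := m)) := by
    refine measurable_pi_iff.2 fun j => ?_
    refine Fin.lastCases ?_ (fun i => ?_) j
    · simp only [om_last]; exact measurable_const
    · simp only [om_castSucc]
      have h1 : Measurable (fun x : Rn m => x i) := by
        have : Continuous (fun x : Rn m => x i) := by fun_prop
        exact this.measurable
      exact (measurable_norm.inv).mul h1
  exact (PiLp.continuous_toLp 2 _).measurable.comp h

lemma meas_eps {X : Type*} [MeasurableSpace X] {y : X → Rn n} {v : X → Lam n} (hy : Measurable y) (hv : Measurable v) :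
    Measurable (fun x => eps (rc (y x)) (v x)) := by
  have h := (cont_eps (n := n)).measurable.comp (hy.prodMk hv)
  simp only [Function.comp_def] at h
  exact h
lemma meas_iot {X : Type*} [MeasurableSpace X] {y : X → Rn n} {v : X → Lam n} (hy : Measurable y) (hv : Measurable v) :
    Measurable (fun x => iot (rc (y x)) (v x)) := by
  have h := (cont_iot (n := n)).measurable.comp (hy.prodMk hv)
  simp only [Function.comp_def] at h
  exact h

lemma mfst : Measurable (Prod.fst : Rn m × ℝ → Rn m) := measurable_fst

lemma meas_kap (μ : ℝ) : Measurable (fun x : Rn m => kap μ ‖x‖) := by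
  unfold kap; fun_prop

lemma meas_inc (h : SL m) : Measurable (fun x => inc (h x)) := by
  have := (inc_cont (m := m)).comp h.continuous
  simp only [Function.comp_def] at this
  exact this.measurable

lemma meas_alf (μ : ℝ) (h : SL m) : Measurable (fun x => alf μ x (h x)) := by
  unfold alf
  have h1 := meas_inc h
  have h2 := meas_iot meas_omE h1
  have h3 := meas_eps meas_omE h2
  exact (Complex.measurable_ofReal.comp (meas_kap μ)).smul (h1.sub h3)
lemma meas_gam (μ M : ℝ) (h : SL m) : Measurable (fun x => gam μ M x (h x)) := by
  unfold gam
  have h1 := meas_inc h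
  have h2 := meas_iot meas_omE h1
  exact (Complex.measurable_ofReal.comp ((meas_kap μ).mul_const _)).smul h2

lemma meas_Gz (μ M : ℝ) (h : SL m) : Measurable (Gz μ M (fun x => h x)) := by
  unfold Gz Fib
  have a1 := (meas_alf μ h).comp mfst
  have g1 := (meas_gam μ M h)
  have e1 := (meas_eps meas_omE g1).comp mfst
  have e2 : Measurable (fun x => eps (ee (Fin.last m)) (gam μ M x (h x))) := (epsL (ee (Fin.last m))).continuous.measurable.comp g1
  have e3 := e2.comp mfst
  simp only [Function.comp_def] at a1 e1 e3
  have s1 : Measurable (fun z : Rn m × ℝ => (((‖z.1‖^2+z.2^2) ^ (-(μ/2)) : ℝ) : ℂ)) := by fun_prop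
  have s2 : Measurable (fun z : Rn m × ℝ => ((C0 μ M ‖z.1‖ z.2 : ℝ) : ℂ)) := by unfold C0; fun_prop
  have s3 : Measurable (fun z : Rn m × ℝ => ((B0 μ M ‖z.1‖ z.2 : ℝ) : ℂ)) := by unfold B0; fun_prop
  exact ((s1.smul a1).add (s2.smul e1)).add (s3.smul e3)

lemma kap_nonneg {μ k : ℝ} (hμ : 1 < μ) (hk : 0 ≤ k) : 0 ≤ kap μ k := by
  unfold kap
  have := II_pos hμ
  positivity

lemma norm_Gz {μ M : ℝ} (hμ : 1 < μ) (hM : 0 < M) (h : Rn m → Lam m) (x : Rn m) (hx : x ≠ 0) (t : ℝ) :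
    ‖Gz μ M h (x, t)‖ ≤ (2 + (1 + 2*μ/M) + 2*μ/M) * (kap μ ‖x‖ * ‖h x‖) * (‖x‖^2+t^2) ^ (-(μ/2)) := by
  have hk := norm_pos_iff.2 hx
  have hκ := kap_nonneg hμ hk.le
  have hq : 0 < ‖x‖^2+t^2 := by positivity
  set q := ‖x‖^2+t^2 with hqd
  set Q := q ^ (-(μ/2)) with hQ
  have hQ0 : 0 < Q := Real.rpow_pos_of_pos hq _
  have hQ1 : q ^ (-(μ/2)-1) = Q / q := by rw [Real.rpow_sub_one hq.ne']
  set H := kap μ ‖x‖ * ‖h x‖ with hH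
  have hH0 : 0 ≤ H := by positivity
  have n1 : ∀ w, ‖eps (rc (om x)) w‖ ≤ ‖w‖ := fun w => by
    have := norm_eps_le' (omE x) w; rwa [omE_norm x hx, one_mul] at this
  have n2 : ∀ w, ‖iot (rc (om x)) w‖ ≤ ‖w‖ := fun w => by
    have := norm_iot_le' (omE x) w; rwa [omE_norm x hx, one_mul] at this
  have n3 : ∀ w : Lam (m+1), ‖eps (ee (Fin.last m)) w‖ ≤ ‖w‖ := fun w => by
    have := norm_eps_le' (bs (Fin.last m)) w
    have e : rc (bs (Fin.last m)) = ee (Fin.last m) := by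
      ext j; simp only [rc, bs, ee, EuclideanSpace.single_apply]; split_ifs <;> simp
    rw [e] at this
    simpa [bs] using this
  have hα : ‖alf μ x (h x)‖ ≤ 2 * H := by
    unfold alf
    rw [norm_smul, Complex.norm_real, Real.norm_of_nonneg hκ]
    have := (norm_sub_le (inc (h x)) (eps (rc (om x)) (iot (rc (om x)) (inc (h x))))).trans
      (add_le_add_right ((n1 _).trans (n2 _)) _)
    rw [norm_inc] at this
    have := mul_le_mul_of_nonneg_left this hκ
    rw [hH]; linarith
  have hγ : ‖gam μ M x (h x)‖ ≤ H := by
    unfold gam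
    have hD : 0 < M+2*μ-2 := by linarith
    have h1 : M/(M+2*μ-2) ≤ 1 := by rw [div_le_one hD]; linarith
    have h2 : 0 ≤ M/(M+2*μ-2) := by positivity
    rw [norm_smul, Complex.norm_real, Real.norm_of_nonneg (by positivity)]
    have h3 := n2 (inc (h x)); rw [norm_inc] at h3
    exact mul_le_mul (mul_le_of_le_one_right hκ h1) h3 (norm_nonneg _) hκ
  have hC : |C0 μ M ‖x‖ t| ≤ (1+2*μ/M) * Q := by
    unfold C0
    rw [← hqd, hQ1, ← hQ, abs_of_nonneg (by positivity)]
    have : ‖x‖^2 * (Q/q) ≤ Q := by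
      rw [mul_div_assoc', div_le_iff₀ hq]
      have : ‖x‖^2 ≤ q := by rw [hqd]; nlinarith [sq_nonneg t]
      nlinarith
    have := mul_le_mul_of_nonneg_left this (show 0 ≤ 2*μ/M by positivity)
    linarith
  have hB : |B0 μ M ‖x‖ t| ≤ (2*μ/M) * Q := by
    unfold B0
    rw [← hqd, hQ1, abs_mul, abs_mul, abs_mul, abs_of_nonneg (show 0 ≤ 2*μ/M by positivity), abs_of_nonneg hk.le, abs_of_nonneg (show 0 ≤ Q/q by positivity)]
    have : ‖x‖ * |t| * (Q/q) ≤ Q := by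
      rw [mul_div_assoc', div_le_iff₀ hq]
      have : ‖x‖ * |t| ≤ q := by rw [hqd, ← sq_abs t]; nlinarith [sq_nonneg (‖x‖ - |t|), abs_nonneg t]
      nlinarith
    have := mul_le_mul_of_nonneg_left this (show 0 ≤ 2*μ/M by positivity)
    linarith
  have e1 : ‖Gz μ M h (x, t)‖ ≤ Q * ‖alf μ x (h x)‖ + |C0 μ M ‖x‖ t| * ‖eps (rc (om x)) (gam μ M x (h x))‖ + |B0 μ M ‖x‖ t| * ‖eps (ee (Fin.last m)) (gam μ M x (h x))‖ := by
    unfold Gz Fib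
    refine (norm_add₃_le).trans (le_of_eq ?_)
    simp only [norm_smul, Complex.norm_real, Real.norm_eq_abs]
    rw [← hqd, ← hQ, abs_of_pos hQ0]
  have e2 := mul_le_mul_of_nonneg_left hα hQ0.le
  have e3 := mul_le_mul hC ((n1 _).trans hγ) (norm_nonneg _) (by positivity)
  have e4 := mul_le_mul hB ((n3 _).trans hγ) (norm_nonneg _) (by positivity)
  refine e1.trans ((add_le_add (add_le_add e2 e3) e4).trans (le_of_eq ?_))
  ring

lemma Gz_int {μ M : ℝ} (hμ : 1 < μ) (hM : 0 < M) (hm : m ≠ 0) (h : SL m) :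
    Integrable (Gz μ M (fun x => h x)) (volume.prod volume) := by
  have hb : Integrable (fun z : Rn m × ℝ => (2 + (1 + 2*μ/M) + 2*μ/M) * (kap μ ‖z.1‖ * ‖h z.1‖) * (‖z.1‖^2+z.2^2) ^ (-(μ/2))) (volume.prod volume) := by
    have hc : Continuous (fun x => h x) := h.continuous
    have hme : Measurable (fun z : Rn m × ℝ => (2 + (1 + 2*μ/M) + 2*μ/M) * (kap μ ‖z.1‖ * ‖h z.1‖) * (‖z.1‖^2+z.2^2) ^ (-(μ/2))) := by
      have h1 := (meas_kap (m := m) μ).comp mfst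
      have h2 := hc.norm.measurable.comp mfst
      simp only [Function.comp_def] at h1 h2
      exact ((h1.mul h2).const_mul _).mul (by fun_prop)
    rw [integrable_prod_iff hme.aestronglyMeasurable]
    constructor
    · filter_upwards [Hdot_ne hm] with x hx
      exact (q_int (s := μ/2) (by linarith) (norm_pos_iff.2 hx)).const_mul _
    · refine ((h.integrable.norm).const_mul ((2 + (1 + 2*μ/M) + 2*μ/M) * (2*Real.pi) ^ ((1:ℝ)/2))).congr ?_
      filter_upwards [Hdot_ne hm] with x hx
      have hk := norm_pos_iff.2 hx
      have hκ := kap_nonneg hμ hk.le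
      have e : ∀ t : ℝ, ‖(2 + (1 + 2*μ/M) + 2*μ/M) * (kap μ ‖x‖ * ‖h x‖) * (‖x‖^2+t^2) ^ (-(μ/2))‖ = (2 + (1 + 2*μ/M) + 2*μ/M) * (kap μ ‖x‖ * ‖h x‖) * (‖x‖^2+t^2) ^ (-(μ/2)) := by
        intro t
        rw [Real.norm_of_nonneg (by positivity)]
      simp only [e]
      rw [integral_const_mul, q_integral1 hμ hk]
      have h1 := kap_II hμ hk
      have h2 : (2*Real.pi) ^ ((1:ℝ)/2) * (2*Real.pi) ^ (-(1:ℝ)/2) = 1 := by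
        rw [← Real.rpow_add (by positivity)]; norm_num
      have h3 : II μ * ‖x‖ ^ (1-μ) * kap μ ‖x‖ = (2*Real.pi) ^ ((1:ℝ)/2) := by
        calc _ = ((2*Real.pi) ^ ((1:ℝ)/2) * (2*Real.pi) ^ (-(1:ℝ)/2)) * (II μ * ‖x‖ ^ (1-μ) * kap μ ‖x‖) := by rw [h2, one_mul]
          _ = (2*Real.pi) ^ ((1:ℝ)/2) * ((2*Real.pi) ^ (-(1:ℝ)/2) * (II μ * ‖x‖ ^ (1-μ)) * kap μ ‖x‖) := by ring
          _ = _ := by rw [h1, mul_one]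
      rw [← h3]; ring
  refine hb.mono' (meas_Gz μ M h).aestronglyMeasurable ?_
  have hne : ∀ᵐ z : Rn m × ℝ ∂(volume.prod volume), z.1 ≠ 0 :=
    Measure.quasiMeasurePreserving_fst.ae (Hdot_ne hm)
  filter_upwards [hne] with z hz
  exact norm_Gz hμ hM _ z.1 hz z.2

lemma Gn_int {μ M : ℝ} (hμ : 1 < μ) (hM : 0 < M) (hm : m ≠ 0) (h : SL m) : Integrable (Gn μ M (fun x => h x)) := by
  rw [← mp_ap.integrable_comp_emb me_ap]
  refine (Gz_int hμ hM hm h).congr (ae_of_all _ fun z => ?_)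
  simp only [Function.comp_def, Gn_ap]
end

section
variable {n m : ℕ}

lemma pe_int (X : Rn n) {E : Type*} [NormedAddCommGroup E] [NormedSpace ℂ E] {g : Rn n → E} (hg : Integrable g) : Integrable (fun ξ => pe ξ X • g ξ) := by
  have hc : Continuous (fun ξ : Rn n => pe ξ X) := by unfold pe; fun_prop
  refine hg.norm.mono' (hc.aestronglyMeasurable.smul hg.aestronglyMeasurable) (ae_of_all _ fun ξ => ?_)
  rw [norm_smul, norm_pe, one_mul]

lemma ftInv_pe (u : Rn n → Lam n) (X : Rn n) : ftInv u X = ((2 * Real.pi) ^ (-(n:ℝ)/2) : ℝ) • ∫ ξ, pe ξ X • u ξ := rfl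

lemma pe_ap (η : Rn m) (t : ℝ) (X : Rn (m+1)) : pe (ap η t) X = pe η (rs X) * cexp (((X (Fin.last m) * t : ℝ):ℂ) * I) := by
  unfold pe
  rw [← Complex.exp_add, Fin.sum_univ_castSucc, ap_last]
  simp only [ap_castSucc, rs_apply]
  congr 1; push_cast; ring

lemma pois_KK (a : ℝ) (p : ℕ) (f : Rn m → Lam m) (X : Rn (m+1)) :
    Pois (n := m+1) a p (Fin.last m) f X = (cP (m+1) p a * |X (Fin.last m)| ^ (1-a)) • ∫ y, KK (((m:ℝ)+1-a)/2) (X (Fin.last m)) (rs X - y) (inc (f y)) := by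
  unfold Pois
  rw [mul_smul]
  congr 1
  rw [← integral_smul]
  refine integral_congr_ae (ae_of_all _ fun (y : Rn m) => ?_)
  have e : X - app (n := m+1) y 0 = ap (rs X - y) (X (Fin.last m)) := by
    change X - ap y 0 = _
    ext j
    refine Fin.lastCases ?_ (fun i => ?_) j
    · rw [PiLp.sub_apply, ap_last, ap_last, sub_zero]
    · rw [PiLp.sub_apply, ap_castSucc, ap_castSucc, PiLp.sub_apply, rs_apply]
  have e2 : ‖X - app (n := m+1) y 0‖ ^ (-(((m+1:ℕ):ℝ) - a + 2)) = (‖rs X - y‖^2 + (X (Fin.last m))^2) ^ (-(((m:ℝ)+1-a)/2+1)) := by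
    rw [e, norm_ap_rpow]; congr 1; push_cast; ring
  have e3 : rc (X - app (n := m+1) y 0) = rc (ap (rs X - y) (X (Fin.last m))) := by rw [e]
  change (|X (Fin.last m)| ^ (1-a) * ‖X - app (n := m+1) y 0‖ ^ (-(((m+1:ℕ):ℝ) - a + 2))) • cmm (rc (X - app (n := m+1) y 0)) (inc (f y)) = _
  rw [e2, e3, mul_smul]
  unfold KK
  beta_reduce
  rw [Complex.coe_smul]

lemma pois_ftInv {μ M a : ℝ} {p : ℕ} (hμ : 1 < μ) (hM : 0 < M) (hm : m ≠ 0) (ha : μ = 2 - a) (hN : (m:ℝ)+1-2*p = M+μ)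
    (f : SL m) (hf : ∀ y, IsForm p (f y)) (X : Rn (m+1)) (hX : X (Fin.last m) ≠ 0) :
    Pois (n := m+1) a p (Fin.last m) (fun y => f y) X = ftInv (Gn μ M (fun x => hS f x)) X := by
  set x := X (Fin.last m) with hx
  have hG := Gn_int hμ hM hm (hS f)
  rw [pois_KK, conv hX (by linarith) (rs X) f, ftInv_pe, integral_ap _ (pe_int X hG), smul_comm, ← hx]
  have e : ((2 * Real.pi) ^ (-((m+1:ℕ):ℝ)/2) : ℝ) = (2 * Real.pi) ^ (-(m:ℝ)/2) * (2*Real.pi) ^ (-(1:ℝ)/2) := by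
    rw [← Real.rpow_add (by positivity)]; congr 1; push_cast; ring
  rw [e, mul_smul ((2 * Real.pi) ^ (-(m:ℝ)/2)) ((2*Real.pi) ^ (-(1:ℝ)/2))]
  congr 1
  rw [← integral_smul, ← integral_smul]
  refine integral_congr_ae ?_
  filter_upwards [Hdot_ne hm] with η hη
  have h := fib_id (x := x) hμ hM ha hN hX η hη (hS f η) (isForm_ft f hf η)
  rw [Complex.coe_smul, Complex.coe_smul] at h
  rw [smul_comm, h, smul_comm]
  congr 1
  rw [← integral_smul]
  congr 1; ext1 t
  rw [Gn_ap, pe_ap, mul_smul]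
  rfl

lemma scal_dual {u w : Rn n → ℂ} (hu : Integrable u) (hw : Integrable w) :
    ∫ X, (∫ ξ, pe ξ X * u ξ) * w X = ∫ ξ, u ξ * ∫ X, pe X ξ * w X := by
  have hi : Integrable (fun z : Rn n × Rn n => pe z.2 z.1 * (w z.1 * u z.2)) (volume.prod volume) := by
    have h := hw.mul_prod hu
    have hc : Continuous (fun z : Rn n × Rn n => pe z.2 z.1) := cont_pe.comp continuous_swap
    refine h.norm.mono' (hc.aestronglyMeasurable.mul h.aestronglyMeasurable) (ae_of_all _ fun z => ?_)
    rw [norm_mul, norm_pe, one_mul]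
  have h := integral_integral_swap (f := fun X ξ => pe ξ X * (w X * u ξ)) hi
  calc _ = ∫ X, ∫ ξ, pe ξ X * (w X * u ξ) := by
        congr 1; ext1 X; rw [← integral_mul_const]; congr 1; ext1 ξ; ring
    _ = _ := by
        rw [h]; congr 1; ext1 ξ; rw [← integral_const_mul]; congr 1; ext1 X
        have : pe X ξ = pe ξ X := by unfold pe; simp only [mul_comm]
        rw [this]; ring

lemma coordI {X : Type*} [MeasurableSpace X] {ν : Measure X} {g : X → Lam n} (hg : Integrable g ν) (S : Finset (Fin n)) : Integrable (fun x => g x S) ν := by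
  have := (EuclideanSpace.proj (𝕜 := ℂ) S : Lam n →L[ℂ] ℂ).integrable_comp hg
  simpa only [PiLp.proj_apply] using this

lemma ftInv_coord {u : Rn n → Lam n} (hu : Integrable u) (X : Rn n) (S : Finset (Fin n)) :
    ftInv u X S = (((2 * Real.pi) ^ (-(n:ℝ)/2) : ℝ):ℂ) * ∫ ξ, pe ξ X * u ξ S := by
  rw [ftInv_pe, PiLp.smul_apply]
  have h2 := (EuclideanSpace.proj (𝕜 := ℂ) S : Lam n →L[ℂ] ℂ).integral_comp_comm (pe_int X hu)
  simp only [PiLp.proj_apply, PiLp.smul_apply, smul_eq_mul] at h2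
  rw [← h2, Complex.real_smul]

lemma ftInv_bdd {u : Rn n → Lam n} (hu : Integrable u) : Continuous (ftInv u) ∧ ∃ C, ∀ X, ‖ftInv u X‖ ≤ C := by
  constructor
  · have : Continuous (fun X => ∫ ξ, pe ξ X • u ξ) := by
      refine continuous_of_dominated (bound := fun ξ => ‖u ξ‖) ?_ ?_ hu.norm ?_
      · exact fun X => (pe_int X hu).aestronglyMeasurable
      · exact fun X => ae_of_all _ fun ξ => by rw [norm_smul, norm_pe, one_mul]
      · refine ae_of_all _ fun ξ => ?_
        have hc : Continuous (fun X : Rn n => pe ξ X) := by unfold pe; fun_prop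
        exact hc.smul continuous_const
    exact this.const_smul ((2 * Real.pi) ^ (-(n:ℝ)/2) : ℝ)
  · refine ⟨((2 * Real.pi) ^ (-(n:ℝ)/2) : ℝ) * ∫ ξ, ‖u ξ‖, fun X => ?_⟩
    rw [ftInv_pe, norm_smul, Real.norm_of_nonneg (by positivity)]
    refine mul_le_mul_of_nonneg_left ((norm_integral_le_integral_norm _).trans (le_of_eq ?_)) (by positivity)
    congr 1; ext1 ξ; rw [norm_smul, norm_pe, one_mul]

lemma dual {u : Rn n → Lam n} (hu : Integrable u) (ψ : SL n) :
    ∫ X, blin (ftInv u X) (hS ψ X) = ∫ ξ, blin (u ξ) (ψ ξ) := by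
  obtain ⟨hc, C, hC⟩ := ftInv_bdd hu
  unfold blin
  have b1 : ∀ S, Integrable (fun X => ftInv u X S * hS ψ X S) := by
    intro S
    have h1 := coordI (ν := volume) (hS ψ).integrable S
    refine h1.bdd_mul (c := C) ?_ (ae_of_all _ fun X => (PiLp.norm_apply_le _ S).trans (hC X))
    have : Continuous (fun X => ftInv u X S) := by
      have := (EuclideanSpace.proj (𝕜 := ℂ) S : Lam n →L[ℂ] ℂ).continuous.comp hc
      exact this
    exact this.aestronglyMeasurable
  have b2 : ∀ S, Integrable (fun ξ => u ξ S * ψ ξ S) := by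
    intro S
    obtain ⟨D, hD⟩ := ψ.decay 0 0
    refine (coordI hu S).mul_bdd (c := D) ?_ (ae_of_all _ fun X => (PiLp.norm_apply_le _ S).trans ?_)
    · exact (coordI (ν := volume) ψ.integrable S).aestronglyMeasurable
    · have := hD.2 X; simpa using this
  rw [integral_finset_sum _ fun S _ => b1 S, integral_finset_sum _ fun S _ => b2 S]
  refine Finset.sum_congr rfl fun S _ => ?_
  have h := scal_dual (coordI hu S) (coordI (ν := volume) (hS ψ).integrable S)
  have e1 : ∀ ξ, ψ ξ S = (((2 * Real.pi) ^ (-(n:ℝ)/2) : ℝ):ℂ) * ∫ X, pe X ξ * hS ψ X S := by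
    intro ξ
    rw [← ftInv_coord (hS ψ).integrable, hS_inv]
  simp only [ftInv_coord hu, e1]
  calc _ = (((2 * Real.pi) ^ (-(n:ℝ)/2) : ℝ):ℂ) * ∫ X, (∫ ξ, pe ξ X * u ξ S) * hS ψ X S := by
        rw [← integral_const_mul]; congr 1; ext1 X; ring
    _ = _ := by
        rw [h, ← integral_const_mul]; congr 1; ext1 X; ring

lemma last_ne : ∀ᵐ X : Rn (m+1), X (Fin.last m) ≠ 0 := by
  have h : ∀ᵐ z : Rn m × ℝ ∂(volume.prod volume), z.2 ≠ 0 := by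
    refine Measure.quasiMeasurePreserving_snd.ae (μb := volume) (p := fun t : ℝ => t ≠ 0) ?_
    rw [ae_iff]; simp
  have h2 := mp_ap (m := m)
  rw [← h2.map_eq, me_ap.ae_map_iff]
  filter_upwards [h] with z hz
  rwa [ap_last]

lemma pois_dual {μ M a : ℝ} {p : ℕ} (hμ : 1 < μ) (hM : 0 < M) (hm : m ≠ 0) (ha : μ = 2 - a) (hN : (m:ℝ)+1-2*p = M+μ)
    (f : SL m) (hf : ∀ y, IsForm p (f y)) {G : Rn (m+1) → Lam (m+1)} (hFT : IsFTof G (Pois (n := m+1) a p (Fin.last m) (fun y => f y))) (ψ : SL (m+1)) :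
    ∫ ξ, blin (G ξ) (ψ ξ) = ∫ ξ, blin (Gn μ M (fun x => hS f x) ξ) (ψ ξ) := by
  rw [hFT ψ, ← dual (Gn_int hμ hM hm (hS f)) ψ, ft_hS]
  refine integral_congr_ae ?_
  filter_upwards [last_ne] with X hX
  rw [pois_ftInv hμ hM hm ha hN f hf X hX]

lemma G_eq {μ M a : ℝ} {p : ℕ} (hμ : 1 < μ) (hM : 0 < M) (hm : m ≠ 0) (ha : μ = 2 - a) (hN : (m:ℝ)+1-2*p = M+μ)
    (f : SL m) (hf : ∀ y, IsForm p (f y)) {G : Rn (m+1) → Lam (m+1)} (hG : G ∈ Hdot (m+1) (μ/2) p)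
    (hFT : IsFTof G (Pois (n := m+1) a p (Fin.last m) (fun y => f y))) :
    ∀ᵐ ξ, G ξ = Gn μ M (fun x => hS f x) ξ := by
  have hGn := Gn_int hμ hM hm (hS f)
  obtain ⟨h1, -, h3⟩ := hG
  -- local integrability of G away from the origin
  have hloc : ∀ K : Set (Rn (m+1)), K ⊆ {0}ᶜ → IsCompact K → IntegrableOn G K := by
    intro K hK0 hK
    have hcont : ContinuousOn (fun ξ : Rn (m+1) => ‖ξ‖ ^ (-μ)) K := by
      refine ContinuousOn.rpow_const continuous_norm.continuousOn fun ξ hξ => Or.inl ?_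
      exact norm_ne_zero_iff.2 (hK0 hξ)
    have hb := (h3.integrableOn (s := K)).add (hcont.integrableOn_compact hK)
    refine hb.mono' h1.restrict ?_
    filter_upwards [ae_restrict_mem hK.measurableSet] with ξ hξ
    have := norm_le_half (μ := μ) (norm_pos_iff.2 (hK0 hξ)) (norm_nonneg (G ξ))
    have e : 2*(μ/2) = μ := by ring
    simpa only [Pi.add_apply, e] using this
  have hS' : ∀ S, ∀ᵐ ξ, ξ ∈ ({0}ᶜ : Set (Rn (m+1))) → (G ξ S - Gn μ M (fun x => hS f x) ξ S) = 0 := by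
    intro S
    refine isOpen_compl_singleton.ae_eq_zero_of_integral_contDiff_smul_eq_zero ?_ ?_
    · rw [locallyIntegrableOn_iff isOpen_compl_singleton.isLocallyClosed]
      intro K hK0 hK
      exact (coordI (hloc K hK0 hK) S).sub ((coordI hGn S).integrableOn)
    · intro χ hχ hs h0
      have hψs : HasCompactSupport (fun ξ => ((χ ξ:ℂ) • (EuclideanSpace.single S (1:ℂ) : Lam (m+1)))) := by
        refine hs.mono' ?_
        refine subset_trans ?_ subset_closure
        intro ξ hξ hz
        exact hξ (by simp [show χ ξ = 0 from hz])
      have hψc : ContDiff ℝ (⊤:ℕ∞) (fun ξ => ((χ ξ:ℂ) • (EuclideanSpace.single S (1:ℂ) : Lam (m+1)))) := by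
        exact ((Complex.ofRealCLM.contDiff).comp hχ).smul contDiff_const
      have h := pois_dual hμ hM hm ha hN f hf hFT (hψs.toSchwartzMap hψc)
      have e : ∀ v ξ, blin v ((hψs.toSchwartzMap hψc) ξ) = χ ξ • v S := by
        intro v ξ
        change blin v ((χ ξ:ℂ) • (EuclideanSpace.single S (1:ℂ) : Lam (m+1))) = _
        unfold blin
        rw [Finset.sum_eq_single S]
        · simp [mul_comm]
        · intro T _ hT; simp [hT]
        · simp
      simp only [e] at h
      have hcG : Integrable (fun ξ => χ ξ • G ξ S) := by
        have hi : IntegrableOn (fun ξ => G ξ S) (tsupport χ) := coordI (hloc _ h0 hs) S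
        have h5 : IntegrableOn (fun ξ => χ ξ • G ξ S) (tsupport χ) := by
          have := hi.continuousOn_smul hχ.continuous.continuousOn hs
          exact this
        refine (integrableOn_iff_integrable_of_support_subset ?_).1 h5
        intro ξ hξ
        refine subset_closure fun hz => hξ ?_
        change χ ξ • G ξ S = 0
        rw [show χ ξ = 0 from hz, zero_smul]
      have hcN : Integrable (fun ξ => χ ξ • Gn μ M (fun x => hS f x) ξ S) := by
        exact (coordI hGn S).locallyIntegrable.integrable_smul_left_of_hasCompactSupport hχ.continuous hs
      simp only [smul_sub]
      rw [integral_sub hcG hcN, h, sub_self]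
  have hall := ae_all_iff.2 hS'
  filter_upwards [hall, Hdot_ne (n := m+1) (by omega)] with ξ hξ hne
  ext S
  exact sub_eq_zero.1 (hξ S hne)

theorem part1 {μ M a : ℝ} {p : ℕ} (hμ : 1 < μ) (hM : 0 < M) (hm : m ≠ 0) (ha : μ = 2 - a) (hN : (m:ℝ)+1-2*p = M+μ)
    (f : SL m) (hf : ∀ y, IsForm p (f y)) {G : Rn (m+1) → Lam (m+1)} (hG : G ∈ Hdot (m+1) (μ/2) p)
    (hFT : IsFTof G (Pois (n := m+1) a p (Fin.last m) (fun y => f y))) :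
    cSq ((M+μ)/2) (-(μ/2)) G
     = (2*Real.pi*(M+2*μ)/(II μ * (M+2*μ-2))) * cSq ((M+μ-1)/2) (-((μ-1)/2)) (ft (fun y => f y)) := by
  have h := G_eq hμ hM hm ha hN f hf hG hFT
  rw [← (mp_ap (m := m)).map_eq, me_ap.ae_map_iff] at h
  have h2 := Measure.ae_ae_of_ae_prod h
  refine assemble hμ hM hm G hG _ ?_
  filter_upwards [h2, Hdot_ne hm] with x hx hx0
  refine ⟨alf μ x (hS f x), gam μ M x (hS f x), tang_alf μ x hx0 _, tang_gam μ M x _, ?_, ?_⟩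
  · filter_upwards [hx] with t ht
    rw [ht, Gn_ap]; rfl
  · rw [ft_hS]; exact trRel_ag hμ hM x hx0 _
end

section
variable {n m : ℕ}

lemma const_match {μ A B : ℝ} (hμ : 1 < μ) :
    2*Real.pi*A/(II μ * B) = 2 * Real.sqrt Real.pi * A * Real.Gamma (μ/2) / (B * Real.Gamma ((μ-1)/2)) := by
  have h1 : Real.Gamma (μ/2) ≠ 0 := (Real.Gamma_pos_of_pos (by linarith)).ne'
  have h2 : Real.Gamma ((μ-1)/2) ≠ 0 := (Real.Gamma_pos_of_pos (by linarith)).ne'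
  have h3 : Real.sqrt Real.pi ≠ 0 := (Real.sqrt_pos.2 Real.pi_pos).ne'
  have h4 : Real.pi = Real.sqrt Real.pi * Real.sqrt Real.pi := (Real.mul_self_sqrt Real.pi_pos.le).symm
  rcases eq_or_ne B 0 with rfl | hB
  · simp
  unfold II
  nth_rewrite 1 [h4]
  field_simp
end

/-- isometry property of the Poisson transform:
‖P_{a,p}f‖²_{(2-a)/2,p} = [2√π (n-2p-a+2) Γ((2-a)/2) / ((n-2p-a) Γ((1-a)/2))] ‖f‖²_{(1-a)/2,p}
in the conformally invariant norms. Expressed on the Fourier side: first for Schwartz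
boundary data f and any distributional Fourier transform G of P_{a,p}f, then for
arbitrary boundary data h ∈ Ḣ^{(1-a)/2,p}(ℝ^{n-1}) and the corresponding solution
G = (P_{a,p}f)^ of the boundary value problem. -/
theorem stmt9 (n p : ℕ) (hn : 2 ≤ n) (hp : 2*p ≤ n)
    (a : ℝ) (ha1 : 2 - (n:ℝ) + 2*p < a) (ha2 : a < 1)
    (ℓ : Fin n) (hℓ : (ℓ : ℕ) = n - 1) :
    (∀ f : SchwartzMap (Rn (n-1)) (Lam (n-1)), (∀ y, IsForm p (f y)) →
      ∀ G ∈ Hdot n ((2-a)/2) p, IsFTof G (Pois a p ℓ (fun y => f y)) →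
        cSq ((n:ℝ)/2 - p) ((a-2)/2) G
          = (2 * Real.sqrt Real.pi * ((n:ℝ) - 2*p - a + 2) * Real.Gamma ((2-a)/2) /
              (((n:ℝ) - 2*p - a) * Real.Gamma ((1-a)/2))) *
            cSq (((n:ℝ)-1)/2 - p) ((a-1)/2) (ft (fun y => f y))) ∧
    (∀ h ∈ Hdot (n-1) ((1-a)/2) p, ∀ G ∈ Hdot n ((2-a)/2) p,
      WeakEig a p ℓ G 0 → (∀ᵐ ξ' : Rn (n-1), ftrace G ξ' = h ξ') →
        cSq ((n:ℝ)/2 - p) ((a-2)/2) G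
          = (2 * Real.sqrt Real.pi * ((n:ℝ) - 2*p - a + 2) * Real.Gamma ((2-a)/2) /
              (((n:ℝ) - 2*p - a) * Real.Gamma ((1-a)/2))) *
            cSq (((n:ℝ)-1)/2 - p) ((a-1)/2) h) := by
  obtain ⟨m, rfl⟩ : ∃ m, n = m + 1 := ⟨n - 1, by omega⟩
  obtain rfl : ℓ = Fin.last m := Fin.ext (by simpa using hℓ)
  have hm : m ≠ 0 := by omega
  obtain ⟨μ, hμa⟩ : ∃ μ : ℝ, μ = 2 - a := ⟨_, rfl⟩
  obtain ⟨M, hMa⟩ : ∃ M : ℝ, M = (m:ℝ) + 1 - 2*p - μ := ⟨_, rfl⟩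
  push_cast at ha1
  have hμ : 1 < μ := by linarith
  have hM : 0 < M := by linarith
  have hN : (m:ℝ)+1-2*p = M+μ := by linarith
  have e1 : ((m+1:ℕ):ℝ)/2 - p = (M+μ)/2 := by push_cast; linarith
  have e2 : (a-2)/2 = -(μ/2) := by linarith
  have e3 : (((m+1:ℕ):ℝ)-1)/2 - p = (M+μ-1)/2 := by push_cast; linarith
  have e4 : (a-1)/2 = -((μ-1)/2) := by linarith
  have e5 : ((m+1:ℕ):ℝ) - 2*p - a + 2 = M + 2*μ := by push_cast; linarith
  have e6 : ((m+1:ℕ):ℝ) - 2*p - a = M + 2*μ - 2 := by push_cast; linarith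
  have e7 : (2-a)/2 = μ/2 := by linarith
  have e8 : (1-a)/2 = (μ-1)/2 := by linarith
  rw [e1, e2, e3, e4, e5, e6, e7, e8, ← const_match hμ]
  refine ⟨fun f hf G hG hFT => ?_, fun h _ G hG hW ht => ?_⟩
  · exact part1 hμ hM hm hμa hN f hf hG hFT
  · exact part2 hμ hM hm hμa hN hG hW h ht
end
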